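/- For every positive integer t there exists a positive integer τ = τ(t) such that every (theta, prism, K_{1,t})-free graph G satisfies tree-α(G) ≤ τ. -/

import Mathlib

open SimpleGraph

namespace Paper

variable {V : Type}

/-- Two vertex sets are anticomplete: no edges between them. -/
def Anticomplete (G : SimpleGraph V) (A B : Set V) : Prop :=
  ∀ a ∈ A, ∀ b ∈ B, ¬ G.Adj a b

/-- A stable (independent) set of vertices. -/
def StableSet (G : SimpleGraph V) (A : Set V) : Prop :=
  ∀ x ∈ A, ∀ y ∈ A, x ≠ y → ¬ G.Adj x y

/-- A walk is induced in `G`: any two adjacent vertices on it are consecutive. -/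
def InducedWalk (G : SimpleGraph V) {u v : V} (P : G.Walk u v) : Prop :=
  ∀ x ∈ P.support, ∀ y ∈ P.support, G.Adj x y → s(x, y) ∈ P.edges

/-- The interior (set of internal vertices) of a walk from `u` to `v`. -/
def Interior {G : SimpleGraph V} {u v : V} (P : G.Walk u v) : Set V :=
  {w | w ∈ P.support ∧ w ≠ u ∧ w ≠ v}

/-- Closed neighborhood of a set of vertices. -/
def ClosedNbhd (G : SimpleGraph V) (A : Set V) : Set V :=
  A ∪ {v | ∃ a ∈ A, G.Adj v a}

/-- Open neighborhood of a set of vertices. -/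
def OpenNbhd (G : SimpleGraph V) (A : Set V) : Set V :=
  {v | v ∉ A ∧ ∃ a ∈ A, G.Adj v a}

/-- `M` separates `x` and `y` in `G`: there is a separation `(L, M, R)` with `x ∈ L`, `y ∈ R`. -/
def Separates (G : SimpleGraph V) (M : Set V) (x y : V) : Prop :=
  ∃ L R : Set V,
    L ∪ M ∪ R = Set.univ ∧
    Disjoint L M ∧ Disjoint L R ∧ Disjoint M R ∧
    L.Nonempty ∧ R.Nonempty ∧ Anticomplete G L R ∧ x ∈ L ∧ y ∈ R

/-- `G` contains a theta as an induced subgraph. -/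
def ContainsTheta (G : SimpleGraph V) : Prop :=
  ∃ (a b : V) (P₁ P₂ P₃ : G.Walk a b),
    a ≠ b ∧ ¬ G.Adj a b ∧
    P₁.IsPath ∧ P₂.IsPath ∧ P₃.IsPath ∧
    InducedWalk G P₁ ∧ InducedWalk G P₂ ∧ InducedWalk G P₃ ∧
    2 ≤ P₁.length ∧ 2 ≤ P₂.length ∧ 2 ≤ P₃.length ∧
    Disjoint (Interior P₁) (Interior P₂) ∧
    Disjoint (Interior P₁) (Interior P₃) ∧
    Disjoint (Interior P₂) (Interior P₃) ∧
    Anticomplete G (Interior P₁) (Interior P₂) ∧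
    Anticomplete G (Interior P₁) (Interior P₃) ∧
    Anticomplete G (Interior P₂) (Interior P₃)

/-- `G` contains a prism as an induced subgraph (one path may have length zero). -/
def ContainsPrism (G : SimpleGraph V) : Prop :=
  ∃ (a b : Fin 3 → V) (P : ∀ i, G.Walk (a i) (b i)),
    (∀ i j, i ≠ j → G.Adj (a i) (a j)) ∧
    (∀ i j, i ≠ j → G.Adj (b i) (b j)) ∧
    (∀ i, (P i).IsPath) ∧ (∀ i, InducedWalk G (P i)) ∧
    (∀ i j, i ≠ j → ∀ x, x ∈ (P i).support → x ∉ (P j).support) ∧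
    (∀ i j, i ≠ j → ∀ x ∈ (P i).support, ∀ y ∈ (P j).support,
        G.Adj x y → (x = a i ∧ y = a j) ∨ (x = b i ∧ y = b j)) ∧
    (∀ i j, i ≠ j → 2 ≤ (P i).length + (P j).length)

/-- `G` contains `K_{1,t}` as an induced subgraph. -/
def ContainsK1t (G : SimpleGraph V) (t : ℕ) : Prop :=
  ∃ (v : V) (S : Finset V),
    S.card = t ∧ v ∉ S ∧ (∀ x ∈ S, G.Adj v x) ∧ StableSet G ↑S

/-- `G` belongs to the class `C_t` of (theta, prism, `K_{1,t}`)-free graphs. -/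
def MemCt (t : ℕ) (G : SimpleGraph V) : Prop :=
  ¬ ContainsTheta G ∧ ¬ ContainsPrism G ∧ ¬ ContainsK1t G t

/-- A tree decomposition of `G`. -/
structure TreeDecomp (G : SimpleGraph V) where
  ι : Type
  T : SimpleGraph ι
  isTree : T.IsTree
  bag : ι → Set V
  mem_bag : ∀ v : V, ∃ i, v ∈ bag i
  edge_bag : ∀ u v : V, G.Adj u v → ∃ i, u ∈ bag i ∧ v ∈ bag i
  bag_connected : ∀ v : V, (T.induce {i | v ∈ bag i}).Connected

/-- The tree independence number of `G` is at most `k`. -/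
def TreeAlphaLE (G : SimpleGraph V) (k : ℕ) : Prop :=
  ∃ D : TreeDecomp G, ∀ i : D.ι, ∀ S : Finset V,
    ↑S ⊆ D.bag i → StableSet G ↑S → S.card ≤ k

/-- Sum of weights over a vertex set. -/
noncomputable def wSum [Fintype V] (w : V → ℝ) (A : Set V) : ℝ :=
  ∑ v, A.indicator w v

/-- `D` is a connected component of `G \ X`. -/
def IsComponentOf (G : SimpleGraph V) (X D : Set V) : Prop :=
  D.Nonempty ∧ D ⊆ Xᶜ ∧ (G.induce D).Connected ∧
  ∀ D' : Set V, D ⊆ D' → D' ⊆ Xᶜ → (G.induce D').Connected → D' = D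

/-- `X` is a `w`-balanced separator in `G`. -/
def BalancedSeparator [Fintype V] (G : SimpleGraph V) (w : V → ℝ) (X : Set V) : Prop :=
  ∀ D : Set V, IsComponentOf G X D → wSum w D ≤ 1 / 2

/-- A closed walk is a hole (induced cycle of length at least four) in `G`. -/
def IsHoleWalk (G : SimpleGraph V) {h : V} (H : G.Walk h h) : Prop :=
  H.IsCycle ∧ 4 ≤ H.length ∧ InducedWalk G H

/-- The neighbors of `c` on the hole `H`. -/
def HoleNbrs (G : SimpleGraph V) {h : V} (H : G.Walk h h) (c : V) : Set V :=
  {v | v ∈ H.support ∧ G.Adj c v}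

/-- `(H, c)` is a wheel in `G`. -/
def IsWheel (G : SimpleGraph V) {h : V} (H : G.Walk h h) (c : V) : Prop :=
  IsHoleWalk G H ∧ c ∉ H.support ∧ 3 ≤ (HoleNbrs G H c).ncard

/-- `P` is a sector of the wheel `(H, c)`. -/
def IsSector (G : SimpleGraph V) {h : V} (H : G.Walk h h) (c : V)
    {x y : V} (P : G.Walk x y) : Prop :=
  P.IsPath ∧ 0 < P.length ∧
  (∀ w ∈ P.support, w ∈ H.support) ∧
  (∀ e ∈ P.edges, e ∈ H.edges) ∧
  G.Adj c x ∧ G.Adj c y ∧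
  ∀ w ∈ P.support, w ≠ x → w ≠ y → ¬ G.Adj c w

/-- The wheel `(H, c)` is special. -/
def IsSpecialWheel (G : SimpleGraph V) {h : V} (H : G.Walk h h) (c : V) : Prop :=
  IsWheel G H c ∧ ∃ a b d : V,
    a ≠ b ∧ a ≠ d ∧ b ≠ d ∧
    HoleNbrs G H c = {a, b, d} ∧
    s(a, b) ∈ H.edges ∧ s(a, d) ∉ H.edges ∧ s(b, d) ∉ H.edges

/-- `Z(W)` for a non-special wheel `W = (H, c)`. -/
def ZNonSpecial (G : SimpleGraph V) {h : V} (H : G.Walk h h) (c : V) : Set V :=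
  {c} ∪ HoleNbrs G H c

/-- `Z(W)` for a special wheel `W = (H, c)` with length-one sector `ab` and third neighbor `d`. -/
def ZSpecial (G : SimpleGraph V) {h : V} (H : G.Walk h h) (c a b d : V) : Set V :=
  ({a, b, c, d} : Set V) ∪ {v | s(v, d) ∈ H.edges}

/-- A pyramid in `G` with apex `apx`, base `b 0, b 1, b 2` and paths `P i`. -/
def IsPyramid (G : SimpleGraph V) (apx : V) (b : Fin 3 → V)
    (P : ∀ i, G.Walk apx (b i)) : Prop :=
  (∀ i, b i ≠ apx) ∧
  (∀ i j, i ≠ j → G.Adj (b i) (b j)) ∧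
  (∀ i, (P i).IsPath) ∧ (∀ i, InducedWalk G (P i)) ∧
  (∀ i, 1 ≤ (P i).length) ∧
  (∀ i j, i ≠ j → ∀ x, x ∈ (P i).support → x ∈ (P j).support → x = apx) ∧
  (∀ i j, i ≠ j → ∀ x ∈ (P i).support, ∀ y ∈ (P j).support,
      x ≠ apx → y ≠ apx → G.Adj x y → x = b i ∧ y = b j) ∧
  (∀ i j, i ≠ j → 3 ≤ (P i).length + (P j).length)

/-- `Z(Σ)` for a pyramid. -/
def ZPyramid (G : SimpleGraph V) (apx : V) (b : Fin 3 → V)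
    (P : ∀ i, G.Walk apx (b i)) : Set V :=
  {apx} ∪ {v | (∃ i, v ∈ (P i).support) ∧ G.Adj apx v} ∪ Set.range b

/-- `x : Fin k → V` enumerates `X` in an order witnessing that `(P, X)` is an alignment. -/
def AlignmentOrder (G : SimpleGraph V) {p q : V} (P : G.Walk p q)
    (X : Finset V) {k : ℕ} (x : Fin k → V) : Prop :=
  Function.Injective x ∧ (∀ l, x l ∈ X) ∧ (∀ z ∈ X, ∃ l, x l = z) ∧
  ∃ lo hi : Fin k → ℕ,
    (∀ l, lo l ≤ hi l) ∧
    (∀ l m : Fin k, l < m → hi l < lo m) ∧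
    (∀ l, hi l < P.support.length) ∧
    ∀ (l : Fin k) (n : Fin P.support.length),
      G.Adj (x l) (P.support.get n) → lo l ≤ (n : ℕ) ∧ (n : ℕ) ≤ hi l

/-- `(P, X)` is an alignment. -/
def IsAlignment (G : SimpleGraph V) {p q : V} (P : G.Walk p q) (X : Finset V) : Prop :=
  (∀ z ∈ X, z ∉ P.support) ∧
  (∀ z ∈ X, ∃ u ∈ P.support, G.Adj z u) ∧
  ∃ (k : ℕ) (x : Fin k → V), AlignmentOrder G P X x

/-- Every vertex of `X` has two non-adjacent neighbors in `P`. -/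
def WideAl (G : SimpleGraph V) {p q : V} (P : G.Walk p q) (X : Finset V) : Prop :=
  ∀ z ∈ X, ∃ u v : V, u ∈ P.support ∧ v ∈ P.support ∧
    G.Adj z u ∧ G.Adj z v ∧ u ≠ v ∧ ¬ G.Adj u v

/-- Every vertex of `X` has a unique neighbor in `P`. -/
def SpikyAl (G : SimpleGraph V) {p q : V} (P : G.Walk p q) (X : Finset V) : Prop :=
  ∀ z ∈ X, ∃! u : V, u ∈ P.support ∧ G.Adj z u

/-- Every vertex of `X` has exactly two neighbors in `P`, and they are adjacent. -/
def TriangularAl (G : SimpleGraph V) {p q : V} (P : G.Walk p q) (X : Finset V) : Prop :=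
  ∀ z ∈ X, ∃ u v : V, u ∈ P.support ∧ v ∈ P.support ∧
    G.Adj z u ∧ G.Adj z v ∧ u ≠ v ∧ G.Adj u v ∧
    ∀ w ∈ P.support, G.Adj z w → w = u ∨ w = v

/-- `(P, X)` is a consistent alignment. -/
def ConsistentAlignment (G : SimpleGraph V) {p q : V} (P : G.Walk p q) (X : Finset V) : Prop :=
  IsAlignment G P X ∧ (WideAl G P X ∨ SpikyAl G P X ∨ TriangularAl G P X)

/-- A branch vertex of a graph: a vertex of degree at least three. -/
def BranchVtx {W : Type} (T : SimpleGraph W) (v : W) : Prop :=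
  3 ≤ (T.neighborSet v).ncard

/-- `T` is a caterpillar: a tree of maximum degree three, no two branch vertices adjacent,
and some path contains all branch vertices. -/
def IsCaterpillar {W : Type} (T : SimpleGraph W) : Prop :=
  T.IsTree ∧ (∀ v, (T.neighborSet v).ncard ≤ 3) ∧
  (∀ u v, BranchVtx T u → BranchVtx T v → ¬ T.Adj u v) ∧
  ∃ (x y : W) (P : T.Walk x y), P.IsPath ∧ ∀ v, BranchVtx T v → v ∈ P.support

/-- `T` is a subdivided star with root `r`. -/
def IsSubdividedStar {W : Type} (T : SimpleGraph W) (r : W) : Prop :=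
  T.IsTree ∧ 3 ≤ (T.neighborSet r).ncard ∧ ∀ v, v ≠ r → (T.neighborSet v).ncard ≤ 2

/-- `H` is isomorphic to the line graph of a caterpillar. -/
def IsLineCaterpillar {U : Type} (H : SimpleGraph U) : Prop :=
  ∃ (W : Type) (T : SimpleGraph W), IsCaterpillar T ∧ Nonempty (H ≃g T.lineGraph)

/-- `H` is isomorphic to the line graph of a subdivided star. -/
def IsLineSubdividedStar {U : Type} (H : SimpleGraph U) : Prop :=
  ∃ (W : Type) (T : SimpleGraph W) (r : W),
    IsSubdividedStar T r ∧ Nonempty (H ≃g T.lineGraph)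

/-- `v` is a simplicial vertex of `G[S]`. -/
def SimplicialIn (G : SimpleGraph V) (S : Set V) (v : V) : Prop :=
  v ∈ S ∧ ∀ u ∈ S, ∀ w ∈ S, G.Adj v u → G.Adj v w → u ≠ w → G.Adj u w

/-- `G[S]` is one of the four connectifier shapes. -/
def ConnType (G : SimpleGraph V) (S : Set V) : Prop :=
  IsCaterpillar (G.induce S) ∨ IsLineCaterpillar (G.induce S) ∨
  (∃ r, IsSubdividedStar (G.induce S) r) ∨ IsLineSubdividedStar (G.induce S)

/-- `(G[S], X)` is a connectifier. -/
def IsConnectifier (G : SimpleGraph V) (S : Set V) (X : Finset V) : Prop :=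
  (∀ z ∈ X, (z : V) ∉ S) ∧ (∀ z ∈ X, ∃ r ∈ S, G.Adj z r) ∧
  ( (∃ v, S = {v}) ∨
    ( ConnType G S ∧
      (∀ z ∈ X, ∀ r₁ ∈ S, ∀ r₂ ∈ S, G.Adj z r₁ → G.Adj z r₂ → r₁ = r₂) ∧
      (∀ z ∈ X, ∀ r ∈ S, G.Adj z r → SimplicialIn G S r) ∧
      (∀ v, SimplicialIn G S v → ∃ z ∈ X, G.Adj z v) ) )

/-- The connectifier `(G[S], X)` is concentrated. -/
def Concentrated (G : SimpleGraph V) (S : Set V) : Prop :=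
  (∃ v, S = {v}) ∨ (∃ r, IsSubdividedStar (G.induce S) r) ∨
  IsLineSubdividedStar (G.induce S)

/-- Reachability inside a vertex set `A`. -/
def Reaches (G : SimpleGraph V) (A : Set V) (u v : V) : Prop :=
  ∃ (w : G.Walk u v), ∀ z ∈ w.support, z ∈ A

/-- `Pw` is a spine of the caterpillar `G[S]`: a maximal path containing all branch vertices. -/
def IsSpineOf (G : SimpleGraph V) (S : Set V) {p q : V} (Pw : G.Walk p q) : Prop :=
  Pw.IsPath ∧ (∀ w ∈ Pw.support, w ∈ S) ∧
  (∀ v ∈ S, 3 ≤ ({u | u ∈ S ∧ G.Adj v u}).ncard → v ∈ Pw.support) ∧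
  ∀ (p' q' : V) (P' : G.Walk p' q'), P'.IsPath → (∀ w ∈ P'.support, w ∈ S) →
    (∀ w ∈ Pw.support, w ∈ P'.support) → ∀ w ∈ P'.support, w ∈ Pw.support

/-- `Pw` realizes `P(H)` for `H = G[S]`, when `H` is a caterpillar or the line graph
of a caterpillar. -/
def IsPHOf (G : SimpleGraph V) (S : Set V) {p q : V} (Pw : G.Walk p q) : Prop :=
  Pw.IsPath ∧ (∀ w ∈ Pw.support, w ∈ S) ∧
  ( (IsCaterpillar (G.induce S) ∧ IsSpineOf G S Pw) ∨
    (∃ (W : Type) (T : SimpleGraph W) (φ : T.lineGraph ≃g G.induce S)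
        (x y : W) (Q : T.Walk x y),
      IsCaterpillar T ∧ Q.IsPath ∧
      (∀ v, BranchVtx T v → v ∈ Q.support) ∧
      (∀ (x' y' : W) (Q' : T.Walk x' y'), Q'.IsPath →
        (∀ w ∈ Q.support, w ∈ Q'.support) → ∀ w ∈ Q'.support, w ∈ Q.support) ∧
      {w | w ∈ Pw.support} = {v : V | ∃ e : T.edgeSet, (e : Sym2 W) ∈ Q.edges ∧ ↑(φ e) = v}) )

/-- `x` enumerates `X` in the order given by the (non-concentrated) connectifier `(G[S], X)`
with central path `Pw = P(H)`. -/
def ConnectifierOrder (G : SimpleGraph V) (S : Set V) (X : Finset V)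
    {p q : V} (Pw : G.Walk p q) {k : ℕ} (x : Fin k → V) : Prop :=
  Function.Injective x ∧ (∀ l, x l ∈ X) ∧ (∀ z ∈ X, ∃ l, x l = z) ∧
  ∃ (s : Fin k → V) (lo hi : Fin k → ℕ),
    (∀ l, lo l ≤ hi l) ∧ (∀ l m : Fin k, l < m → hi l < lo m) ∧
    (∀ l, hi l < Pw.support.length) ∧
    (∀ (l : Fin k) (n : Fin Pw.support.length),
      G.Adj (s l) (Pw.support.get n) → lo l ≤ (n : ℕ) ∧ (n : ℕ) ≤ hi l) ∧
    ∀ l : Fin k, s l ∈ S ∧ s l ∉ Pw.support ∧ (∃ u ∈ Pw.support, G.Adj (s l) u) ∧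
      ∀ r ∈ S, G.Adj (x l) r → Reaches G (S \ {w | w ∈ Pw.support}) r (s l)

/-- `(G[S], X)` is a consistent alignment (with `G[S]` a path). -/
def ConsistentAlignmentSet (G : SimpleGraph V) (S : Set V) (X : Finset V) : Prop :=
  ∃ (p q : V) (Pw : G.Walk p q), Pw.IsPath ∧ InducedWalk G Pw ∧
    {w | w ∈ Pw.support} = S ∧ ConsistentAlignment G Pw X

/-- The orders on `X` given by `(D1, X)` and by `(G[S], X)` coincide. -/
def OrdersAgree (G : SimpleGraph V) {p q : V} (D1w : G.Walk p q)
    (S : Set V) (X : Finset V) : Prop :=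
  ∃ (k : ℕ) (x : Fin k → V),
    AlignmentOrder G D1w X x ∧
    ( (∃ (p' q' : V) (Pw : G.Walk p' q'), IsPHOf G S Pw ∧ ConnectifierOrder G S X Pw x) ∨
      (∃ (p' q' : V) (Pw : G.Walk p' q'), Pw.IsPath ∧ InducedWalk G Pw ∧
        {w | w ∈ Pw.support} = S ∧ AlignmentOrder G Pw X x) )

/-- `(D1, Y, D2)` is an `s`-trisection of `G`, where `D1` is (the support of) the path `D1w`. -/
def IsTrisection (G : SimpleGraph V) (s : ℕ) {p q : V} (D1w : G.Walk p q)
    (Y D2 : Set V) : Prop :=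
  D1w.IsPath ∧ InducedWalk G D1w ∧
  (∀ w ∈ D1w.support, w ∉ Y ∧ w ∉ D2) ∧ Disjoint Y D2 ∧
  ({w | w ∈ D1w.support} ∪ Y ∪ D2 = Set.univ) ∧
  D2.Nonempty ∧
  (∀ a ∈ D1w.support, ∀ b ∈ D2, ¬ G.Adj a b) ∧
  StableSet G Y ∧ Y.ncard = s ∧
  OpenNbhd G {w | w ∈ D1w.support} = Y ∧ OpenNbhd G D2 = Y ∧
  (∀ y ∈ Y, ∃ d ∈ D1w.support, ∀ z ∈ Y, (G.Adj d z ↔ z = y))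

/-- The conclusion of amiability for the trisection `(D1w, Y, D2)` with parameter `x`:
the pair `(G[S], X)` is "given by amiability". -/
def AmiableOutcome (G : SimpleGraph V) {p q : V} (D1w : G.Walk p q)
    (Y D2 : Set V) (x : ℕ) (S : Set V) (X : Finset V) : Prop :=
  S ⊆ D2 ∧ ↑X ⊆ Y ∧ X.card = x ∧
  ConsistentAlignment G D1w X ∧
  (IsConnectifier G S X ∨ ConsistentAlignmentSet G S X) ∧
  (¬ (IsConnectifier G S X ∧ Concentrated G S) → OrdersAgree G D1w S X)


/-! ### Reachability inside a set -/

theorem Reaches.refl {G : SimpleGraph V} {A : Set V} {u : V} (hu : u ∈ A) : Reaches G A u u :=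
  ⟨.nil, by simpa using hu⟩

theorem Reaches.symm {G : SimpleGraph V} {A : Set V} {u v : V} (h : Reaches G A u v) :
    Reaches G A v u := by
  obtain ⟨w, hw⟩ := h
  exact ⟨w.reverse, by simpa using hw⟩

theorem Reaches.trans {G : SimpleGraph V} {A : Set V} {u v w : V} (h : Reaches G A u v)
    (h' : Reaches G A v w) : Reaches G A u w := by
  obtain ⟨p, hp⟩ := h
  obtain ⟨q, hq⟩ := h'
  refine ⟨p.append q, fun z hz => ?_⟩
  rcases (Walk.mem_support_append_iff _ _).1 hz with h | h
  exacts [hp z h, hq z h]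

theorem Reaches.mono {G : SimpleGraph V} {A B : Set V} {u v : V} (h : Reaches G A u v)
    (hAB : A ⊆ B) : Reaches G B u v := by
  obtain ⟨p, hp⟩ := h
  exact ⟨p, fun z hz => hAB (hp z hz)⟩

theorem Reaches.of_adj {G : SimpleGraph V} {A : Set V} {u v : V} (h : G.Adj u v) (hu : u ∈ A)
    (hv : v ∈ A) : Reaches G A u v :=
  ⟨h.toWalk, by simp [hu, hv]⟩

theorem Reaches.right_mem {G : SimpleGraph V} {A : Set V} {u v : V} (h : Reaches G A u v) :
    v ∈ A := by
  obtain ⟨p, hp⟩ := h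
  exact hp _ p.end_mem_support

theorem Reaches.induction {G : SimpleGraph V} {A : Set V} {u v : V} (h : Reaches G A u v)
    {C : V → Prop} (hu : C u) (hs : ∀ x y, C x → G.Adj x y → y ∈ A → C y) : C v := by
  obtain ⟨p, hp⟩ := h
  induction p with
  | nil => exact hu
  | cons h p ih =>
    refine ih (hs _ _ hu h (hp _ ?_)) (fun z hz => hp z ?_)
    · simp
    · simp [hz]

/-- Every two vertices of `D` are joined by a walk inside `D`. -/
def Conn (G : SimpleGraph V) (D : Set V) : Prop := ∀ u ∈ D, ∀ v ∈ D, Reaches G D u v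

theorem Conn.singleton (G : SimpleGraph V) (v : V) : Conn G {v} := by
  rintro _ rfl _ rfl
  exact .refl rfl

theorem Conn.union {G : SimpleGraph V} {A B : Set V} (hA : Conn G A) (hB : Conn G B) {x y : V}
    (hx : x ∈ A) (hy : y ∈ B) (hxy : x = y ∨ G.Adj x y) : Conn G (A ∪ B) := by
  have key : ∀ u ∈ A ∪ B, Reaches G (A ∪ B) x u := by
    rintro u (hu | hu)
    · exact (hA x hx u hu).mono Set.subset_union_left
    · have h1 := (hB y hy u hu).mono (Set.subset_union_right (s := A))
      rcases hxy with rfl | h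
      · exact h1
      · exact (Reaches.of_adj h (Or.inl hx) (Or.inr hy)).trans h1
  exact fun u hu v hv => (key u hu).symm.trans (key v hv)

theorem Conn.insert {G : SimpleGraph V} {A : Set V} (hA : Conn G A) {x y : V}
    (hy : y ∈ A) (hxy : G.Adj x y) : Conn G (insert x A) :=
  (Conn.singleton G x).union hA rfl hy (Or.inr hxy)

/-- Distinct and pairwise nonadjacent: `A` and `B` are disjoint and anticomplete. -/
def Apart (G : SimpleGraph V) (A B : Set V) : Prop := ∀ x ∈ A, ∀ y ∈ B, x ≠ y ∧ ¬ G.Adj x y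

theorem Apart.symm {G : SimpleGraph V} {A B : Set V} (h : Apart G A B) : Apart G B A :=
  fun x hx y hy => ⟨(h y hy x hx).1.symm, fun e => (h y hy x hx).2 e.symm⟩

theorem Apart.mono {G : SimpleGraph V} {A B A' B' : Set V} (h : Apart G A B) (hA : A' ⊆ A)
    (hB : B' ⊆ B) : Apart G A' B' :=
  fun x hx y hy => h x (hA hx) y (hB hy)

theorem Apart.union_right {G : SimpleGraph V} {A B C : Set V} (h : Apart G A B)
    (h' : Apart G A C) : Apart G A (B ∪ C) := by
  rintro x hx y (hy | hy)
  exacts [h x hx y hy, h' x hx y hy]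

theorem Apart.union_left {G : SimpleGraph V} {A B C : Set V} (h : Apart G A C)
    (h' : Apart G B C) : Apart G (A ∪ B) C :=
  (h.symm.union_right h'.symm).symm

/-! ### Induced paths, thetas and prisms from connected sets -/

theorem InducedWalk.of_cons {G : SimpleGraph V} {u v w : V} {h : G.Adj u v} {p : G.Walk v w}
    (hi : InducedWalk G (.cons h p)) (hp : (Walk.cons h p).IsPath) : InducedWalk G p := by
  have hu := ((Walk.cons_isPath_iff h p).1 hp).2
  intro x hx y hy hxy
  have := hi x (by simp [hx]) y (by simp [hy]) hxy
  rw [Walk.edges_cons, List.mem_cons] at this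
  rcases this with e | e
  · rw [Sym2.eq_iff] at e
    rcases e with ⟨rfl, -⟩ | ⟨-, rfl⟩
    exacts [absurd hx hu, absurd hy hu]
  · exact e

theorem exists_induced_cons {G : SimpleGraph V} {v w : V} (p : G.Walk v w) (hp : p.IsPath)
    (hi : InducedWalk G p) {u : V} (hu : u ∉ p.support) (hx : ∃ x ∈ p.support, G.Adj u x) :
    ∃ q : G.Walk u w, q.IsPath ∧ InducedWalk G q ∧ ∀ z ∈ q.support, z = u ∨ z ∈ p.support := by
  induction p with
  | nil =>
    obtain ⟨x, hx, hux⟩ := hx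
    simp only [Walk.support_nil, List.mem_singleton] at hx hu
    subst hx
    refine ⟨hux.toWalk, by simp [hux.ne], ?_, by simp⟩
    intro a ha b hb hab
    simp only [Walk.support_cons, Walk.support_nil, List.mem_cons, List.not_mem_nil, or_false]
      at ha hb
    rcases ha with rfl | rfl <;> rcases hb with rfl | rfl <;> simp_all [Sym2.eq_swap]
  | cons h p ih =>
    rename_i a b c
    have hp' := (Walk.cons_isPath_iff h p).1 hp
    have hi' := hi.of_cons hp
    simp only [Walk.support_cons, List.mem_cons, not_or] at hu
    by_cases hc : ∃ x ∈ p.support, G.Adj u x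
    · obtain ⟨q, h1, h2, h3⟩ := ih hp'.1 hi' hu.2 hc
      refine ⟨q, h1, h2, fun z hz => ?_⟩
      rcases h3 z hz with h | h <;> simp [h]
    · push Not at hc
      obtain ⟨x, hx, hux⟩ := hx
      rw [Walk.support_cons, List.mem_cons] at hx
      have hua : G.Adj u a := by
        rcases hx with rfl | hx
        exacts [hux, absurd hux (hc x hx)]
      refine ⟨.cons hua (.cons h p), ?_, ?_, by simp⟩
      · rw [Walk.cons_isPath_iff]
        exact ⟨hp, by simp [hu]⟩
      · have key : ∀ y ∈ (Walk.cons h p).support, G.Adj u y → y = a := by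
          intro y hy huy
          rw [Walk.support_cons, List.mem_cons] at hy
          rcases hy with rfl | hy
          exacts [rfl, absurd huy (hc y hy)]
        intro x hx y hy hxy
        rw [Walk.support_cons, List.mem_cons] at hx hy
        rw [Walk.edges_cons, List.mem_cons]
        rcases hx with rfl | hx <;> rcases hy with rfl | hy
        · exact absurd hxy (G.irrefl)
        · rw [key y hy hxy]; simp
        · rw [key x hx hxy.symm]; simp [Sym2.eq_swap]
        · exact Or.inr (hi x hx y hy hxy)

theorem InducedWalk.dropUntil [DecidableEq V] {G : SimpleGraph V} {v w : V} {p : G.Walk v w}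
    (hp : p.IsPath) (hi : InducedWalk G p) {u : V} (hu : u ∈ p.support) :
    InducedWalk G (p.dropUntil u hu) := by
  induction p with
  | nil =>
    intro x hx y hy hxy
    have hx := Walk.support_dropUntil_subset_support _ hu hx
    have hy := Walk.support_dropUntil_subset_support _ hu hy
    simp only [Walk.support_nil, List.mem_singleton] at hx hy
    exact absurd (hx.trans hy.symm) hxy.ne
  | cons h p ih =>
    rename_i a b c
    have hp' := (Walk.cons_isPath_iff h p).1 hp
    have hi' := hi.of_cons hp
    by_cases hua : a = u
    · subst hua
      simpa [Walk.dropUntil] using hi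
    · have : u ∈ p.support := by simpa [Ne.symm hua] using hu
      have := ih hp'.1 hi' this
      simpa [Walk.dropUntil, hua] using this

theorem Reaches.exists_induced {G : SimpleGraph V} {A : Set V} {u v : V} (h : Reaches G A u v) :
    ∃ p : G.Walk u v, p.IsPath ∧ InducedWalk G p ∧ ∀ z ∈ p.support, z ∈ A := by
  classical
  obtain ⟨w, hw⟩ := h
  induction w with
  | nil =>
    refine ⟨.nil, by simp, ?_, hw⟩
    intro x hx y hy hxy
    simp only [Walk.support_nil, List.mem_singleton] at hx hy
    exact absurd (hx.trans hy.symm) hxy.ne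
  | cons h p ih =>
    rename_i a b c
    obtain ⟨q, h1, h2, h3⟩ := ih (fun z hz => hw z (by simp [hz]))
    by_cases ha : a ∈ q.support
    · exact ⟨q.dropUntil a ha, h1.dropUntil ha, h2.dropUntil h1 ha,
        fun z hz => h3 z (Walk.support_dropUntil_subset_support _ ha hz)⟩
    · obtain ⟨r, r1, r2, r3⟩ := exists_induced_cons q h1 h2 ha ⟨b, q.start_mem_support, h⟩
      refine ⟨r, r1, r2, fun z hz => ?_⟩
      rcases r3 z hz with rfl | h
      exacts [hw _ (by simp), h3 z h]

theorem theta_of_sets {G : SimpleGraph V} {a b : V} {A₁ A₂ A₃ : Set V} (hab : a ≠ b)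
    (hadj : ¬ G.Adj a b) (h₁₂ : Apart G A₁ A₂) (h₁₃ : Apart G A₁ A₃) (h₂₃ : Apart G A₂ A₃)
    (h₁ : Reaches G (insert a (insert b A₁)) a b) (h₂ : Reaches G (insert a (insert b A₂)) a b)
    (h₃ : Reaches G (insert a (insert b A₃)) a b) : ContainsTheta G := by
  obtain ⟨p₁, hp₁, hi₁, hs₁⟩ := h₁.exists_induced
  obtain ⟨p₂, hp₂, hi₂, hs₂⟩ := h₂.exists_induced
  obtain ⟨p₃, hp₃, hi₃, hs₃⟩ := h₃.exists_induced
  have hlen : ∀ p : G.Walk a b, 2 ≤ p.length := by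
    intro p
    by_contra! h
    interval_cases h' : p.length
    · exact hab (Walk.eq_of_length_eq_zero h')
    · exact hadj (Walk.adj_of_length_eq_one h')
  have hpath : ∀ (p : G.Walk a b) (A : Set V), (∀ z ∈ p.support, z ∈ insert a (insert b A)) →
      Interior p ⊆ A := by
    rintro p A hs z ⟨hz, hza, hzb⟩
    rcases hs z hz with h | h | h
    exacts [absurd h hza, absurd h hzb, h]
  have hd : ∀ {p q : G.Walk a b} {A B : Set V}, Interior p ⊆ A → Interior q ⊆ B →
      Apart G A B → Disjoint (Interior p) (Interior q) ∧ Anticomplete G (Interior p) (Interior q) :=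
    fun h h' hAB => ⟨Set.disjoint_left.2 fun z hz hz' => (hAB z (h hz) z (h' hz')).1 rfl,
      fun x hx y hy => (hAB x (h hx) y (h' hy)).2⟩
  have i₁ := hpath p₁ A₁ hs₁
  have i₂ := hpath p₂ A₂ hs₂
  have i₃ := hpath p₃ A₃ hs₃
  exact ⟨a, b, p₁, p₂, p₃, hab, hadj, hp₁, hp₂, hp₃, hi₁, hi₂, hi₃, hlen _, hlen _, hlen _,
    (hd i₁ i₂ h₁₂).1, (hd i₁ i₃ h₁₃).1, (hd i₂ i₃ h₂₃).1,
    (hd i₁ i₂ h₁₂).2, (hd i₁ i₃ h₁₃).2, (hd i₂ i₃ h₂₃).2⟩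

/-- The condition on edges between two of the three paths of a prism. -/
def PrismCross (G : SimpleGraph V) (A A' : Set V) (a a' b b' : V) : Prop :=
  ∀ x ∈ A, ∀ y ∈ A', x ≠ y ∧ (G.Adj x y → (x = a ∧ y = a') ∨ (x = b ∧ y = b'))

theorem PrismCross.symm {G : SimpleGraph V} {A A' : Set V} {a a' b b' : V}
    (h : PrismCross G A A' a a' b b') : PrismCross G A' A a' a b' b := by
  intro x hx y hy
  obtain ⟨h1, h2⟩ := h y hy x hx
  refine ⟨h1.symm, fun e => ?_⟩
  rcases h2 e.symm with h | h
  exacts [Or.inl h.symm, Or.inr h.symm]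

theorem prism_of_sets {G : SimpleGraph V} {a₁ a₂ a₃ b₁ b₂ b₃ : V} {A₁ A₂ A₃ : Set V}
    (ha₁₂ : G.Adj a₁ a₂) (ha₁₃ : G.Adj a₁ a₃) (ha₂₃ : G.Adj a₂ a₃)
    (hb₁₂ : G.Adj b₁ b₂) (hb₁₃ : G.Adj b₁ b₃) (hb₂₃ : G.Adj b₂ b₃)
    (h₁ : Reaches G A₁ a₁ b₁) (h₂ : Reaches G A₂ a₂ b₂) (h₃ : Reaches G A₃ a₃ b₃)
    (c₁₂ : PrismCross G A₁ A₂ a₁ a₂ b₁ b₂) (c₁₃ : PrismCross G A₁ A₃ a₁ a₃ b₁ b₃)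
    (c₂₃ : PrismCross G A₂ A₃ a₂ a₃ b₂ b₃) (hne₂ : a₂ ≠ b₂) (hne₃ : a₃ ≠ b₃)
    (hne₁ : a₁ ≠ b₁ ∨ (¬ G.Adj a₂ b₂ ∧ ¬ G.Adj a₃ b₃)) : ContainsPrism G := by
  obtain ⟨p₁, hp₁, hi₁, hs₁⟩ := h₁.exists_induced
  obtain ⟨p₂, hp₂, hi₂, hs₂⟩ := h₂.exists_induced
  obtain ⟨p₃, hp₃, hi₃, hs₃⟩ := h₃.exists_induced
  have cross : ∀ {A A' : Set V} {a a' b b' : V} {p : G.Walk a b} {q : G.Walk a' b'},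
      (∀ z ∈ p.support, z ∈ A) → (∀ z ∈ q.support, z ∈ A') → PrismCross G A A' a a' b b' →
      (∀ x ∈ p.support, x ∉ q.support) ∧ (∀ x ∈ p.support, ∀ y ∈ q.support,
        G.Adj x y → (x = a ∧ y = a') ∨ (x = b ∧ y = b')) :=
    fun hp hq hc => ⟨fun x hx hx' => (hc x (hp x hx) x (hq x hx')).1 rfl,
      fun x hx y hy => (hc x (hp x hx) y (hq y hy)).2⟩
  have l₀ : ∀ {a b : V} (p : G.Walk a b), a ≠ b → 1 ≤ p.length := fun p h => by
    by_contra! h'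
    exact h (Walk.eq_of_length_eq_zero (p := p) (by omega))
  have l₁ : ∀ {a b : V} (p : G.Walk a b), a ≠ b → ¬ G.Adj a b → 2 ≤ p.length := fun p h h' => by
    have h0 := l₀ p h
    by_contra! h1
    exact h' (Walk.adj_of_length_eq_one (p := p) (by omega))
  have hl : 2 ≤ p₁.length + p₂.length ∧ 2 ≤ p₁.length + p₃.length ∧
      2 ≤ p₂.length + p₃.length := by
    have e₂ := l₀ p₂ hne₂
    have e₃ := l₀ p₃ hne₃
    rcases hne₁ with h | ⟨h, h'⟩
    · have e₁ := l₀ p₁ h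
      omega
    · have e₂ := l₁ p₂ hne₂ h
      have e₃ := l₁ p₃ hne₃ h'
      omega
  let P : ∀ i : Fin 3, G.Walk (![a₁, a₂, a₃] i) (![b₁, b₂, b₃] i) := fun i => match i with
    | 0 => p₁
    | 1 => p₂
    | 2 => p₃
  refine ⟨![a₁, a₂, a₃], ![b₁, b₂, b₃], P, ?_, ?_, ?_, ?_, ?_, ?_, ?_⟩
  · intro i j hij
    fin_cases i <;> fin_cases j <;> first | exact absurd rfl hij | simp [*, G.adj_comm]
  · intro i j hij
    fin_cases i <;> fin_cases j <;> first | exact absurd rfl hij | simp [*, G.adj_comm]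
  · intro i
    fin_cases i
    exacts [hp₁, hp₂, hp₃]
  · intro i
    fin_cases i
    exacts [hi₁, hi₂, hi₃]
  · intro i j hij
    fin_cases i <;> fin_cases j <;> first
      | exact absurd rfl hij
      | exact (cross hs₁ hs₂ c₁₂).1
      | exact (cross hs₁ hs₃ c₁₃).1
      | exact (cross hs₂ hs₃ c₂₃).1
      | exact (cross hs₂ hs₁ c₁₂.symm).1
      | exact (cross hs₃ hs₁ c₁₃.symm).1
      | exact (cross hs₃ hs₂ c₂₃.symm).1
  · intro i j hij
    fin_cases i <;> fin_cases j <;> first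
      | exact absurd rfl hij
      | exact (cross hs₁ hs₂ c₁₂).2
      | exact (cross hs₁ hs₃ c₁₃).2
      | exact (cross hs₂ hs₃ c₂₃).2
      | exact (cross hs₂ hs₁ c₁₂.symm).2
      | exact (cross hs₃ hs₁ c₁₃.symm).2
      | exact (cross hs₃ hs₂ c₂₃.symm).2
  · intro i j hij
    have : ∀ k : Fin 3, (P k).length = ![p₁.length, p₂.length, p₃.length] k := by
      intro k
      fin_cases k <;> rfl
    rw [this, this]
    fin_cases i <;> fin_cases j <;> first | exact absurd rfl hij | (simp; omega)

/-! ### Induced sequences -/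

theorem reaches_of_seq {G : SimpleGraph V} {A : Set V} {f : ℕ → V} {i j : ℕ} (hij : i ≤ j)
    (hadj : ∀ k, i ≤ k → k < j → G.Adj (f k) (f (k + 1)))
    (hA : ∀ k, i ≤ k → k ≤ j → f k ∈ A) : Reaches G A (f i) (f j) := by
  induction j, hij using Nat.le_induction with
  | base => exact .refl (hA i le_rfl le_rfl)
  | succ j hij ih =>
    exact (ih (fun k h h' => hadj k h (by omega)) (fun k h h' => hA k h (by omega))).trans
      (.of_adj (hadj j hij (by omega)) (hA j hij (by omega)) (hA (j + 1) (by omega) le_rfl))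

theorem conn_image_Icc {G : SimpleGraph V} {f : ℕ → V} {a b : ℕ}
    (hadj : ∀ k, a ≤ k → k < b → G.Adj (f k) (f (k + 1))) : Conn G (f '' Set.Icc a b) := by
  have key : ∀ i j, a ≤ i → i ≤ j → j ≤ b → Reaches G (f '' Set.Icc a b) (f i) (f j) :=
    fun i j h1 h2 h3 => reaches_of_seq h2 (fun k _ _ => hadj k (by omega) (by omega))
      (fun k _ _ => ⟨k, ⟨by omega, by omega⟩, rfl⟩)
  rintro _ ⟨i, ⟨hi, hi'⟩, rfl⟩ _ ⟨j, ⟨hj, hj'⟩, rfl⟩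
  rcases le_total i j with h | h
  · exact key i j hi h hj'
  · exact (key j i hj h hi').symm

/-- `f 0, …, f n` is an induced path of `G`. -/
def IsIP (G : SimpleGraph V) (f : ℕ → V) (n : ℕ) : Prop :=
  ∀ i j, i < j → j ≤ n → f i ≠ f j ∧ (G.Adj (f i) (f j) ↔ j = i + 1)

namespace IsIP

variable {G : SimpleGraph V} {f : ℕ → V} {n : ℕ}

theorem adj (h : IsIP G f n) {i : ℕ} (hi : i < n) : G.Adj (f i) (f (i + 1)) :=
  (h i (i + 1) (by omega) hi).2.2 rfl

theorem adj_iff (h : IsIP G f n) {i j : ℕ} (hi : i ≤ n) (hj : j ≤ n) :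
    G.Adj (f i) (f j) ↔ j = i + 1 ∨ i = j + 1 := by
  rcases lt_trichotomy i j with hij | rfl | hij
  · rw [(h i j hij hj).2]; omega
  · simp
  · rw [G.adj_comm, (h j i hij hi).2]; omega

theorem inj (h : IsIP G f n) {i j : ℕ} (hi : i ≤ n) (hj : j ≤ n) (e : f i = f j) : i = j := by
  rcases lt_trichotomy i j with hij | rfl | hij
  · exact absurd e (h i j hij hj).1
  · rfl
  · exact absurd e.symm (h j i hij hi).1

theorem mono (h : IsIP G f n) {m : ℕ} (hm : m ≤ n) : IsIP G f m :=
  fun i j hij hj => h i j hij (by omega)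

theorem comp (h : IsIP G f n) {m : ℕ} (g : ℕ → ℕ)
    (hg : ∀ i j, i < j → j ≤ m → g i ≤ n ∧ g j ≤ n ∧ g i ≠ g j ∧
      ((g j = g i + 1 ∨ g i = g j + 1) ↔ j = i + 1)) : IsIP G (fun i => f (g i)) m := by
  intro i j hij hj
  obtain ⟨h1, h2, h3, h4⟩ := hg i j hij hj
  exact ⟨fun e => h3 (h.inj h1 h2 e), by rw [h.adj_iff h1 h2, h4]⟩

theorem shift (h : IsIP G f n) {a m : ℕ} (hm : a + m ≤ n) : IsIP G (fun i => f (a + i)) m :=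
  h.comp _ fun i j hij hj => ⟨by omega, by omega, by omega, by omega⟩

theorem reverse (h : IsIP G f n) {m a : ℕ} (ha : a ≤ n) (hm : m ≤ a) :
    IsIP G (fun i => f (a - i)) m :=
  h.comp _ fun i j hij hj => ⟨by omega, by omega, by omega, by omega⟩

theorem conn (h : IsIP G f n) {a b : ℕ} (hb : b ≤ n) : Conn G (f '' Set.Icc a b) :=
  conn_image_Icc fun _ _ hk => h.adj (by omega)

theorem apart (h : IsIP G f n) {a b c d : ℕ} (hbc : b + 2 ≤ c) (hd : d ≤ n) :
    Apart G (f '' Set.Icc a b) (f '' Set.Icc c d) := by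
  rintro _ ⟨i, ⟨hi, hi'⟩, rfl⟩ _ ⟨j, ⟨hj, hj'⟩, rfl⟩
  obtain ⟨h1, h2⟩ := h i j (by omega) (by omega)
  exact ⟨h1, by rw [h2]; omega⟩

end IsIP

theorem exists_isIP {G : SimpleGraph V} {A : Set V} {T : V → Prop} {u v : V}
    (h : Reaches G A u v) (hv : T v) : ∃ n f, f 0 = u ∧ T (f n) ∧ (∀ i ≤ n, f i ∈ A) ∧
      IsIP G f n ∧ ∀ i < n, ¬ T (f i) := by
  classical
  have hex : ∃ n, ∃ f : ℕ → V, f 0 = u ∧ T (f n) ∧ (∀ i ≤ n, f i ∈ A) ∧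
      ∀ i < n, G.Adj (f i) (f (i + 1)) := by
    obtain ⟨w, hw⟩ := h
    exact ⟨w.length, w.getVert, by simp, by simpa using hv,
      fun i _ => hw _ (w.getVert_mem_support i), fun i hi => w.adj_getVert_succ hi⟩
  obtain ⟨f, h0, hT, hA, hadj⟩ := Nat.find_spec hex
  have hmin : ∀ m < Nat.find hex, ¬ _ := fun m hm => Nat.find_min hex hm
  set n := Nat.find hex
  have splice : ∀ i d, 0 < d → i + d ≤ n → (i + d < n → G.Adj (f i) (f (i + d + 1))) →
      (i + d = n → T (f i)) → False := by
    intro i d hd hid hl hT'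
    refine hmin (n - d) (by omega) ⟨fun k => if k ≤ i then f k else f (k + d), ?_, ?_, ?_, ?_⟩
    · simpa using h0
    · dsimp only
      split_ifs with hk
      · rw [show n - d = i by omega]; exact hT' (by omega)
      · rwa [show n - d + d = n by omega]
    · intro k hk
      dsimp only
      split_ifs
      exacts [hA _ (by omega), hA _ (by omega)]
    · intro k hk
      dsimp only
      rcases lt_trichotomy k i with hki | rfl | hki
      · rw [if_pos (by omega), if_pos (by omega)]; exact hadj k (by omega)
      · rw [if_pos le_rfl, if_neg (by omega), show k + 1 + d = k + d + 1 by omega]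
        exact hl (by omega)
      · rw [if_neg (by omega), if_neg (by omega), show k + 1 + d = k + d + 1 by omega]
        exact hadj _ (by omega)
  refine ⟨n, f, h0, hT, hA, fun i j hij hj => ⟨fun e => ?_, fun e => ?_, ?_⟩, fun i hi hTi => ?_⟩
  · refine splice i (j - i) (by omega) (by omega) (fun h => ?_) (fun h => ?_)
    · rw [e, show i + (j - i) + 1 = j + 1 by omega]; exact hadj j (by omega)
    · rw [e, show j = n by omega]; exact hT
  · by_contra hne
    refine splice i (j - i - 1) (by omega) (by omega) (fun h => ?_) (fun h => by omega)
    rwa [show i + (j - i - 1) + 1 = j by omega]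
  · rintro rfl
    exact hadj i (by omega)
  · exact splice i (n - i) (by omega) (by omega) (fun h => by omega) (fun _ => hTi)

/-- A vertex `c` adjacent to both ends of an induced path, and a vertex `r` joined to `c` by a path
away from it, give a theta unless `r` has exactly two neighbours on the path, and these are
consecutive. -/
theorem star_theta {G : SimpleGraph V} {f : ℕ → V} {M : ℕ} (hf : IsIP G f M) {c r : V}
    (hc : ∀ i ≤ M, f i ≠ c) (hc0 : G.Adj c (f 0)) (hcM : G.Adj c (f M))
    (hr : ∀ i ≤ M, f i ≠ r) (hcr : c ≠ r) (hrc : ¬ G.Adj r c) {E : Set V}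
    (hE : ∀ e ∈ E, ∀ i ≤ M, e ≠ f i ∧ ¬ G.Adj e (f i))
    (hreach : Reaches G (insert r (insert c E)) r c) (hrt : ∃ i ≤ M, G.Adj r (f i))
    (hsep : ∀ i ≤ M, G.Adj r (f i) → ¬ G.Adj c (f i))
    (htri : ¬ ∃ u, u + 1 ≤ M ∧ ∀ i ≤ M, G.Adj r (f i) ↔ i = u ∨ i = u + 1) :
    ContainsTheta G := by
  classical
  obtain ⟨u, ⟨huM, hu⟩, humin⟩ : ∃ u, (u ≤ M ∧ G.Adj r (f u)) ∧
      ∀ i, i ≤ M → G.Adj r (f i) → u ≤ i :=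
    ⟨Nat.find hrt, Nat.find_spec hrt, fun i h h' => Nat.find_min' hrt ⟨h, h'⟩⟩
  obtain ⟨v, ⟨hvM, hv⟩, hvmax⟩ : ∃ v, (v ≤ M ∧ G.Adj r (f v)) ∧
      ∀ i, i ≤ M → G.Adj r (f i) → i ≤ v :=
    ⟨_, Nat.findGreatest_spec (P := fun i => i ≤ M ∧ G.Adj r (f i)) huM ⟨huM, hu⟩,
      fun i h h' => Nat.le_findGreatest h ⟨h, h'⟩⟩
  have hu0 : 0 < u := by
    rcases Nat.eq_zero_or_pos u with rfl | h
    exacts [absurd hc0 (hsep 0 huM hu), h]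
  have hvM' : v < M := by
    rcases Nat.lt_or_ge v M with h | h
    · exact h
    · obtain rfl : v = M := by omega
      exact absurd hcM (hsep _ hvM hv)
  have huv := humin v hvM hv
  rcases Nat.eq_or_lt_of_le huv with rfl | huv
  · have honly : ∀ i ≤ M, G.Adj r (f i) → i = u := fun i h h' =>
      le_antisymm (hvmax i h h') (humin i h h')
    have apE : ∀ a b, b ≤ M → (u < a ∨ b < u) →
        Apart G (f '' Set.Icc a b) (insert r E) := by
      rintro a b hb hab _ ⟨i, ⟨hi, hi'⟩, rfl⟩ y (rfl | hy)
      · refine ⟨hr i (by omega), fun e => ?_⟩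
        have := honly i (by omega) e.symm
        omega
      · have := hE y hy i (by omega)
        exact ⟨this.1.symm, fun e => this.2 e.symm⟩
    refine theta_of_sets (a := f u) (b := c) (A₁ := f '' Set.Icc 0 (u - 1))
      (A₂ := f '' Set.Icc (u + 1) M) (A₃ := insert r E) (hc u huM)
      (fun e => hsep u huM hu e.symm) (hf.apart (by omega) le_rfl)
      (apE _ _ (by omega) (by omega)) (apE _ _ le_rfl (by omega)) ?_ ?_ ?_
    · refine Reaches.symm (Reaches.trans (.of_adj hc0 (by simp) ?_)
        (reaches_of_seq (Nat.zero_le u) (fun k _ hk => hf.adj (by omega)) fun k _ hk => ?_))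
      · exact Or.inr (Or.inr ⟨0, ⟨le_rfl, by omega⟩, rfl⟩)
      · rcases Nat.eq_or_lt_of_le hk with rfl | hk
        exacts [Or.inl rfl, Or.inr (Or.inr ⟨k, ⟨by omega, by omega⟩, rfl⟩)]
    · refine Reaches.trans (reaches_of_seq huM (fun k _ hk => hf.adj (by omega)) fun k hk _ => ?_)
        (.of_adj hcM.symm ?_ (by simp))
      · rcases Nat.eq_or_lt_of_le hk with rfl | hk
        exacts [Or.inl rfl, Or.inr (Or.inr ⟨k, ⟨by omega, by omega⟩, rfl⟩)]
      · exact Or.inr (Or.inr ⟨M, ⟨by omega, by omega⟩, rfl⟩)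
    · refine Reaches.trans (.of_adj hu.symm (by simp) (by simp)) (hreach.mono ?_)
      rintro x (rfl | rfl | hx)
      exacts [by simp, by simp, Or.inr (Or.inr (Or.inr hx))]
  · have hgap : u + 2 ≤ v := by
      by_contra! h
      obtain rfl : v = u + 1 := by omega
      refine htri ⟨u, hvM, fun i hi => ⟨fun e => ?_, ?_⟩⟩
      · have := humin i hi e
        have := hvmax i hi e
        omega
      · rintro (rfl | rfl)
        exacts [hu, hv]
    have apE : ∀ a b, b ≤ M → Apart G (f '' Set.Icc a b) E := by
      rintro a b hb _ ⟨i, ⟨hi, hi'⟩, rfl⟩ y hy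
      have := hE y hy i (by omega)
      exact ⟨this.1.symm, fun e => this.2 e.symm⟩
    refine theta_of_sets (a := r) (b := c) (A₁ := f '' Set.Icc 0 u)
      (A₂ := f '' Set.Icc v M) (A₃ := E) hcr.symm hrc (hf.apart hgap le_rfl)
      (apE _ _ huM) (apE _ _ le_rfl) ?_ ?_ hreach
    · refine Reaches.symm (Reaches.trans (.of_adj hc0 (by simp) ?_)
        (Reaches.trans (reaches_of_seq (Nat.zero_le u) (fun k _ hk => hf.adj (by omega))
          fun k _ hk => ?_) (.of_adj hu.symm ?_ (by simp))))
      · exact Or.inr (Or.inr ⟨0, ⟨le_rfl, by omega⟩, rfl⟩)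
      · exact Or.inr (Or.inr ⟨k, ⟨by omega, by omega⟩, rfl⟩)
      · exact Or.inr (Or.inr ⟨u, ⟨by omega, by omega⟩, rfl⟩)
    · refine Reaches.trans (.of_adj hv (by simp) ?_)
        (Reaches.trans (reaches_of_seq hvM (fun k _ hk => hf.adj (by omega))
          fun k hk _ => ?_) (.of_adj hcM.symm ?_ (by simp)))
      · exact Or.inr (Or.inr ⟨v, ⟨by omega, by omega⟩, rfl⟩)
      · exact Or.inr (Or.inr ⟨k, ⟨by omega, by omega⟩, rfl⟩)
      · exact Or.inr (Or.inr ⟨M, ⟨by omega, by omega⟩, rfl⟩)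

/-! ### Shortest links between labelled sets -/

/-- `v` has a neighbour in `S z`. -/
def Touches {L : Type} (G : SimpleGraph V) (S : L → Set V) (v : V) (z : L) : Prop :=
  ∃ s ∈ S z, G.Adj v s

/-- A sequence `r 0, …, r k` in `U`, avoiding all the sets `S z`, from a vertex touching `S x` to a
vertex touching `S y`. -/
structure IsLink {L : Type} (G : SimpleGraph V) (S : L → Set V) (U : Set V) (x y : L) (k : ℕ)
    (r : ℕ → V) : Prop where
  ne : x ≠ y
  mem : ∀ i ≤ k, r i ∈ U
  notMem : ∀ i ≤ k, ∀ z, r i ∉ S z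
  adj : ∀ i < k, G.Adj (r i) (r (i + 1))
  first : Touches G S (r 0) x
  last : Touches G S (r k) y

theorem exists_isLink {L : Type} {G : SimpleGraph V} {S : L → Set V} {U D : Set V}
    (hS : ∀ x y, x ≠ y → ∀ u ∈ S x, u ∈ U → ∀ v ∈ S y, u ≠ v ∧ ¬ G.Adj u v)
    (hD : Conn G D) (hDU : D ⊆ U) {x₀ y₀ : L} (hxy : x₀ ≠ y₀) (hx : (S x₀ ∩ D).Nonempty)
    (hy : (S y₀ ∩ D).Nonempty) : ∃ x y k r, IsLink G S U x y k r ∧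
      ((∀ i ≤ k, ∀ z, Touches G S (r i) z → (i = 0 ∧ z = x) ∨ (i = k ∧ z = y)) ∨
        (k = 0 ∧ ∃ z, z ≠ x ∧ z ≠ y ∧ Touches G S (r 0) z)) := by
  classical
  let near : V → L → Prop := fun v z => ∃ s ∈ S z, v = s ∨ G.Adj v s
  have hex : ∃ n, ∃ (f : ℕ → V) (x y : L), x ≠ y ∧ near (f 0) x ∧ near (f n) y ∧
      (∀ i ≤ n, f i ∈ U) ∧ ∀ i < n, G.Adj (f i) (f (i + 1)) := by
    obtain ⟨u, hu, huD⟩ := hx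
    obtain ⟨v, hv, hvD⟩ := hy
    obtain ⟨w, hw⟩ := hD u huD v hvD
    exact ⟨w.length, w.getVert, x₀, y₀, hxy, ⟨u, hu, by simp⟩, ⟨v, hv, by simp⟩,
      fun i _ => hDU (hw _ (w.getVert_mem_support i)), fun i hi => w.adj_getVert_succ hi⟩
  obtain ⟨r, x, y, hne, h0, hk, hU, hadj⟩ := Nat.find_spec hex
  have hmin : ∀ m < Nat.find hex, ¬ _ := fun m hm => Nat.find_min hex hm
  set k := Nat.find hex
  have hl : ∀ i ≤ k, ∀ z, near (r i) z → z ≠ x → i = k := by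
    intro i hi z hz hzx
    by_contra hik
    exact hmin i (by omega) ⟨r, x, z, hzx.symm, h0, hz, fun j _ => hU j (by omega),
      fun j _ => hadj j (by omega)⟩
  have hr : ∀ i ≤ k, ∀ z, near (r i) z → z ≠ y → i = 0 := by
    intro i hi z hz hzy
    by_contra hi0
    refine hmin (k - i) (by omega) ⟨fun j => r (i + j), z, y, hzy, hz, ?_,
      fun j _ => hU _ (by omega), fun j _ => hadj _ (by omega)⟩
    show near (r (i + (k - i))) y
    rwa [show i + (k - i) = k by omega]
  have hnot : ∀ i ≤ k, ∀ z, r i ∉ S z := by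
    intro i hi z hz
    have hnear : near (r i) z := ⟨_, hz, Or.inl rfl⟩
    have hzero : ∀ z', near (r i) z' → z' = z := by
      rintro z' ⟨s, hs, e⟩
      by_contra hzz
      have := hS z z' (Ne.symm hzz) _ hz (hU i hi) s hs
      tauto
    by_cases hzx : z = x
    · have hzy : z ≠ y := hzx ▸ hne
      obtain rfl := hr i hi z hnear hzy
      rcases Nat.eq_zero_or_pos k with h | h
      · rw [h] at hk
        exact hzy (hzero y hk).symm
      · have := hr 1 h z ⟨_, hz, Or.inr (hadj 0 h).symm⟩ hzy
        omega
    · obtain rfl := hl i hi z hnear hzx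
      rcases Nat.eq_zero_or_pos k with h | h
      · rw [← h] at h0
        exact hzx (hzero x h0).symm
      · have h1 := hadj (k - 1) (by omega)
        rw [show k - 1 + 1 = k by omega] at h1
        have := hl (k - 1) (by omega) z ⟨_, hz, Or.inr h1⟩ hzx
        omega
  have htouch : ∀ i ≤ k, ∀ z, near (r i) z → Touches G S (r i) z := by
    rintro i hi z ⟨s, hs, rfl | h⟩
    exacts [absurd hs (hnot i hi z), ⟨s, hs, h⟩]
  refine ⟨x, y, k, r, ⟨hne, hU, hnot, hadj, htouch _ (by omega) _ h0, htouch _ le_rfl _ hk⟩, ?_⟩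
  by_cases hthird : k = 0 ∧ ∃ z, z ≠ x ∧ z ≠ y ∧ Touches G S (r 0) z
  · exact Or.inr hthird
  · refine Or.inl fun i hi z hz => ?_
    have hz' : near (r i) z := by
      obtain ⟨s, hs, h⟩ := hz
      exact ⟨s, hs, Or.inr h⟩
    by_cases hzx : z = x
    · exact Or.inl ⟨hr i hi z hz' (hzx ▸ hne), hzx⟩
    · by_cases hzy : z = y
      · exact Or.inr ⟨hl i hi z hz' hzx, hzy⟩
      · have e1 := hl i hi z hz' hzx
        have e2 := hr i hi z hz' hzy
        subst e2
        exact absurd ⟨e1.symm, z, hzx, hzy, hz⟩ hthird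

theorem IsLink.reverse {L : Type} {G : SimpleGraph V} {S : L → Set V} {U : Set V} {x y : L}
    {k : ℕ} {r : ℕ → V} (h : IsLink G S U x y k r) :
    IsLink G S U y x k (fun i => r (k - i)) where
  ne := h.ne.symm
  mem i _ := h.mem _ (by omega)
  notMem i _ := h.notMem _ (by omega)
  adj i hi := by
    have := h.adj (k - (i + 1)) (by omega)
    rw [show k - (i + 1) + 1 = k - i by omega] at this
    exact this.symm
  first := by simpa using h.last
  last := by simpa using h.first

/-! ### Pyramids -/

/-- Three legs `f i 0, …, f i (n i)` forming a pyramid with apex `a`. -/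
structure IsPyr (G : SimpleGraph V) (a : V) (f : Fin 3 → ℕ → V) (n : Fin 3 → ℕ) : Prop where
  zero : ∀ i, f i 0 = a
  ip : ∀ i, IsIP G (f i) (n i)
  pos : ∀ i, 1 ≤ n i
  cross : ∀ i j, i ≠ j → ∀ s t, 1 ≤ s → s ≤ n i → 1 ≤ t → t ≤ n j →
    f i s ≠ f j t ∧ (G.Adj (f i s) (f j t) ↔ s = n i ∧ t = n j)

/-- The apex of a pyramid, its neighbours on the legs, and the base. -/
def pyrCore (a : V) (f : Fin 3 → ℕ → V) (n : Fin 3 → ℕ) : Set V :=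
  {a} ∪ (Set.range fun i => f i 1) ∪ Set.range fun i => f i (n i)

theorem IsPyr.not_conn {G : SimpleGraph V} (hθ : ¬ ContainsTheta G) (hpr : ¬ ContainsPrism G)
    {a : V} {f : Fin 3 → ℕ → V} {n : Fin 3 → ℕ} (h : IsPyr G a f n) {D : Set V} (hD : Conn G D)
    (hDZ : Apart G D (pyrCore a f n)) {i₀ j₀ : Fin 3} (hij : i₀ ≠ j₀) {s₀ t₀ : ℕ}
    (hs₀ : s₀ ≤ n i₀) (ht₀ : t₀ ≤ n j₀) (hs : f i₀ s₀ ∈ D) (ht : f j₀ t₀ ∈ D) : False := by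
  set Z := pyrCore a f n with hZ
  have haZ : a ∈ Z := Or.inl (Or.inl rfl)
  have h1Z : ∀ i, f i 1 ∈ Z := fun i => Or.inl (Or.inr ⟨i, rfl⟩)
  have hnZ : ∀ i, f i (n i) ∈ Z := fun i => Or.inr ⟨i, rfl⟩
  let U : Set V := {x | ∀ z ∈ Z, x ≠ z ∧ ¬ G.Adj x z}
  have hDU : D ⊆ U := fun x hx => hDZ x hx
  let S : Fin 3 → Set V := fun i => {v | ∃ s, 2 ≤ s ∧ s + 1 ≤ n i ∧ v = f i s}
  have hmid : ∀ i s, s ≤ n i → f i s ∈ U → 2 ≤ s ∧ s + 1 ≤ n i := by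
    intro i s hs hU
    have e0 : s ≠ 0 := by rintro rfl; exact (hU a haZ).1 (h.zero i)
    have e1 : s ≠ 1 := by rintro rfl; exact (hU _ (h1Z i)).1 rfl
    have e2 : s ≠ n i := by rintro rfl; exact (hU _ (hnZ i)).1 rfl
    omega
  have hS : ∀ x y, x ≠ y → ∀ u ∈ S x, u ∈ U → ∀ v ∈ S y, u ≠ v ∧ ¬ G.Adj u v := by
    rintro x y hxy _ ⟨s, hs, hs', rfl⟩ - _ ⟨t, ht, ht', rfl⟩
    obtain ⟨c1, c2⟩ := h.cross x y hxy s t (by omega) (by omega) (by omega) (by omega)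
    exact ⟨c1, by rw [c2]; omega⟩
  obtain ⟨i, j, k, r, hl, hcase⟩ := exists_isLink hS hD hDU hij
    ⟨_, ⟨s₀, (hmid _ _ hs₀ (hDU hs)).1, (hmid _ _ hs₀ (hDU hs)).2, rfl⟩, hs⟩
    ⟨_, ⟨t₀, (hmid _ _ ht₀ (hDU ht)).1, (hmid _ _ ht₀ (hDU ht)).2, rfl⟩, ht⟩
  have hrne : ∀ m ≤ k, ∀ i s, s ≤ n i → r m ≠ f i s := by
    intro m hm i s hs e
    have hU := hl.mem m hm
    obtain ⟨h1, h2⟩ := hmid i s hs (e ▸ hU)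
    exact hl.notMem m hm i ⟨s, h1, h2, e⟩
  have hradj : ∀ m ≤ k, ∀ i s, s ≤ n i → G.Adj (r m) (f i s) →
      2 ≤ s ∧ s + 1 ≤ n i ∧ Touches G S (r m) i := by
    intro m hm i s hs e
    have hU := hl.mem m hm
    have e0 : s ≠ 0 := by rintro rfl; exact (hU a haZ).2 (h.zero i ▸ e)
    have e1 : s ≠ 1 := by rintro rfl; exact (hU _ (h1Z i)).2 e
    have e2 : s ≠ n i := by rintro rfl; exact (hU _ (hnZ i)).2 e
    exact ⟨by omega, by omega, f i s, ⟨s, by omega, by omega, rfl⟩, e⟩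
  have hra : ∀ m ≤ k, a ≠ r m ∧ ¬ G.Adj a (r m) := fun m hm =>
    ⟨(hl.mem m hm a haZ).1.symm, fun e => (hl.mem m hm a haZ).2 e.symm⟩
  rcases hcase with hsolo | ⟨rfl, l, hli, hlj, hlt⟩
  swap
  · have hall : ∀ x y z w : Fin 3, x ≠ y → z ≠ x → z ≠ y → w = x ∨ w = y ∨ w = z := by decide
    have htouch : ∀ w, Touches G S (r 0) w := by
      intro w
      rcases hall i j l w hl.ne hli hlj with rfl | rfl | rfl
      exacts [hl.first, hl.last, hlt]
    have hap : ∀ x y, x ≠ y →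
        Apart G (f x '' Set.Icc 1 (n x - 1)) (f y '' Set.Icc 1 (n y - 1)) := by
      rintro x y hxy _ ⟨s, ⟨hs, hs'⟩, rfl⟩ _ ⟨t, ⟨ht, ht'⟩, rfl⟩
      have := h.pos x
      have := h.pos y
      obtain ⟨c1, c2⟩ := h.cross x y hxy s t (by omega) (by omega) (by omega) (by omega)
      exact ⟨c1, by rw [c2]; omega⟩
    have hre : ∀ x, Reaches G (insert a (insert (r 0) (f x '' Set.Icc 1 (n x - 1)))) a (r 0) := by
      intro x
      obtain ⟨_, ⟨s, hs, hs', rfl⟩, e⟩ := htouch x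
      have h1 : Reaches G (insert a (insert (r 0) (f x '' Set.Icc 1 (n x - 1)))) (f x 0)
          (f x s) := by
        refine reaches_of_seq (Nat.zero_le s) (fun m _ hm => (h.ip x).adj (by omega)) ?_
        intro m _ hm
        rcases Nat.eq_zero_or_pos m with rfl | h0
        · exact Or.inl (h.zero x)
        · exact Or.inr (Or.inr ⟨m, ⟨h0, by omega⟩, rfl⟩)
      rw [h.zero x] at h1
      exact h1.trans (.of_adj e.symm (Or.inr (Or.inr ⟨s, ⟨by omega, by omega⟩, rfl⟩)) (by simp))
    exact hθ (theta_of_sets (hra 0 le_rfl).1 (hra 0 le_rfl).2 (hap 0 1 (by decide))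
      (hap 0 2 (by decide)) (hap 1 2 (by decide)) (hre 0) (hre 1) (hre 2))
  · obtain ⟨l, hli, hlj⟩ : ∃ l : Fin 3, l ≠ i ∧ l ≠ j := by
      have : ∀ i j : Fin 3, ∃ l, l ≠ i ∧ l ≠ j := by decide
      exact this i j
    have hne := hl.ne
    have ri : ∀ m ≤ k, ∀ s ≤ n i, G.Adj (r m) (f i s) → m = 0 := by
      intro m hm s hs e
      have := hsolo m hm i (hradj m hm i s hs e).2.2
      tauto
    have rl : ∀ m ≤ k, ∀ s ≤ n l, ¬ G.Adj (r m) (f l s) := by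
      intro m hm s hs e
      have := hsolo m hm l (hradj m hm l s hs e).2.2
      tauto
    obtain ⟨_, ⟨sj, hsj, hsj', rfl⟩, ej⟩ := hl.last
    have hpi := h.pos i
    have hpj := h.pos j
    have hpl := h.pos l
    have tri : ∃ u, 2 ≤ u ∧ u + 2 ≤ n i ∧ ∀ s ≤ n i, G.Adj (r 0) (f i s) ↔ s = u ∨ s = u + 1 := by
      by_contra hn
      apply hθ
      let p : ℕ → V := fun t => if t < n i then f i (t + 1) else f l (n i + n l - t)
      have p1 : ∀ t, t < n i → p t = f i (t + 1) := fun t ht => if_pos ht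
      have p2 : ∀ t, n i ≤ t → p t = f l (n i + n l - t) := fun t ht => if_neg (by omega)
      have hp : IsIP G p (n i + n l - 1) := by
        intro s t hst ht
        rcases Nat.lt_or_ge t (n i) with h1 | h1
        · rw [p1 s (by omega), p1 t h1]
          obtain ⟨c1, c2⟩ := h.ip i (s + 1) (t + 1) (by omega) (by omega)
          exact ⟨c1, by rw [c2]; omega⟩
        · rcases Nat.lt_or_ge s (n i) with h2 | h2
          · rw [p1 s h2, p2 t h1]
            obtain ⟨c1, c2⟩ := h.cross i l hli.symm (s + 1) (n i + n l - t) (by omega) (by omega)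
              (by omega) (by omega)
            exact ⟨c1, by rw [c2]; omega⟩
          · rw [p2 s h2, p2 t h1]
            obtain ⟨c1, c2⟩ := h.ip l (n i + n l - t) (n i + n l - s) (by omega) (by omega)
            exact ⟨c1.symm, by rw [G.adj_comm, c2]; omega⟩
      have pcase : ∀ t ≤ n i + n l - 1, (t + 1 ≤ n i ∧ p t = f i (t + 1)) ∨
          ∃ s, 1 ≤ s ∧ s ≤ n l ∧ p t = f l s := by
        intro t ht
        rcases Nat.lt_or_ge t (n i) with h1 | h1
        · exact Or.inl ⟨h1, p1 t h1⟩
        · exact Or.inr ⟨_, by omega, by omega, p2 t h1⟩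
      have ha : ∀ x s, s ≤ n x → 1 ≤ s → f x s ≠ a ∧ (G.Adj a (f x s) ↔ s = 1) := by
        intro x s hs hs1
        rw [← h.zero x]
        obtain ⟨c1, c2⟩ := h.ip x 0 s (by omega) hs
        exact ⟨c1.symm, by rw [c2]⟩
      refine star_theta hp (c := a) (r := r 0)
        (E := r '' Set.Icc 1 k ∪ f j '' Set.Icc 1 (n j - 1)) ?_ ?_ ?_ ?_ (hra 0 (by omega)).1
        (fun e => (hra 0 (by omega)).2 e.symm) ?_ ?_ ?_ ?_ ?_
      · intro t ht
        rcases pcase t ht with ⟨h1, e⟩ | ⟨s, h1, h2, e⟩ <;> rw [e]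
        exacts [(ha _ _ h1 (by omega)).1, (ha _ _ h2 h1).1]
      · rw [p1 0 (by omega)]
        exact (ha _ _ (by omega) (by omega)).2.2 rfl
      · rw [p2 _ (by omega), show n i + n l - (n i + n l - 1) = 1 by omega]
        exact (ha _ _ (by omega) (by omega)).2.2 rfl
      · intro t ht
        rcases pcase t ht with ⟨h1, e⟩ | ⟨s, h1, h2, e⟩ <;> rw [e]
        exacts [(hrne 0 (by omega) _ _ h1).symm, (hrne 0 (by omega) _ _ h2).symm]
      · rintro _ (⟨m, ⟨hm, hm'⟩, rfl⟩ | ⟨m, ⟨hm, hm'⟩, rfl⟩) t ht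
        · rcases pcase t ht with ⟨h1, e⟩ | ⟨s, h1, h2, e⟩ <;> rw [e]
          · refine ⟨hrne m hm' _ _ h1, fun e' => ?_⟩
            have := ri m hm' _ h1 e'
            omega
          · exact ⟨hrne m hm' _ _ h2, rl m hm' _ h2⟩
        · rcases pcase t ht with ⟨h1, e⟩ | ⟨s, h1, h2, e⟩ <;> rw [e]
          · obtain ⟨c1, c2⟩ := h.cross j i hne.symm m (t + 1) hm (by omega) (by omega) h1
            exact ⟨c1, by rw [c2]; omega⟩
          · obtain ⟨c1, c2⟩ := h.cross j l hlj.symm m s hm (by omega) (by omega) h2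
            exact ⟨c1, by rw [c2]; omega⟩
      · have hr : Reaches G
            (insert (r 0) (insert a (r '' Set.Icc 1 k ∪ f j '' Set.Icc 1 (n j - 1))))
            (r 0) (r k) := by
          refine reaches_of_seq (Nat.zero_le k) (fun m _ hm => hl.adj m hm) fun m _ hm => ?_
          rcases Nat.eq_zero_or_pos m with rfl | h0
          · exact Or.inl rfl
          · exact Or.inr (Or.inr (Or.inl ⟨m, ⟨h0, hm⟩, rfl⟩))
        have hfj : Reaches G
            (insert (r 0) (insert a (r '' Set.Icc 1 k ∪ f j '' Set.Icc 1 (n j - 1))))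
            (f j 0) (f j sj) := by
          refine reaches_of_seq (Nat.zero_le sj) (fun m _ hm => (h.ip j).adj (by omega))
            fun m _ hm => ?_
          rcases Nat.eq_zero_or_pos m with rfl | h0
          · exact Or.inr (Or.inl (h.zero j))
          · exact Or.inr (Or.inr (Or.inr ⟨m, ⟨h0, by omega⟩, rfl⟩))
        have := hr.trans ((Reaches.of_adj ej hr.right_mem hfj.right_mem).trans hfj.symm)
        rwa [h.zero j] at this
      · obtain ⟨_, ⟨s, hs, hs', rfl⟩, e⟩ := hl.first
        refine ⟨s - 1, by omega, ?_⟩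
        rwa [p1 _ (by omega), show s - 1 + 1 = s by omega]
      · intro t ht e
        rcases pcase t ht with ⟨h1, e'⟩ | ⟨s, h1, h2, e'⟩ <;> rw [e'] at e ⊢
        · have := hradj 0 (by omega) i _ h1 e
          rw [(ha _ _ h1 (by omega)).2]
          omega
        · exact absurd e (rl 0 (by omega) _ h2)
      · rintro ⟨u, hu, hiff⟩
        have hlt : ∀ t ≤ n i + n l - 1, G.Adj (r 0) (p t) →
            t + 1 ≤ n i ∧ G.Adj (r 0) (f i (t + 1)) := by
          intro t ht e
          rcases pcase t ht with ⟨h1, e'⟩ | ⟨s, h1, h2, e'⟩ <;> rw [e'] at e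
          exacts [⟨h1, e⟩, absurd e (rl 0 (by omega) _ h2)]
        obtain ⟨q1, q2⟩ := hlt u (by omega) ((hiff u (by omega)).2 (Or.inl rfl))
        obtain ⟨q3, q4⟩ := hlt (u + 1) (by omega) ((hiff (u + 1) (by omega)).2 (Or.inr rfl))
        have q5 := hradj 0 (by omega) i _ q1 q2
        have q6 := hradj 0 (by omega) i _ q3 q4
        refine hn ⟨u + 1, by omega, by omega, fun s hs => ⟨fun e => ?_, ?_⟩⟩
        · have q7 := hradj 0 (by omega) i _ hs e
          have := (hiff (s - 1) (by omega)).1 (by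
            rwa [p1 _ (by omega), show s - 1 + 1 = s by omega])
          omega
        · rintro (rfl | rfl)
          exacts [q2, q4]
    obtain ⟨u, hu2, hun, hu⟩ := tri
    apply hpr
    have hru : ∀ m ≤ k, ∀ s ≤ n i, G.Adj (f i s) (r m) → m = 0 ∧ (s = u ∨ s = u + 1) := by
      intro m hm s hs e
      have h0 := ri m hm s hs e.symm
      subst h0
      exact ⟨rfl, (hu s hs).1 e.symm⟩
    have hends : ∀ x y, x ≠ y → G.Adj (f x (n x)) (f y (n y)) := fun x y hxy =>
      (h.cross x y hxy (n x) (n y) (h.pos x) le_rfl (h.pos y) le_rfl).2.2 ⟨rfl, rfl⟩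
    refine prism_of_sets (a₁ := f i u) (a₂ := f i (u + 1)) (a₃ := r 0) (b₁ := f l (n l))
      (b₂ := f i (n i)) (b₃ := f j (n j)) (A₁ := f i '' Set.Icc 0 u ∪ f l '' Set.Icc 1 (n l))
      (A₂ := f i '' Set.Icc (u + 1) (n i)) (A₃ := r '' Set.Icc 0 k ∪ f j '' Set.Icc 2 (n j))
      ((h.ip i).adj (by omega)) ((hu _ (by omega)).2 (Or.inl rfl)).symm
      ((hu _ (by omega)).2 (Or.inr rfl)).symm (hends _ _ hli) (hends _ _ hlj) (hends _ _ hne)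
      ?_ ?_ ?_ ?_ ?_ ?_ ?_ ?_ ?_
    · have hi : Reaches G (f i '' Set.Icc 0 u ∪ f l '' Set.Icc 1 (n l)) (f i 0) (f i u) :=
        reaches_of_seq (Nat.zero_le u) (fun m _ hm => (h.ip i).adj (by omega))
          fun m _ hm => Or.inl ⟨m, ⟨by omega, hm⟩, rfl⟩
      have hl' : Reaches G (f i '' Set.Icc 0 u ∪ f l '' Set.Icc 1 (n l)) (f l 0) (f l (n l)) := by
        refine reaches_of_seq (Nat.zero_le _) (fun m _ hm => (h.ip l).adj (by omega))
          fun m _ hm => ?_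
        rcases Nat.eq_zero_or_pos m with rfl | h0
        · rw [h.zero l, ← h.zero i]
          exact Or.inl ⟨0, ⟨le_rfl, by omega⟩, rfl⟩
        · exact Or.inr ⟨m, ⟨h0, hm⟩, rfl⟩
      rw [h.zero] at hi hl'
      exact hi.symm.trans hl'
    · exact reaches_of_seq (by omega) (fun m _ hm => (h.ip i).adj (by omega))
        fun m h1 h2 => ⟨m, ⟨h1, h2⟩, rfl⟩
    · refine Reaches.trans (reaches_of_seq (Nat.zero_le k) (fun m _ hm => hl.adj m hm)
        fun m _ hm => Or.inl ⟨m, ⟨by omega, hm⟩, rfl⟩) (Reaches.trans (.of_adj ej ?_ ?_)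
        (reaches_of_seq (show sj ≤ n j by omega) (fun m _ hm => (h.ip j).adj (by omega))
        fun m h1 h2 => Or.inr ⟨m, ⟨by omega, h2⟩, rfl⟩))
      · exact Or.inl ⟨k, ⟨by omega, le_rfl⟩, rfl⟩
      · exact Or.inr ⟨sj, ⟨hsj, by omega⟩, rfl⟩
    · rintro _ (⟨s, ⟨hs, hs'⟩, rfl⟩ | ⟨s, ⟨hs, hs'⟩, rfl⟩) _ ⟨t, ⟨ht, ht'⟩, rfl⟩
      · obtain ⟨c1, c2⟩ := h.ip i s t (by omega) ht'
        refine ⟨c1, fun e => Or.inl ?_⟩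
        rw [c2] at e
        obtain ⟨rfl, rfl⟩ : s = u ∧ t = u + 1 := by omega
        exact ⟨rfl, rfl⟩
      · obtain ⟨c1, c2⟩ := h.cross l i hli s t hs hs' (by omega) ht'
        refine ⟨c1, fun e => Or.inr ?_⟩
        obtain ⟨rfl, rfl⟩ := c2.1 e
        exact ⟨rfl, rfl⟩
    · rintro _ (⟨s, ⟨hs, hs'⟩, rfl⟩ | ⟨s, ⟨hs, hs'⟩, rfl⟩) _
        (⟨m, ⟨hm, hm'⟩, rfl⟩ | ⟨t, ⟨ht, ht'⟩, rfl⟩)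
      · refine ⟨(hrne m hm' _ _ (by omega)).symm, fun e => Or.inl ?_⟩
        obtain ⟨rfl, h2⟩ := hru m hm' s (by omega) e
        obtain rfl : s = u := by omega
        exact ⟨rfl, rfl⟩
      · rcases Nat.eq_zero_or_pos s with rfl | h0
        · rw [h.zero i, ← h.zero j]
          obtain ⟨c1, c2⟩ := h.ip j 0 t (by omega) ht'
          exact ⟨c1, fun e => by rw [c2] at e; omega⟩
        · obtain ⟨c1, c2⟩ := h.cross i j hne s t h0 (by omega) (by omega) ht'
          exact ⟨c1, fun e => by rw [c2] at e; omega⟩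
      · exact ⟨(hrne m hm' _ _ (by omega)).symm, fun e => absurd e.symm (rl m hm' s hs')⟩
      · obtain ⟨c1, c2⟩ := h.cross l j hlj s t hs hs' (by omega) ht'
        refine ⟨c1, fun e => Or.inr ?_⟩
        obtain ⟨rfl, rfl⟩ := c2.1 e
        exact ⟨rfl, rfl⟩
    · rintro _ ⟨s, ⟨hs, hs'⟩, rfl⟩ _ (⟨m, ⟨hm, hm'⟩, rfl⟩ | ⟨t, ⟨ht, ht'⟩, rfl⟩)
      · refine ⟨(hrne m hm' _ _ (by omega)).symm, fun e => Or.inl ?_⟩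
        obtain ⟨rfl, h2⟩ := hru m hm' s (by omega) e
        obtain rfl : s = u + 1 := by omega
        exact ⟨rfl, rfl⟩
      · obtain ⟨c1, c2⟩ := h.cross i j hne s t (by omega) hs' (by omega) ht'
        refine ⟨c1, fun e => Or.inr ?_⟩
        obtain ⟨rfl, rfl⟩ := c2.1 e
        exact ⟨rfl, rfl⟩
    · exact (h.ip i _ _ (by omega) le_rfl).1
    · exact hrne 0 (by omega) _ _ le_rfl
    · exact Or.inl (h.cross i l hli.symm u (n l) (by omega) (by omega) hpl le_rfl).1

/-! ### Holes -/

/-- `h 0, …, h (N - 1)` is an induced cycle of `G`, and `h N = h 0`. -/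
structure IsHole (G : SimpleGraph V) (h : ℕ → V) (N : ℕ) : Prop where
  four_le : 4 ≤ N
  closed : h N = h 0
  rel' : ∀ i j, i < j → j < N → h i ≠ h j ∧ (G.Adj (h i) (h j) ↔ j = i + 1 ∨ (i = 0 ∧ j + 1 = N))

namespace IsHole

variable {G : SimpleGraph V} {h : ℕ → V} {N : ℕ}

theorem rel (H : IsHole G h N) {i j : ℕ} (hij : i < j) (hj : j ≤ N) (h0 : ¬ (i = 0 ∧ j = N)) :
    h i ≠ h j ∧ (G.Adj (h i) (h j) ↔ j = i + 1 ∨ (i = 0 ∧ j + 1 = N) ∨ (i = 1 ∧ j = N)) := by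
  have h4 := H.four_le
  rcases Nat.lt_or_ge j N with hj' | hj'
  · obtain ⟨c1, c2⟩ := H.rel' i j hij hj'
    exact ⟨c1, by rw [c2]; omega⟩
  · obtain rfl : j = N := by omega
    rw [H.closed]
    obtain ⟨c1, c2⟩ := H.rel' 0 i (by omega) hij
    exact ⟨c1.symm, by rw [G.adj_comm, c2]; omega⟩

theorem adj (H : IsHole G h N) {i : ℕ} (hi : i < N) : G.Adj (h i) (h (i + 1)) := by
  have := H.four_le
  exact (H.rel (Nat.lt_succ_self i) hi (by omega)).2.2 (Or.inl rfl)

theorem isIP (H : IsHole G h N) {a m : ℕ} (ham : a + m ≤ N) (hm : m + 2 ≤ N) :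
    IsIP G (fun t => h (a + t)) m := by
  intro i j hij hj
  obtain ⟨c1, c2⟩ := H.rel (i := a + i) (j := a + j) (by omega) (by omega) (by omega)
  exact ⟨c1, by rw [c2]; omega⟩

theorem isIP_rev (H : IsHole G h N) {a m : ℕ} (ham : a ≤ N) (hma : m ≤ a) (hm : m + 2 ≤ N) :
    IsIP G (fun t => h (a - t)) m := by
  intro i j hij hj
  obtain ⟨c1, c2⟩ := H.rel (i := a - j) (j := a - i) (by omega) (by omega) (by omega)
  exact ⟨c1.symm, by rw [G.adj_comm, c2]; omega⟩

theorem apart (H : IsHole G h N) {a b c d : ℕ} (hbc : b + 2 ≤ c) (hd : d ≤ N)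
    (hda : d + 2 ≤ N + a) : Apart G (h '' Set.Icc a b) (h '' Set.Icc c d) := by
  rintro _ ⟨i, ⟨hi, hi'⟩, rfl⟩ _ ⟨j, ⟨hj, hj'⟩, rfl⟩
  obtain ⟨c1, c2⟩ := H.rel (i := i) (j := j) (by omega) (by omega) (by omega)
  exact ⟨c1, by rw [c2]; omega⟩

end IsHole

/-! ### Wheels -/

/-- `x < y` are consecutive elements of `M`. -/
structure IsSec (M : ℕ → Prop) (x y : ℕ) : Prop where
  lt : x < y
  left : M x
  right : M y
  gap : ∀ t, x < t → t < y → ¬ M t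

theorem exists_isSec {M : ℕ → Prop} {N i : ℕ} (h0 : M 0) (hN : M N) (hi : i < N) (hiM : ¬ M i) :
    ∃ x y, IsSec M x y ∧ x < i ∧ i < y ∧ y ≤ N := by
  classical
  have hex : ∃ y, i < y ∧ M y := ⟨N, hi, hN⟩
  have hx := Nat.findGreatest_spec (P := M) (Nat.zero_le i) h0
  have hxi := Nat.findGreatest_le (P := M) i
  have hne : Nat.findGreatest M i ≠ i := fun e => hiM (e ▸ hx)
  refine ⟨Nat.findGreatest M i, Nat.find hex, ⟨?_, hx, (Nat.find_spec hex).2, ?_⟩, by omega,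
    (Nat.find_spec hex).1, Nat.find_min' hex ⟨hi, hN⟩⟩
  · have := (Nat.find_spec hex).1
    omega
  · intro t h1 h2 ht
    rcases Nat.lt_or_ge i t with h3 | h3
    · exact Nat.find_min hex h2 ⟨h3, ht⟩
    · exact absurd (Nat.le_findGreatest h3 ht) (by omega)

theorem IsSec.le_of_lt {M : ℕ → Prop} {x y x' y' : ℕ} (h : IsSec M x y) (h' : IsSec M x' y')
    (hlt : x < x') : y ≤ x' := by
  by_contra! hc
  exact h.gap x' hlt hc h'.left

theorem IsSec.right_unique {M : ℕ → Prop} {x y y' : ℕ} (h : IsSec M x y) (h' : IsSec M x y') :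
    y = y' := by
  rcases lt_trichotomy y y' with e | e | e
  · exact absurd h.right (h'.gap y h.lt e)
  · exact e
  · exact absurd h'.right (h.gap y' h'.lt e)

/-- The centre `c` of a wheel, with its neighbours on the rim and the vertices next to them. -/
def wheelCore (G : SimpleGraph V) (F : ℕ → V) (N : ℕ) (c : V) : Set V :=
  {c} ∪ {v | ∃ m i, m ≤ N ∧ i ≤ N ∧ i ≤ m + 1 ∧ m ≤ i + 1 ∧ G.Adj c (F m) ∧ v = F i}

theorem IsHole.not_conn_of_wheel {G : SimpleGraph V} (hθ : ¬ ContainsTheta G)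
    (hpr : ¬ ContainsPrism G) {F : ℕ → V} {N : ℕ} (H : IsHole G F N) {c : V}
    (hc : ∀ i ≤ N, F i ≠ c) (hc0 : G.Adj c (F 0)) {p q : ℕ} (hp : 2 ≤ p) (hpq : p + 2 ≤ q)
    (hq : q + 2 ≤ N) (hcp : G.Adj c (F p)) (hcq : G.Adj c (F q)) {D : Set V} (hD : Conn G D)
    (hDZ : Apart G D (wheelCore G F N c)) {i₀ j₀ m₀ : ℕ} (him : i₀ < m₀) (hmj : m₀ < j₀)
    (hjN : j₀ ≤ N) (hcm : G.Adj c (F m₀)) (hi₀ : F i₀ ∈ D) (hj₀ : F j₀ ∈ D) : False := by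
  set Z := wheelCore G F N c with hZ
  have hcN : G.Adj c (F N) := H.closed ▸ hc0
  let M : ℕ → Prop := fun i => G.Adj c (F i)
  have hcZ : c ∈ Z := Or.inl rfl
  have hmZ : ∀ m i, m ≤ N → i ≤ N → i ≤ m + 1 → m ≤ i + 1 → M m → F i ∈ Z :=
    fun m i h1 h2 h3 h4 h5 => Or.inr ⟨m, i, h1, h2, h3, h4, h5, rfl⟩
  let U : Set V := {x | ∀ z ∈ Z, x ≠ z ∧ ¬ G.Adj x z}
  have hDU : D ⊆ U := fun x hx => hDZ x hx
  have hUM : ∀ i ≤ N, F i ∈ U → ¬ M i := fun i hi hU hM =>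
    (hU _ (hmZ i i hi hi (by omega) (by omega) hM)).1 rfl
  let S : ℕ → Set V := fun x => {v | ∃ y i, IsSec M x y ∧ y ≤ N ∧ x < i ∧ i < y ∧ v = F i}
  have hsec : ∀ i ≤ N, ¬ M i → ∃ x y, IsSec M x y ∧ x < i ∧ i < y ∧ y ≤ N := by
    intro i hi hM
    have : i ≠ N := by rintro rfl; exact hM hcN
    exact exists_isSec hc0 hcN (by omega) hM
  have hS' : ∀ x y, x < y → ∀ u ∈ S x, ∀ v ∈ S y, u ≠ v ∧ ¬ G.Adj u v := by
    rintro x y hxy _ ⟨x', s, hx', hN1, h1, h2, rfl⟩ _ ⟨y', t, hy', hN2, h3, h4, rfl⟩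
    have := hx'.le_of_lt hy' hxy
    obtain ⟨c1, c2⟩ := H.rel (i := s) (j := t) (by omega) (by omega) (by omega)
    exact ⟨c1, by rw [c2]; omega⟩
  have hS : ∀ x y, x ≠ y → ∀ u ∈ S x, u ∈ U → ∀ v ∈ S y, u ≠ v ∧ ¬ G.Adj u v := by
    intro x y hxy u hu _ v hv
    rcases lt_or_gt_of_ne hxy with h | h
    · exact hS' x y h u hu v hv
    · have := hS' y x h v hv u hu
      exact ⟨this.1.symm, fun e => this.2 e.symm⟩
  obtain ⟨x₁, y₁, hs₁, hx₁, hy₁, hN₁⟩ := hsec i₀ (by omega) (hUM i₀ (by omega) (hDU hi₀))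
  obtain ⟨x₂, y₂, hs₂, hx₂, hy₂, hN₂⟩ := hsec j₀ hjN (hUM j₀ hjN (hDU hj₀))
  have hne : x₁ ≠ x₂ := by
    rintro rfl
    have := hs₁.right_unique hs₂
    exact hs₁.gap m₀ (by omega) (by omega) hcm
  obtain ⟨x, y, k, r, hl, hcase⟩ := exists_isLink hS hD hDU hne
    ⟨_, ⟨_, _, hs₁, hN₁, hx₁, hy₁, rfl⟩, hi₀⟩ ⟨_, ⟨_, _, hs₂, hN₂, hx₂, hy₂, rfl⟩, hj₀⟩
  have hrne : ∀ {x y k r}, IsLink G S U x y k r → ∀ m ≤ k, ∀ i ≤ N, r m ≠ F i := by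
    intro x y k r hl m hm i hi e
    obtain ⟨x', y', h1, h2, h3, h4⟩ := hsec i hi (hUM i hi (e ▸ hl.mem m hm))
    exact hl.notMem m hm x' ⟨y', i, h1, h4, h2, h3, e⟩
  have hradj : ∀ {x y k r}, IsLink G S U x y k r → ∀ m ≤ k, ∀ i ≤ N, G.Adj (r m) (F i) →
      ∃ x' y', IsSec M x' y' ∧ x' + 2 ≤ i ∧ i + 2 ≤ y' ∧ y' ≤ N ∧ Touches G S (r m) x' := by
    intro x y k r hl m hm i hi e
    have hU := hl.mem m hm
    have hnear : ∀ m' ≤ N, i ≤ m' + 1 → m' ≤ i + 1 → ¬ M m' := fun m' h1 h2 h3 h4 =>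
      (hU _ (hmZ m' i h1 hi h2 h3 h4)).2 e
    obtain ⟨x', y', h1, h2, h3, h4⟩ := hsec i hi (hnear i hi (by omega) (by omega))
    refine ⟨x', y', h1, ?_, ?_, h4, F i, ⟨y', i, h1, h4, h2, h3, rfl⟩, e⟩
    · by_contra hc
      exact hnear x' (by omega) (by omega) (by omega) h1.left
    · by_contra hc
      exact hnear y' (by omega) (by omega) (by omega) h1.right
  have hrc : ∀ {x y k r}, IsLink G S U x y k r → ∀ m ≤ k, r m ≠ c ∧ ¬ G.Adj (r m) c :=
    fun hl m hm => hl.mem m hm c hcZ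
  have htou : ∀ {x y k r}, IsLink G S U x y k r → ∀ m ≤ k, ∀ z, Touches G S (r m) z →
      ∃ z' i, IsSec M z z' ∧ z + 2 ≤ i ∧ i + 2 ≤ z' ∧ z' ≤ N ∧ G.Adj (r m) (F i) := by
    rintro x y k r hl m hm z ⟨_, ⟨z', i, h1, h2, h3, h4, rfl⟩, e⟩
    obtain ⟨x', y', g1, g2, g3, g4, -⟩ := hradj hl m hm i (by omega) e
    have : z = x' := by
      rcases lt_trichotomy z x' with h | h | h
      · have := h1.le_of_lt g1 h; omega
      · exact h
      · have := g1.le_of_lt h1 h; omega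
    subst this
    obtain rfl := h1.right_unique g1
    exact ⟨z', i, h1, g2, g3, g4, e⟩
  rcases hcase with hsolo | ⟨rfl, z, hzx, hzy, hzt⟩
  swap
  · have piece : ∀ w, Touches G S (r 0) w → ∃ u e, IsSec M w e ∧ w + 2 ≤ u ∧ u ≤ e ∧ e ≤ N ∧
        Reaches G (insert (r 0) (insert c (F '' Set.Icc u e))) (r 0) c := by
      intro w hw
      obtain ⟨e, u, h1, h2, h3, h4, h5⟩ := htou hl 0 le_rfl w hw
      refine ⟨u, e, h1, h2, by omega, h4, Reaches.trans (.of_adj h5 (by simp) ?_)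
        (Reaches.trans (reaches_of_seq (show u ≤ e by omega)
        (fun m _ hm => H.adj (by omega)) fun m hm hm' => ?_) (.of_adj h1.right.symm ?_ (by simp)))⟩
      exacts [Or.inr (Or.inr ⟨u, ⟨le_rfl, by omega⟩, rfl⟩), Or.inr (Or.inr ⟨m, ⟨hm, hm'⟩, rfl⟩),
        Or.inr (Or.inr ⟨e, ⟨by omega, le_rfl⟩, rfl⟩)]
    have ap : ∀ {w w' u u' e e'}, w ≠ w' → IsSec M w e → IsSec M w' e' → w + 2 ≤ u → w' + 2 ≤ u' →
        e ≤ N → e' ≤ N → Apart G (F '' Set.Icc u e) (F '' Set.Icc u' e') := by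
      intro w w' u u' e e' hne h1 h2 h3 h4 h5 h6
      rcases lt_or_gt_of_ne hne with h | h
      · have := h1.le_of_lt h2 h
        exact H.apart (by omega) h6 (by omega)
      · have := h2.le_of_lt h1 h
        exact (H.apart (by omega) h5 (by omega)).symm
    obtain ⟨u₁, e₁, a₁, b₁, -, d₁, g₁⟩ := piece x hl.first
    obtain ⟨u₂, e₂, a₂, b₂, -, d₂, g₂⟩ := piece y hl.last
    obtain ⟨u₃, e₃, a₃, b₃, -, d₃, g₃⟩ := piece z hzt
    exact hθ (theta_of_sets (hrc hl 0 le_rfl).1 (hrc hl 0 le_rfl).2 (ap hl.ne a₁ a₂ b₁ b₂ d₁ d₂)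
      (ap hzx.symm a₁ a₃ b₁ b₃ d₁ d₃) (ap hzy.symm a₂ a₃ b₂ b₃ d₂ d₃) g₁ g₂ g₃)
  · have tri : ∀ {x y k r}, IsLink G S U x y k r →
        (∀ i ≤ k, ∀ z, Touches G S (r i) z → (i = 0 ∧ z = x) ∨ (i = k ∧ z = y)) →
        ∃ u e, IsSec M x e ∧ e ≤ N ∧ x + 2 ≤ u ∧ u + 3 ≤ e ∧
          ∀ s, x ≤ s → s ≤ e → (G.Adj (r 0) (F s) ↔ s = u ∨ s = u + 1) := by
      intro x y k r hl hsolo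
      obtain ⟨e, i, hxe, hxi, hie, heN, hi⟩ := htou hl 0 (by omega) x hl.first
      obtain ⟨e', j, hye, hyj, hje, heN', hj⟩ := htou hl k le_rfl y hl.last
      have hlabel : ∀ m ≤ k, ∀ s, x ≤ s → s ≤ e → G.Adj (r m) (F s) →
          m = 0 ∧ x + 2 ≤ s ∧ s + 2 ≤ e := by
        intro m hm s hs hs' had
        obtain ⟨x', y', h1, h2, h3, h4, h5⟩ := hradj hl m hm s (by omega) had
        have : x' = x := by
          rcases lt_trichotomy x' x with h | h | h
          · have := h1.le_of_lt hxe h; omega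
          · exact h
          · have := hxe.le_of_lt h1 h; omega
        subst this
        obtain rfl := h1.right_unique hxe
        have := hsolo m hm _ h5
        have := hl.ne
        exact ⟨by tauto, h2, h3⟩
      by_contra hn
      have hpe := hxe.gap p
      have hqe := hxe.gap q
      have hpe' := hye.gap p
      have hqe' := hye.gap q
      have hpM : M p := hcp
      have hqM : M q := hcq
      obtain ⟨a, b, hab, haj, hjb, hMab, hap⟩ : ∃ a b, a ≤ b ∧ a ≤ j ∧ j ≤ b ∧
          ((a = y ∧ b ≤ e') ∨ (b = e' ∧ y ≤ a)) ∧
          Apart G (F '' Set.Icc a b) (F '' Set.Icc x e) := by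
        rcases lt_or_gt_of_ne hl.ne with h | h
        · have hle := hxe.le_of_lt hye h
          by_cases hw : e' + 2 ≤ N + x
          · exact ⟨y + 2, e', by omega, by omega, by omega, Or.inr ⟨rfl, by omega⟩,
              (H.apart (by omega) heN' hw).symm⟩
          · refine ⟨y, e' - 2, by omega, by omega, by omega, Or.inl ⟨rfl, by omega⟩,
              (H.apart ?_ (by omega) (by omega)).symm⟩
            by_contra hc'
            have : x < p := by omega
            have : x < q := by omega
            have : ¬ p < e := fun h => hpe (by omega) h hpM
            have : ¬ q < e := fun h => hqe (by omega) h hqM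
            have : ¬ (y < p) := fun h => hpe' h (by omega) hpM
            have : ¬ (y < q) := fun h => hqe' h (by omega) hqM
            omega
        · have hle := hye.le_of_lt hxe h
          by_cases hw : e' + 2 ≤ x
          · exact ⟨y + 2, e', by omega, by omega, by omega, Or.inr ⟨rfl, by omega⟩,
              H.apart hw heN (by omega)⟩
          · refine ⟨y, e' - 2, by omega, by omega, by omega, Or.inl ⟨rfl, by omega⟩,
              H.apart (by omega) heN ?_⟩
            by_contra hc'
            have : ¬ p < e' := fun h => hpe' (by omega) h hpM
            have : ¬ q < e' := fun h => hqe' (by omega) h hqM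
            have : ¬ (x < p) := fun h => hpe h (by omega) hpM
            have : ¬ (x < q) := fun h => hqe h (by omega) hqM
            omega
      have hlen : e - x + 2 ≤ N := by
        by_contra hc'
        exact hpe (by omega) (by omega) hpM
      have hyM : M y := hye.left
      have heM : M e' := hye.right
      refine hθ (star_theta (H.isIP (a := x) (m := e - x) (by omega) hlen) (c := c) (r := r 0)
        (E := r '' Set.Icc 1 k ∪ F '' Set.Icc a b) ?_ hxe.left ?_ ?_ (hrc hl 0 (by omega)).1.symm
        (hrc hl 0 (by omega)).2 ?_ ?_ ?_ ?_ ?_)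
      · exact fun t ht => hc _ (by omega)
      · rw [show x + (e - x) = e by have := hxe.lt; omega]; exact hxe.right
      · exact fun t ht => (hrne hl 0 (by omega) _ (by omega)).symm
      · rintro _ (⟨m, ⟨hm, hm'⟩, rfl⟩ | hm) t ht
        · refine ⟨hrne hl m hm' _ (by omega), fun e' => ?_⟩
          have := hlabel m hm' _ (by omega) (by omega) e'
          omega
        · exact hap _ hm _ ⟨x + t, ⟨by omega, by omega⟩, rfl⟩
      · have h1 : Reaches G (insert (r 0) (insert c (r '' Set.Icc 1 k ∪ F '' Set.Icc a b)))
            (r 0) (r k) := by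
          refine reaches_of_seq (Nat.zero_le k) (fun m _ hm => hl.adj m hm) fun m _ hm => ?_
          rcases Nat.eq_zero_or_pos m with rfl | h0
          · exact Or.inl rfl
          · exact Or.inr (Or.inr (Or.inl ⟨m, ⟨h0, hm⟩, rfl⟩))
        have hin : ∀ t, a ≤ t → t ≤ b →
            F t ∈ insert (r 0) (insert c (r '' Set.Icc 1 k ∪ F '' Set.Icc a b)) :=
          fun t h1 h2 => Or.inr (Or.inr (Or.inr ⟨t, ⟨h1, h2⟩, rfl⟩))
        refine h1.trans (Reaches.trans (.of_adj hj h1.right_mem (hin j haj hjb)) ?_)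
        rcases hMab with ⟨rfl, hbe⟩ | ⟨rfl, -⟩
        · exact (Reaches.trans (.of_adj hyM (by simp) (hin _ le_rfl hab))
            (reaches_of_seq haj (fun m _ hm => H.adj (by omega))
              fun m h1 h2 => hin m h1 (by omega))).symm
        · exact Reaches.trans (reaches_of_seq hjb (fun m _ hm => H.adj (by omega))
            fun m h1 h2 => hin m (by omega) h2) (.of_adj heM.symm (hin _ hab le_rfl) (by simp))
      · exact ⟨i - x, by omega, by rwa [show x + (i - x) = i by omega]⟩
      · intro t ht had
        obtain ⟨-, h2, h3⟩ := hlabel 0 (by omega) _ (by omega) (by omega) had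
        exact hxe.gap _ (by omega) (by omega)
      · rintro ⟨u, hu, hiff⟩
        have g1 := hlabel 0 (by omega) (x + u) (by omega) (by omega)
          ((hiff u (by omega)).2 (Or.inl rfl))
        have g2 := hlabel 0 (by omega) (x + (u + 1)) (by omega) (by omega)
          ((hiff (u + 1) (by omega)).2 (Or.inr rfl))
        refine hn ⟨x + u, e, hxe, heN, by omega, by omega, fun s hs hs' => ?_⟩
        have := hiff (s - x) (by omega)
        rw [show x + (s - x) = s by omega] at this
        rw [this]
        omega
    have final : ∀ {x y k r}, IsLink G S U x y k r →
        (∀ i ≤ k, ∀ z, Touches G S (r i) z → (i = 0 ∧ z = x) ∨ (i = k ∧ z = y)) → x < y →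
        False := by
      intro x y k r hl hsolo hxy
      obtain ⟨u, e, hxe, heN, hxu, hue, hu⟩ := tri hl hsolo
      obtain ⟨u', e', hye, heN', hyu, hue', hu'⟩ := tri hl.reverse (by
        intro i hi z hz
        have := hsolo (k - i) (by omega) z hz
        omega)
      simp only [Nat.sub_zero] at hu'
      have hle := hxe.le_of_lt hye hxy
      have hcross : ∀ m ≤ k, ∀ s ≤ N, G.Adj (r m) (F s) →
          (m = 0 ∧ (s = u ∨ s = u + 1)) ∨ (m = k ∧ (s = u' ∨ s = u' + 1)) := by
        intro m hm s hs had
        obtain ⟨x', y', h1, h2, h3, h4, h5⟩ := hradj hl m hm s hs had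
        rcases hsolo m hm x' h5 with ⟨rfl, rfl⟩ | ⟨rfl, rfl⟩
        · obtain rfl := h1.right_unique hxe
          exact Or.inl ⟨rfl, (hu s (by omega) (by omega)).1 had⟩
        · obtain rfl := h1.right_unique hye
          exact Or.inr ⟨rfl, (hu' s (by omega) (by omega)).1 had⟩
      have hF : ∀ s t, s < t → t ≤ N → 2 ≤ s → F s ≠ F t ∧ (G.Adj (F s) (F t) ↔ t = s + 1) := by
        intro s t h1 h2 h3
        obtain ⟨c1, c2⟩ := H.rel h1 h2 (by omega)
        exact ⟨c1, by rw [c2]; omega⟩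
      refine hpr (prism_of_sets (a₁ := r 0) (a₂ := F u) (a₃ := F (u + 1)) (b₁ := r k)
        (b₂ := F (u' + 1)) (b₃ := F u') (A₁ := r '' Set.Icc 0 k)
        (A₂ := F '' Set.Icc 0 u ∪ F '' Set.Icc (u' + 1) N) (A₃ := F '' Set.Icc (u + 1) u')
        ((hu u (by omega) (by omega)).2 (Or.inl rfl))
        ((hu (u + 1) (by omega) (by omega)).2 (Or.inr rfl)) (H.adj (by omega))
        ((hu' (u' + 1) (by omega) (by omega)).2 (Or.inr rfl))
        ((hu' u' (by omega) (by omega)).2 (Or.inl rfl)) (H.adj (by omega)).symm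
        ?_ ?_ ?_ ?_ ?_ ?_ ?_ ?_ ?_)
      · exact reaches_of_seq (Nat.zero_le k) (fun m _ hm => hl.adj m hm)
          fun m h1 h2 => ⟨m, ⟨h1, h2⟩, rfl⟩
      · have h1 : Reaches G (F '' Set.Icc 0 u ∪ F '' Set.Icc (u' + 1) N) (F 0) (F u) :=
          reaches_of_seq (Nat.zero_le u) (fun m _ hm => H.adj (by omega))
            fun m h1 h2 => Or.inl ⟨m, ⟨h1, h2⟩, rfl⟩
        have h2 : Reaches G (F '' Set.Icc 0 u ∪ F '' Set.Icc (u' + 1) N) (F (u' + 1)) (F N) :=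
          reaches_of_seq (by omega) (fun m _ hm => H.adj (by omega))
            fun m h1 h2 => Or.inr ⟨m, ⟨h1, h2⟩, rfl⟩
        rw [H.closed] at h2
        exact (h2.trans h1).symm
      · exact reaches_of_seq (by omega) (fun m _ hm => H.adj (by omega))
          fun m h1 h2 => ⟨m, ⟨h1, h2⟩, rfl⟩
      · rintro _ ⟨m, ⟨hm, hm'⟩, rfl⟩ _ (⟨s, ⟨hs, hs'⟩, rfl⟩ | ⟨s, ⟨hs, hs'⟩, rfl⟩)
        · refine ⟨hrne hl m hm' s (by omega), fun had => Or.inl ?_⟩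
          obtain ⟨rfl, rfl⟩ : m = 0 ∧ s = u := by
            have := hcross m hm' s (by omega) had
            omega
          exact ⟨rfl, rfl⟩
        · refine ⟨hrne hl m hm' s (by omega), fun had => Or.inr ?_⟩
          obtain ⟨rfl, rfl⟩ : m = k ∧ s = u' + 1 := by
            have := hcross m hm' s (by omega) had
            omega
          exact ⟨rfl, rfl⟩
      · rintro _ ⟨m, ⟨hm, hm'⟩, rfl⟩ _ ⟨s, ⟨hs, hs'⟩, rfl⟩
        refine ⟨hrne hl m hm' s (by omega), fun had => ?_⟩
        have : (m = 0 ∧ s = u + 1) ∨ (m = k ∧ s = u') := by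
          have := hcross m hm' s (by omega) had
          omega
        rcases this with ⟨rfl, rfl⟩ | ⟨rfl, rfl⟩
        exacts [Or.inl ⟨rfl, rfl⟩, Or.inr ⟨rfl, rfl⟩]
      · rintro _ (⟨s, ⟨hs, hs'⟩, rfl⟩ | ⟨s, ⟨hs, hs'⟩, rfl⟩) _ ⟨t, ⟨ht, ht'⟩, rfl⟩
        · obtain ⟨c1, c2⟩ := H.rel (i := s) (j := t) (by omega) (by omega) (by omega)
          refine ⟨c1, fun had => Or.inl ?_⟩
          rw [c2] at had
          obtain ⟨rfl, rfl⟩ : s = u ∧ t = u + 1 := by omega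
          exact ⟨rfl, rfl⟩
        · obtain ⟨c1, c2⟩ := hF t s (by omega) (by omega) (by omega)
          refine ⟨c1.symm, fun had => Or.inr ?_⟩
          rw [G.adj_comm, c2] at had
          obtain ⟨rfl, rfl⟩ : t = u' ∧ s = u' + 1 := by omega
          exact ⟨rfl, rfl⟩
      · exact (hF u (u' + 1) (by omega) (by omega) (by omega)).1
      · exact (hF (u + 1) u' (by omega) (by omega) (by omega)).1
      · refine Or.inr ⟨?_, ?_⟩
        · rw [(hF u (u' + 1) (by omega) (by omega) (by omega)).2]; omega
        · rw [(hF (u + 1) u' (by omega) (by omega) (by omega)).2]; omega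
    rcases lt_or_gt_of_ne hl.ne with h | h
    · exact final hl hsolo h
    · refine final hl.reverse ?_ h
      intro i hi z hz
      have := hsolo (k - i) (by omega) z hz
      omega

/-! ### Counting neighbours on induced paths -/

theorem card_lt_of_stable_nbrs {G : SimpleGraph V} {t : ℕ} (hK : ¬ ContainsK1t G t) {v : V}
    {S : Finset V} (hS : StableSet G (S : Set V)) (hv : ∀ x ∈ S, G.Adj v x) : S.card < t := by
  by_contra! h
  obtain ⟨T, hT, hTc⟩ := Finset.exists_subset_card_eq h
  exact hK ⟨v, T, hTc, fun hvT => G.irrefl (hv v (hT hvT)), fun x hx => hv x (hT hx),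
    fun x hx y hy => hS x (hT hx) y (hT hy)⟩

open Classical in
theorem IsIP.card_nbrs {G : SimpleGraph V} {t : ℕ} (hK : ¬ ContainsK1t G t) {f : ℕ → V} {n : ℕ}
    (hf : IsIP G f n) (v : V) :
    ((Finset.range (n + 1)).filter fun i => G.Adj v (f i)).card + 2 ≤ 2 * t := by
  set I := (Finset.range (n + 1)).filter fun i => G.Adj v (f i)
  have hI : ∀ i ∈ I, i ≤ n ∧ G.Adj v (f i) := by
    intro i hi
    rw [Finset.mem_filter, Finset.mem_range] at hi
    exact ⟨by omega, hi.2⟩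
  have par : ∀ e, (I.filter fun i => i % 2 = e).card < t := by
    intro e
    have hJ : ∀ i ∈ I.filter fun i => i % 2 = e, i ≤ n ∧ G.Adj v (f i) ∧ i % 2 = e := by
      intro i hi
      rw [Finset.mem_filter] at hi
      exact ⟨(hI i hi.1).1, (hI i hi.1).2, hi.2⟩
    rw [← Finset.card_image_of_injOn (f := f) (s := I.filter fun i => i % 2 = e)]
    · refine card_lt_of_stable_nbrs hK (v := v) ?_ ?_
      · intro x hx y hy hxy hadj
        rw [Finset.mem_coe, Finset.mem_image] at hx hy
        obtain ⟨i, hi, rfl⟩ := hx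
        obtain ⟨j, hj, rfl⟩ := hy
        have h1 := hJ i hi
        have h2 := hJ j hj
        rw [hf.adj_iff h1.1 h2.1] at hadj
        omega
      · intro x hx
        rw [Finset.mem_image] at hx
        obtain ⟨i, hi, rfl⟩ := hx
        exact (hJ i hi).2.1
    · intro i hi j hj e
      exact hf.inj (hJ i hi).1 (hJ j hj).1 e
  have hsub : I ⊆ (I.filter fun i => i % 2 = 0) ∪ I.filter fun i => i % 2 = 1 := by
    intro i hi
    rcases Nat.mod_two_eq_zero_or_one i with h | h
    · exact Finset.mem_union_left _ (Finset.mem_filter.2 ⟨hi, h⟩)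
    · exact Finset.mem_union_right _ (Finset.mem_filter.2 ⟨hi, h⟩)
  have h1 := Finset.card_le_card hsub
  have h2 := Finset.card_union_le (I.filter fun i => i % 2 = 0) (I.filter fun i => i % 2 = 1)
  have h3 := par 0
  have h4 := par 1
  omega

theorem IsHole.exists_wheelCore {G : SimpleGraph V} {t : ℕ} (hK : ¬ ContainsK1t G t) {F : ℕ → V}
    {N : ℕ} (H : IsHole G F N) (c : V) :
    ∃ Z : Finset V, Z.card ≤ 6 * t + 1 ∧ wheelCore G F N c ⊆ Z := by
  classical
  have h4 := H.four_le
  let I := ((Finset.range (N - 2 + 1)).filter fun i => G.Adj c (F (0 + i))) ∪ {N - 1, N}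
  have hIc : I.card ≤ 2 * t := by
    have h1 := Finset.card_union_le
      ((Finset.range (N - 2 + 1)).filter fun i => G.Adj c (F (0 + i))) {N - 1, N}
    have h2 := IsIP.card_nbrs hK (H.isIP (a := 0) (m := N - 2) (by omega) (by omega)) c
    have h3 := Finset.card_le_two (a := N - 1) (b := N)
    exact h1.trans (by omega)
  let Z : Finset V := {c} ∪ (I.image F ∪ (I.image (fun m => F (m - 1)) ∪
    I.image (fun m => F (m + 1))))
  refine ⟨Z, ?_, ?_⟩
  · have e1 := Finset.card_union_le {c} (I.image F ∪ (I.image (fun m => F (m - 1)) ∪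
      I.image (fun m => F (m + 1))))
    have e2 := Finset.card_union_le (I.image F) (I.image (fun m => F (m - 1)) ∪
      I.image (fun m => F (m + 1)))
    have e3 := Finset.card_union_le (I.image (fun m => F (m - 1))) (I.image (fun m => F (m + 1)))
    have e4 := Finset.card_image_le (s := I) (f := F)
    have e5 := Finset.card_image_le (s := I) (f := fun m => F (m - 1))
    have e6 := Finset.card_image_le (s := I) (f := fun m => F (m + 1))
    have e7 := Finset.card_singleton c
    exact e1.trans (by omega)
  · rintro v (hv | ⟨m, i, hm, hi, h1, h2, hadj, rfl⟩)
    · exact Finset.mem_coe.2 (Finset.mem_union_left _ (by simpa using hv))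
    · have hmI : m ∈ I := by
        simp only [I, Finset.mem_union, Finset.mem_filter, Finset.mem_range, Finset.mem_insert,
          Finset.mem_singleton, Nat.zero_add]
        by_cases h : m < N - 2 + 1
        · exact Or.inl ⟨h, hadj⟩
        · omega
      refine Finset.mem_coe.2 (Finset.mem_union_right _ ?_)
      simp only [Finset.mem_union, Finset.mem_image]
      obtain rfl | rfl | h : i = m ∨ i = m + 1 ∨ i = m - 1 := by omega
      · exact Or.inl ⟨i, hmI, rfl⟩
      · exact Or.inr (Or.inr ⟨m, hmI, rfl⟩)
      · exact Or.inr (Or.inl ⟨m, hmI, by rw [h]⟩)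

/-! ### Holes with a link -/

/-- Every connected set apart from some set of at most `k` vertices misses `A` or `B`. -/
def SmallSep (G : SimpleGraph V) (k : ℕ) (A B : Set V) : Prop :=
  ∃ Z : Finset V, Z.card ≤ k ∧ ∀ D, Conn G D → Apart G D Z → ∀ x ∈ A, ∀ y ∈ B, x ∈ D → y ∉ D

theorem SmallSep.symm {G : SimpleGraph V} {k : ℕ} {A B : Set V} (h : SmallSep G k A B) :
    SmallSep G k B A := by
  obtain ⟨Z, hZ, h⟩ := h
  exact ⟨Z, hZ, fun D hD hDZ x hx y hy hxD hyD => h D hD hDZ y hy x hx hyD hxD⟩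

theorem SmallSep.mono {G : SimpleGraph V} {k : ℕ} {A B A' B' : Set V} (h : SmallSep G k A B)
    (hA : A' ⊆ A) (hB : B' ⊆ B) : SmallSep G k A' B' := by
  obtain ⟨Z, hZ, h⟩ := h
  exact ⟨Z, hZ, fun D hD hDZ x hx y hy => h D hD hDZ x (hA hx) y (hB hy)⟩

theorem pos_of_not_containsK1t {G : SimpleGraph V} {t : ℕ} (hK : ¬ ContainsK1t G t) (v : V) :
    0 < t := by
  rcases Nat.eq_zero_or_pos t with rfl | h
  · exact absurd ⟨v, ∅, by simp [StableSet]⟩ hK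
  · exact h

theorem IsHole.smallSep_of_origin {G : SimpleGraph V} {t : ℕ} (hG : MemCt t G) {F : ℕ → V} {N : ℕ}
    (H : IsHole G F N) {g : ℕ → V} {m : ℕ} (hg : IsIP G g m) (hne : ∀ i ≤ m, ∀ j < N, g i ≠ F j)
    {β γ : ℕ} (hβ : 2 ≤ β) (hβγ : β ≤ γ) (hγ : γ + 2 ≤ N)
    (hadj : ∀ i ≤ m, ∀ j < N, G.Adj (g i) (F j) → (i = 0 ∧ j = 0) ∨ (i = m ∧ β ≤ j ∧ j ≤ γ))
    (h0 : G.Adj (g 0) (F 0)) (hgβ : G.Adj (g m) (F β)) (hgγ : G.Adj (g m) (F γ)) :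
    SmallSep G (6 * t + 1) {v | ∃ i, 0 < i ∧ i < β ∧ v = F i}
      {v | ∃ i, γ < i ∧ i < N ∧ v = F i} := by
  classical
  obtain ⟨hθ, hpr, hK⟩ := hG
  have ht := pos_of_not_containsK1t hK (F 0)
  have hgF : ∀ {a b}, 0 < a → b < N → (∀ j, a ≤ j → j ≤ b → j < β ∨ γ < j) →
      Apart G (F '' Set.Icc a b) (g '' Set.Icc 0 m) := by
    rintro a b ha hb hab _ ⟨j, ⟨hj, hj'⟩, rfl⟩ _ ⟨i, ⟨-, hi⟩, rfl⟩
    refine ⟨(hne i hi j (by omega)).symm, fun e => ?_⟩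
    have := hadj i hi j (by omega) e.symm
    have := hab j hj hj'
    omega
  have hup : ∀ {A : Set V} {b}, b ≤ N → (∀ j, 0 ≤ j → j ≤ b → F j ∈ A) → Reaches G A (F 0) (F b) :=
    fun hb hA =>
    reaches_of_seq (Nat.zero_le _) (fun k _ hk => H.adj (Nat.lt_of_lt_of_le hk hb)) hA
  have hdown : ∀ {A : Set V} {b}, b ≤ N → (∀ j, b ≤ j → j ≤ N → F j ∈ A) →
      Reaches G A (F 0) (F b) := fun hb hA => by
    rw [← H.closed]
    exact (reaches_of_seq hb (fun k _ hk => H.adj (i := k) (by omega)) hA).symm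
  have hlk : ∀ {A : Set V} {b}, b ≤ m → F 0 ∈ A → (∀ j, 0 ≤ j → j ≤ b → g j ∈ A) →
      Reaches G A (F 0) (g b) := fun hb hF hA =>
    (Reaches.of_adj h0.symm hF (hA 0 le_rfl (Nat.zero_le _))).trans
      (reaches_of_seq (Nat.zero_le _) (fun k _ hk => hg.adj (Nat.lt_of_lt_of_le hk hb)) hA)
  rcases Nat.lt_or_ge γ (β + 1) with hlt | hge
  · obtain rfl : β = γ := by omega
    have hr := H.rel (i := 0) (j := β) (by omega) (by omega) (by omega)
    refine absurd (theta_of_sets (a := F 0) (b := F β) (A₁ := F '' Set.Icc 1 (β - 1))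
      (A₂ := F '' Set.Icc (β + 1) (N - 1)) (A₃ := g '' Set.Icc 0 m) hr.1 (by rw [hr.2]; omega)
      (H.apart (by omega) (by omega) (by omega)) (hgF (by omega) (by omega) fun j _ _ => by omega)
      (hgF (by omega) (by omega) fun j _ _ => by omega) (hup (by omega) ?_)
        (hdown (by omega) ?_) ?_) hθ
    · intro j _ hj
      obtain rfl | rfl | h : j = 0 ∨ j = β ∨ (1 ≤ j ∧ j ≤ β - 1) := by omega
      exacts [by simp, by simp, Or.inr (Or.inr ⟨j, h, rfl⟩)]
    · intro j hj hj'
      obtain rfl | rfl | h : j = N ∨ j = β ∨ (β + 1 ≤ j ∧ j ≤ N - 1) := by omega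
      exacts [by simp [H.closed], by simp, Or.inr (Or.inr ⟨j, h, rfl⟩)]
    · have h1 : Reaches G (insert (F 0) (insert (F β) (g '' Set.Icc 0 m))) (F 0) (g m) :=
        hlk le_rfl (by simp) fun j _ hj => Or.inr (Or.inr ⟨j, ⟨by omega, hj⟩, rfl⟩)
      exact h1.trans (.of_adj hgβ h1.right_mem (by simp))
  rcases Nat.eq_or_lt_of_le hge with rfl | hge
  · let f : Fin 3 → ℕ → V := fun i => match i with
      | 0 => F
      | 1 => fun s => F (N - s)
      | 2 => fun s => if s = 0 then F 0 else g (s - 1)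
    let n : Fin 3 → ℕ := fun i => match i with
      | 0 => β
      | 1 => N - (β + 1)
      | 2 => m + 1
    have c01 : ∀ s t, 1 ≤ s → s ≤ β → 1 ≤ t → t ≤ N - (β + 1) →
        F s ≠ F (N - t) ∧ (G.Adj (F s) (F (N - t)) ↔ s = β ∧ t = N - (β + 1)) := by
      intro s t h1 h2 h3 h4
      obtain ⟨c1, c2⟩ := H.rel (i := s) (j := N - t) (by omega) (by omega) (by omega)
      exact ⟨c1, by rw [c2]; omega⟩
    have f2 : ∀ s, 1 ≤ s → f 2 s = g (s - 1) := fun s hs => if_neg (by omega)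
    have c02 : ∀ s t, 1 ≤ s → s ≤ β → 1 ≤ t → t ≤ m + 1 →
        F s ≠ f 2 t ∧ (G.Adj (F s) (f 2 t) ↔ s = β ∧ t = m + 1) := by
      intro s t h1 h2 h3 h4
      rw [f2 t h3]
      refine ⟨(hne _ (by omega) _ (by omega)).symm, fun e => ?_, ?_⟩
      · have := hadj _ (by omega) _ (by omega) e.symm
        omega
      · rintro ⟨rfl, rfl⟩
        exact hgβ.symm
    have c12 : ∀ s t, 1 ≤ s → s ≤ N - (β + 1) → 1 ≤ t → t ≤ m + 1 →
        F (N - s) ≠ f 2 t ∧ (G.Adj (F (N - s)) (f 2 t) ↔ s = N - (β + 1) ∧ t = m + 1) := by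
      intro s t h1 h2 h3 h4
      rw [f2 t h3]
      refine ⟨(hne _ (by omega) _ (by omega)).symm, fun e => ?_, ?_⟩
      · have := hadj _ (by omega) _ (by omega) e.symm
        omega
      · rintro ⟨rfl, rfl⟩
        rw [show N - (N - (β + 1)) = β + 1 by omega]
        exact hgγ.symm
    have hpyr : IsPyr G (F 0) f n := by
      refine ⟨?_, ?_, ?_, ?_⟩
      · intro i
        fin_cases i
        exacts [rfl, by simp [f, H.closed], rfl]
      · intro i
        fin_cases i
        · have := H.isIP (a := 0) (m := β) (by omega) (by omega)
          simpa using this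
        · exact H.isIP_rev (a := N) (m := N - (β + 1)) le_rfl (by omega) (by omega)
        · intro i j hij hj
          have hj : j ≤ m + 1 := hj
          change f 2 i ≠ f 2 j ∧ (G.Adj (f 2 i) (f 2 j) ↔ j = i + 1)
          rw [f2 j (by omega)]
          rcases Nat.eq_zero_or_pos i with rfl | hi
          · refine ⟨(hne _ (by omega) 0 (by omega)).symm, fun e => ?_, ?_⟩
            · have := hadj (j - 1) (by omega) 0 (by omega) (SimpleGraph.Adj.symm e)
              omega
            · rintro rfl
              exact h0.symm
          · rw [f2 i hi]
            obtain ⟨c1, c2⟩ := hg (i - 1) (j - 1) (by omega) (by omega)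
            exact ⟨c1, by rw [c2]; omega⟩
      · intro i
        fin_cases i
        · change 1 ≤ β; omega
        · change 1 ≤ N - (β + 1); omega
        · change 1 ≤ m + 1; omega
      · have sw : ∀ i j, (∀ s t, 1 ≤ s → s ≤ n i → 1 ≤ t → t ≤ n j →
            f i s ≠ f j t ∧ (G.Adj (f i s) (f j t) ↔ s = n i ∧ t = n j)) → ∀ s t, 1 ≤ s → s ≤ n j →
            1 ≤ t → t ≤ n i → f j s ≠ f i t ∧ (G.Adj (f j s) (f i t) ↔ s = n j ∧ t = n i) := by
          intro i j h s t h1 h2 h3 h4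
          obtain ⟨c1, c2⟩ := h t s h3 h4 h1 h2
          exact ⟨c1.symm, by rw [G.adj_comm, c2, and_comm]⟩
        intro i j hij
        fin_cases i <;> fin_cases j
        exacts [absurd rfl hij, c01, c02, sw 0 1 c01, absurd rfl hij, c12, sw 0 2 c02,
          sw 1 2 c12, absurd rfl hij]
    refine ⟨{F 0} ∪ Finset.univ.image (fun i => f i 1) ∪ Finset.univ.image (fun i => f i (n i)),
      ?_, ?_⟩
    · have e1 := Finset.card_union_le ({F 0} ∪ Finset.univ.image (fun i => f i 1))
        (Finset.univ.image (fun i => f i (n i)))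
      have e2 := Finset.card_union_le {F 0} (Finset.univ.image (fun i => f i 1))
      have e3 := Finset.card_image_le (s := Finset.univ) (f := fun i => f i 1)
      have e4 := Finset.card_image_le (s := Finset.univ) (f := fun i => f i (n i))
      have e5 := Finset.card_singleton (F 0)
      rw [Finset.card_univ, Fintype.card_fin] at e3 e4
      omega
    · rintro D hD hDZ _ ⟨i, hi, hi', rfl⟩ _ ⟨j, hj, hj', rfl⟩ hiD hjD
      refine hpyr.not_conn hθ hpr hD ?_ (show (0 : Fin 3) ≠ 1 by decide) (s₀ := i) (t₀ := N - j)
        (show i ≤ β by omega) (show N - j ≤ N - (β + 1) by omega) hiD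
        (show F (N - (N - j)) ∈ D by rwa [show N - (N - j) = j by omega])
      refine hDZ.mono subset_rfl ?_
      intro v hv
      simpa [pyrCore, or_assoc] using hv
  rcases Nat.eq_zero_or_pos m with rfl | hm
  · obtain ⟨Z, hZ, hsub⟩ := H.exists_wheelCore hK (g 0)
    refine ⟨Z, hZ, ?_⟩
    rintro D hD hDZ _ ⟨i, hi, hi', rfl⟩ _ ⟨j, hj, hj', rfl⟩ hiD hjD
    refine H.not_conn_of_wheel hθ hpr ?_ h0 hβ hge hγ hgβ hgγ hD (hDZ.mono subset_rfl hsub)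
      (i₀ := i) (j₀ := j) (m₀ := β) hi' (by omega) (by omega) hgβ hiD hjD
    intro i hi
    rcases Nat.eq_or_lt_of_le hi with rfl | hi
    · rw [H.closed]
      exact (hne 0 le_rfl 0 (by omega)).symm
    · exact (hne 0 le_rfl i hi).symm
  · refine absurd (theta_of_sets (a := F 0) (b := g m) (A₁ := F '' Set.Icc 1 β)
      (A₂ := F '' Set.Icc γ (N - 1)) (A₃ := g '' Set.Icc 0 (m - 1))
      (hne m le_rfl 0 (by omega)).symm (fun e => ?_)
      (H.apart (by omega) (by omega) (by omega)) ?_ ?_ ?_ ?_ ?_) hθ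
    · have := hadj m le_rfl 0 (by omega) e.symm
      omega
    · rintro _ ⟨j, ⟨hj, hj'⟩, rfl⟩ _ ⟨i, ⟨-, hi⟩, rfl⟩
      refine ⟨(hne i (by omega) j (by omega)).symm, fun e => ?_⟩
      have := hadj i (by omega) j (by omega) e.symm
      omega
    · rintro _ ⟨j, ⟨hj, hj'⟩, rfl⟩ _ ⟨i, ⟨-, hi⟩, rfl⟩
      refine ⟨(hne i (by omega) j (by omega)).symm, fun e => ?_⟩
      have := hadj i (by omega) j (by omega) e.symm
      omega
    · have h1 : Reaches G (insert (F 0) (insert (g m) (F '' Set.Icc 1 β))) (F 0) (F β) := by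
        refine hup (by omega) fun j _ hj => ?_
        rcases Nat.eq_zero_or_pos j with rfl | h
        exacts [by simp, Or.inr (Or.inr ⟨j, ⟨h, hj⟩, rfl⟩)]
      exact h1.trans (.of_adj hgβ.symm h1.right_mem (by simp))
    · have h1 : Reaches G (insert (F 0) (insert (g m) (F '' Set.Icc γ (N - 1)))) (F 0) (F γ) := by
        refine hdown (by omega) fun j hj hj' => ?_
        rcases Nat.eq_or_lt_of_le hj' with rfl | h
        exacts [by simp [H.closed], Or.inr (Or.inr ⟨j, ⟨hj, by omega⟩, rfl⟩)]
      exact h1.trans (.of_adj hgγ.symm h1.right_mem (by simp))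
    · refine hlk le_rfl (by simp) fun j _ hj => ?_
      rcases Nat.eq_or_lt_of_le hj with rfl | h
      exacts [by simp, Or.inr (Or.inr ⟨j, ⟨by omega, by omega⟩, rfl⟩)]

/-- Rotation of the hole `h 0, …, h (N - 1)` starting at `h x`. -/
def rot (h : ℕ → V) (N x t : ℕ) : V := if x + t < N then h (x + t) else h (x + t - N)

theorem rot_of_lt {h : ℕ → V} {N x t j : ℕ} (hj : j < N) (e : j = x + t) : rot h N x t = h j := by
  subst e
  exact if_pos hj

theorem rot_of_ge {h : ℕ → V} {N x t j : ℕ} (e : j + N = x + t) : rot h N x t = h j := by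
  rw [rot, if_neg (by omega)]
  congr 1
  omega

theorem rot_eq {h : ℕ → V} {N x t : ℕ} (hx : x < N) (ht : t < N) :
    ∃ j < N, rot h N x t = h j ∧ (j = x + t ∨ j + N = x + t) := by
  rcases Nat.lt_or_ge (x + t) N with h1 | h1
  · exact ⟨x + t, h1, rot_of_lt h1 rfl, Or.inl rfl⟩
  · exact ⟨x + t - N, by omega, rot_of_ge (by omega), Or.inr (by omega)⟩

theorem IsHole.rot {G : SimpleGraph V} {h : ℕ → V} {N : ℕ} (H : IsHole G h N) {x : ℕ}
    (hx : x < N) : IsHole G (rot h N x) N := by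
  refine ⟨H.four_le, ?_, ?_⟩
  · rw [rot_of_ge (j := x) (by omega), rot_of_lt (j := x) hx (by omega)]
  · intro i j hij hj
    obtain ⟨i', hi', e, hi⟩ := rot_eq (h := h) hx (hij.trans hj)
    obtain ⟨j', hj', e', hj⟩ := rot_eq (h := h) hx hj
    rw [e, e']
    rcases Nat.lt_or_ge i' j' with hlt | hge
    · obtain ⟨c1, c2⟩ := H.rel' i' j' hlt hj'
      exact ⟨c1, by rw [c2]; omega⟩
    · obtain ⟨c1, c2⟩ := H.rel' j' i' (by omega) hi'
      exact ⟨c1.symm, by rw [G.adj_comm, c2]; omega⟩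

theorem IsIP.hole_of_cap {G : SimpleGraph V} {A : ℕ → V} {L : ℕ} (hA : IsIP G A L) (hL : 2 ≤ L)
    {v : V} (hv : ∀ t ≤ L, v ≠ A t) (hadj : ∀ t ≤ L, G.Adj v (A t) ↔ t = 0 ∨ t = L) :
    IsHole G (fun t => if t = 0 ∨ t = L + 2 then v else A (t - 1)) (L + 2) := by
  refine ⟨by omega, by simp, ?_⟩
  intro i j hij hj
  have ej : (if j = 0 ∨ j = L + 2 then v else A (j - 1)) = A (j - 1) := if_neg (by omega)
  simp only [ej]
  rcases Nat.eq_zero_or_pos i with rfl | hi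
  · rw [if_pos (by omega), hadj _ (by omega)]
    exact ⟨hv _ (by omega), by omega⟩
  · rw [if_neg (by omega)]
    obtain ⟨c1, c2⟩ := hA (i - 1) (j - 1) (by omega) (by omega)
    exact ⟨c1, by rw [c2]; omega⟩

/-- `μ 0, …, μ s` is an induced path disjoint from the hole `h` whose ends have neighbours in two
separated intervals of `h`, and with no other edges to `h`. -/
structure IsHoleLink (G : SimpleGraph V) (h : ℕ → V) (N : ℕ) (μ : ℕ → V) (s l r β γ : ℕ) :
    Prop where
  hole : IsHole G h N
  ip : IsIP G μ s
  ne : ∀ i ≤ s, ∀ j < N, μ i ≠ h j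
  lr : l ≤ r
  rβ : r + 2 ≤ β
  βγ : β ≤ γ
  γN : γ < N
  γl : γ + 2 ≤ l + N
  cross : ∀ i ≤ s, ∀ j < N, G.Adj (μ i) (h j) → (i = 0 ∧ l ≤ j ∧ j ≤ r) ∨ (i = s ∧ β ≤ j ∧ j ≤ γ)
  adj_l : G.Adj (μ 0) (h l)
  adj_r : G.Adj (μ 0) (h r)
  adj_β : G.Adj (μ s) (h β)
  adj_γ : G.Adj (μ s) (h γ)

namespace IsHoleLink

variable {G : SimpleGraph V} {h : ℕ → V} {N : ℕ} {μ : ℕ → V} {s l r β γ : ℕ}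

theorem flip (B : IsHoleLink G h N μ s l r β γ) :
    IsHoleLink G (rot h N (r + 1)) N (fun i => μ (s - i)) s (β - r - 1) (γ - r - 1) (N - r - 1 + l)
      (N - 1) := by
  obtain ⟨H, hμ, hne, hlr, hrβ, hβγ, hγN, hγl, hadj, al, ar, aβ, aγ⟩ := B
  have hr : r + 1 < N := by omega
  refine ⟨H.rot hr, hμ.reverse le_rfl le_rfl, ?_, by omega, by omega, by omega, by omega, by omega,
    ?_, ?_, ?_, ?_, ?_⟩
  · intro i hi j hj
    obtain ⟨j', hj', e, -⟩ := rot_eq (h := h) hr hj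
    rw [e]
    exact hne _ (by omega) _ hj'
  · intro i hi j hj e
    obtain ⟨j', hj', ej, hjj⟩ := rot_eq (h := h) hr hj
    rw [ej] at e
    have := hadj _ (by omega) _ hj' e
    omega
  · rw [rot_of_lt (j := β) (by omega) (by omega)]
    simpa using aβ
  · rw [rot_of_lt (j := γ) (by omega) (by omega)]
    simpa using aγ
  · rw [rot_of_ge (j := l) (by omega)]
    simpa using al
  · rw [rot_of_ge (j := r) (by omega)]
    simpa using ar

theorem containsPrism (B : IsHoleLink G h N μ s l (l + 1) β (β + 1)) : ContainsPrism G := by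
  obtain ⟨H, hμ, hne, hlr, hrβ, hβγ, hγN, hγl, hadj, al, ar, aβ, aγ⟩ := B
  have el : rot h N (β + 1) (N - (β + 1) + l) = h l := rot_of_ge (by omega)
  have er : rot h N (β + 1) (N - (β + 1) + l + 1) = h (l + 1) := rot_of_ge (by omega)
  have eβ : rot h N (β + 1) (N - 1) = h β := rot_of_ge (by omega)
  have eγ : rot h N (β + 1) 0 = h (β + 1) := rot_of_lt (by omega) (by omega)
  have HF := H.rot hγN
  have cr : ∀ i ≤ s, ∀ t < N, μ i ≠ rot h N (β + 1) t ∧ (G.Adj (μ i) (rot h N (β + 1) t) →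
      (i = 0 ∧ (t = N - (β + 1) + l ∨ t = N - (β + 1) + l + 1)) ∨
        (i = s ∧ (t = N - 1 ∨ t = 0))) := by
    intro i hi t ht
    obtain ⟨j, hj, e, hjj⟩ := rot_eq (h := h) hγN ht
    rw [e]
    refine ⟨hne i hi j hj, fun ha => ?_⟩
    have := hadj i hi j hj ha
    omega
  rw [← el] at al
  rw [← er] at ar
  rw [← eβ] at aβ
  rw [← eγ] at aγ
  generalize rot h N (β + 1) = F at *
  obtain ⟨L, hL⟩ : ∃ L, N - (β + 1) + l = L := ⟨_, rfl⟩
  rw [hL] at cr al ar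
  have d1 := HF.rel (i := L + 1) (j := N - 1) (by omega) (by omega) (by omega)
  have d2 := HF.rel (i := 0) (j := L) (by omega) (by omega) (by omega)
  refine prism_of_sets (a₁ := μ 0) (a₂ := F (L + 1)) (a₃ := F L) (b₁ := μ s) (b₂ := F (N - 1))
    (b₃ := F 0) (A₁ := μ '' Set.Icc 0 s) (A₂ := F '' Set.Icc (L + 1) (N - 1))
    (A₃ := F '' Set.Icc 0 L) ar al (HF.adj (by omega)).symm aβ aγ ?_
    (hμ.conn le_rfl _ ⟨0, by simp, rfl⟩ _ ⟨s, by simp, rfl⟩)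
    (conn_image_Icc (f := F) (fun k _ hk => HF.adj (by omega)) _ ⟨L + 1, ⟨le_rfl, by omega⟩, rfl⟩ _
      ⟨N - 1, ⟨by omega, le_rfl⟩, rfl⟩)
    (conn_image_Icc (f := F) (fun k _ hk => HF.adj (by omega)) _ ⟨L, ⟨by omega, le_rfl⟩, rfl⟩ _
      ⟨0, ⟨le_rfl, by omega⟩, rfl⟩) ?_ ?_ ?_ d1.1 d2.1.symm
    (Or.inr ⟨by rw [d1.2]; omega, by rw [G.adj_comm, d2.2]; omega⟩)
  · rw [← HF.closed]
    have := HF.adj (i := N - 1) (by omega)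
    rwa [show N - 1 + 1 = N by omega] at this
  · rintro _ ⟨i, ⟨-, hi⟩, rfl⟩ _ ⟨t, ⟨ht, ht'⟩, rfl⟩
    refine ⟨(cr i hi t (by omega)).1, fun e => ?_⟩
    rcases (cr i hi t (by omega)).2 e with ⟨rfl, h⟩ | ⟨rfl, h⟩
    · exact Or.inl ⟨rfl, by congr 1; omega⟩
    · exact Or.inr ⟨rfl, by congr 1; omega⟩
  · rintro _ ⟨i, ⟨-, hi⟩, rfl⟩ _ ⟨t, ⟨ht, ht'⟩, rfl⟩
    refine ⟨(cr i hi t (by omega)).1, fun e => ?_⟩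
    rcases (cr i hi t (by omega)).2 e with ⟨rfl, h⟩ | ⟨rfl, h⟩
    · exact Or.inl ⟨rfl, by congr 1; omega⟩
    · exact Or.inr ⟨rfl, by congr 1; omega⟩
  · rintro _ ⟨i, ⟨hi, hi'⟩, rfl⟩ _ ⟨t, ⟨ht, ht'⟩, rfl⟩
    have d := HF.rel (i := t) (j := i) (by omega) (by omega) (by omega)
    refine ⟨d.1.symm, fun e => ?_⟩
    rw [G.adj_comm, d.2] at e
    rcases Nat.eq_zero_or_pos t with rfl | h
    · rcases Nat.eq_or_lt_of_le hi' with rfl | h'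
      · exact Or.inr ⟨rfl, rfl⟩
      · exact Or.inl ⟨by congr 1; omega, by congr 1; omega⟩
    · exact Or.inl ⟨by congr 1; omega, by congr 1; omega⟩

theorem smallSep_of_ne {t : ℕ} (hG : MemCt t G) (B : IsHoleLink G h N μ s l r β γ)
    (hlr' : r ≠ l + 1) :
    SmallSep G (6 * t + 1) {v | ∃ i, i < N ∧ (i < l ∨ γ < i) ∧ v = h i}
      {v | ∃ j, r < j ∧ j < β ∧ v = h j} := by
  obtain ⟨H, hμ, hne, hlr, hrβ, hβγ, hγN, hγl, hadj, al, ar, aβ, aγ⟩ := B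
  rcases Nat.eq_or_lt_of_le hlr with rfl | hlt
  · have hl : l < N := by omega
    have h0 : rot h N l 0 = h l := rot_of_lt hl rfl
    have hβ : rot h N l (β - l) = h β := rot_of_lt (by omega) (by omega)
    have hγ : rot h N l (γ - l) = h γ := rot_of_lt (by omega) (by omega)
    refine ((H.rot hl).smallSep_of_origin hG hμ ?_ (β := β - l) (γ := γ - l) (by omega) (by omega)
      (by omega) ?_ (by rwa [h0]) (by rwa [hβ]) (by rwa [hγ])).symm.mono ?_ ?_
    · intro i hi j hj
      obtain ⟨j', hj', e, -⟩ := rot_eq (h := h) hl hj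
      rw [e]
      exact hne _ hi _ hj'
    · intro i hi j hj e
      obtain ⟨j', hj', ej, hjj⟩ := rot_eq (h := h) hl hj
      rw [ej] at e
      have := hadj _ hi _ hj' e
      omega
    · rintro _ ⟨i, hi, hi' | hi', rfl⟩
      · exact ⟨N - l + i, by omega, by omega, (rot_of_ge (by omega)).symm⟩
      · exact ⟨i - l, by omega, by omega, (rot_of_lt hi (by omega)).symm⟩
    · rintro _ ⟨j, hj, hj', rfl⟩
      exact ⟨j - l, by omega, by omega, (rot_of_lt (by omega) (by omega)).symm⟩
  rcases Nat.eq_zero_or_pos s with rfl | hs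
  · obtain ⟨hθ, hpr, hK⟩ := hG
    have hβN : β < N := by omega
    have HF := H.rot hβN
    obtain ⟨Z, hZ, hsub⟩ := HF.exists_wheelCore hK (μ 0)
    refine ⟨Z, hZ, ?_⟩
    rintro D hD hDZ _ ⟨i, hi, hi', rfl⟩ _ ⟨j, hj, hj', rfl⟩ hiD hjD
    obtain ⟨i', hi'', ei⟩ : ∃ i' < N - β + l, rot h N β i' = h i := by
      rcases hi' with h1 | h1
      · exact ⟨N - β + i, by omega, rot_of_ge (by omega)⟩
      · exact ⟨i - β, by omega, rot_of_lt hi (by omega)⟩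
    have e1 : rot h N β (N - β + l) = h l := rot_of_ge (by omega)
    have e2 : rot h N β (N - β + r) = h r := rot_of_ge (by omega)
    have e3 : rot h N β 0 = h β := rot_of_lt (by omega) (by omega)
    have e4 : rot h N β (N - β + j) = h j := rot_of_ge (by omega)
    refine HF.not_conn_of_wheel hθ hpr (c := μ 0) ?_ (by rwa [e3]) (p := N - β + l)
      (q := N - β + r) (by omega) (by omega) (by omega) (by rwa [e1]) (by rwa [e2]) hD
      (hDZ.mono subset_rfl hsub) (i₀ := i') (m₀ := N - β + l) (j₀ := N - β + j) hi''
      (by omega) (by omega) (by rwa [e1]) (by rwa [ei]) (by rwa [e4])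
    intro i hi
    rcases Nat.eq_or_lt_of_le hi with rfl | hi
    · rw [HF.closed, e3]
      exact (hne 0 le_rfl β (by omega)).symm
    · obtain ⟨j', hj', e, -⟩ := rot_eq (h := h) hβN hi
      rw [e]
      exact (hne 0 le_rfl _ hj').symm
  · have hr : r < N := by omega
    obtain ⟨L, hL⟩ : ∃ L, L = N - r + l := ⟨_, rfl⟩
    have hA : IsIP G (rot h N r) L := by
      simpa using (H.rot hr).isIP (a := 0) (m := L) (by omega) (by omega)
    have e0 : rot h N r 0 = h r := rot_of_lt (by omega) (by omega)
    have eL : rot h N r L = h l := rot_of_ge (by omega)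
    have HF := hA.hole_of_cap (v := μ 0) (by omega) (fun t ht => by
        obtain ⟨j, hj, e, -⟩ := rot_eq (h := h) (t := t) hr (by omega)
        rw [e]
        exact hne 0 (by omega) j hj) (fun t ht => by
        constructor
        · intro e
          obtain ⟨j, hj, e', hjj⟩ := rot_eq (h := h) (t := t) hr (by omega)
          rw [e'] at e
          have := hadj 0 (by omega) j hj e
          omega
        · rintro (rfl | rfl)
          · rwa [e0]
          · rwa [eL])
    have hF : ∀ t, 0 < t → t < L + 2 →
        (if t = 0 ∨ t = L + 2 then μ 0 else rot h N r (t - 1)) = rot h N r (t - 1) :=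
      fun t _ _ => if_neg (by omega)
    have eβ : rot h N r (β - r) = h β := rot_of_lt (by omega) (by omega)
    have eγ : rot h N r (γ - r) = h γ := rot_of_lt (by omega) (by omega)
    refine (HF.smallSep_of_origin hG (g := fun i => μ (1 + i)) (m := s - 1)
      (hμ.shift (by omega)) ?_ (β := β - r + 1) (γ := γ - r + 1) (by omega) (by omega)
      (by omega) ?_ ?_ ?_ ?_).symm.mono ?_ ?_
    · intro i hi j hj
      rcases Nat.eq_zero_or_pos j with rfl | hj0
      · rw [if_pos (by omega)]
        exact (hμ 0 (1 + i) (by omega) (by omega)).1.symm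
      · rw [hF j hj0 hj]
        obtain ⟨j', hj', e, -⟩ := rot_eq (h := h) (t := j - 1) hr (by omega)
        rw [e]
        exact hne _ (by omega) _ hj'
    · intro i hi j hj e
      rcases Nat.eq_zero_or_pos j with rfl | hj0
      · rw [if_pos (by omega), hμ.adj_iff (by omega) (by omega)] at e
        omega
      · rw [hF j hj0 hj] at e
        obtain ⟨j', hj', ej, hjj⟩ := rot_eq (h := h) (t := j - 1) hr (by omega)
        rw [ej] at e
        have := hadj _ (by omega) _ hj' e
        omega
    · simpa using (hμ.adj (i := 0) hs).symm
    · rw [hF _ (by omega) (by omega), show β - r + 1 - 1 = β - r by omega, eβ,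
        show 1 + (s - 1) = s by omega]
      exact aβ
    · rw [hF _ (by omega) (by omega), show γ - r + 1 - 1 = γ - r by omega, eγ,
        show 1 + (s - 1) = s by omega]
      exact aγ
    · rintro _ ⟨i, hi, hi' | hi', rfl⟩
      · refine ⟨N - r + i + 1, by omega, by omega, ?_⟩
        rw [hF _ (by omega) (by omega)]
        exact (rot_of_ge (by omega)).symm
      · refine ⟨i - r + 1, by omega, by omega, ?_⟩
        rw [hF _ (by omega) (by omega)]
        exact (rot_of_lt hi (by omega)).symm
    · rintro _ ⟨j, hj, hj', rfl⟩
      refine ⟨j - r + 1, by omega, by omega, ?_⟩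
      rw [hF _ (by omega) (by omega)]
      exact (rot_of_lt (by omega) (by omega)).symm

theorem smallSep {t : ℕ} (hG : MemCt t G) (B : IsHoleLink G h N μ s l r β γ) :
    SmallSep G (6 * t + 1) {v | ∃ i, i < N ∧ (i < l ∨ γ < i) ∧ v = h i}
      {v | ∃ j, r < j ∧ j < β ∧ v = h j} := by
  have := B.βγ
  have := B.rβ
  have := B.γN
  have := B.γl
  by_cases h1 : r = l + 1
  · by_cases h2 : γ = β + 1
    · subst h1 h2
      exact absurd B.containsPrism hG.2.1
    · refine (B.flip.smallSep_of_ne hG (by omega)).symm.mono ?_ ?_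
      · rintro _ ⟨i, hi, hi' | hi', rfl⟩
        · exact ⟨N - r - 1 + i, by omega, by omega, (rot_of_ge (by omega)).symm⟩
        · exact ⟨i - r - 1, by omega, by omega, (rot_of_lt hi (by omega)).symm⟩
      · rintro _ ⟨j, hj, hj', rfl⟩
        exact ⟨j - r - 1, by omega, by omega, (rot_of_lt (by omega) (by omega)).symm⟩
  · exact B.smallSep_of_ne hG h1

end IsHoleLink

/-! ### A path anticomplete to a connected set -/

/-- `P 0, …, P n` is an induced path apart from the connected set `B`; `y₁` and `y₂` have
neighbours in `B`, and their unique neighbours on the path are its first and last vertex. -/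
structure IsPathEnds (G : SimpleGraph V) (P : ℕ → V) (n : ℕ) (B : Set V) (y₁ y₂ : V) : Prop where
  ip : IsIP G P n
  conn : Conn G B
  apart : ∀ i ≤ n, ∀ b ∈ B, P i ≠ b ∧ ¬ G.Adj (P i) b
  touch₁ : ∃ b ∈ B, G.Adj y₁ b
  touch₂ : ∃ b ∈ B, G.Adj y₂ b
  ne₁ : ∀ i ≤ n, y₁ ≠ P i
  ne₂ : ∀ i ≤ n, y₂ ≠ P i
  adj₁ : ∀ i ≤ n, G.Adj y₁ (P i) ↔ i = 0
  adj₂ : ∀ i ≤ n, G.Adj y₂ (P i) ↔ i = n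

namespace IsPathEnds

variable {G : SimpleGraph V} {P : ℕ → V} {n : ℕ} {B : Set V} {y₁ y₂ : V}

theorem not_mem₁ (E : IsPathEnds G P n B y₁ y₂) : y₁ ∉ B := fun h =>
  (E.apart 0 (Nat.zero_le _) _ h).2 ((E.adj₁ 0 (Nat.zero_le _)).2 rfl).symm

theorem not_mem₂ (E : IsPathEnds G P n B y₁ y₂) : y₂ ∉ B := fun h =>
  (E.apart n le_rfl _ h).2 ((E.adj₂ n le_rfl).2 rfl).symm

theorem exists_hole (E : IsPathEnds G P n B y₁ y₂) (hn : 2 ≤ n) :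
    ∃ (m : ℕ) (q : ℕ → V), q 0 = y₂ ∧ q m = y₁ ∧ (∀ k, 0 < k → k < m → q k ∈ B) ∧
      IsHole G (fun i => if i ≤ n then P i else if i ≤ n + 1 + m then q (i - (n + 1)) else P 0)
        (n + m + 2) := by
  have hne : y₂ ≠ y₁ := by
    rintro rfl
    have := (E.adj₂ 0 (by omega)).1 ((E.adj₁ 0 (by omega)).2 rfl)
    omega
  obtain ⟨b₁, hb₁, hyb₁⟩ := E.touch₁
  obtain ⟨b₂, hb₂, hyb₂⟩ := E.touch₂
  have hreach : Reaches G (insert y₁ (insert y₂ B)) y₂ y₁ :=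
    ((Reaches.of_adj hyb₂ (by simp) (by simp [hb₂])).trans
      ((E.conn b₂ hb₂ b₁ hb₁).mono fun x hx => by simp [hx])).trans
      (.of_adj hyb₁.symm (by simp [hb₁]) (by simp))
  obtain ⟨m, q, hq0, hqm, hqB, hq, -⟩ := exists_isIP (T := fun v => v = y₁) hreach rfl
  have hm : 0 < m := by
    rcases Nat.eq_zero_or_pos m with rfl | h
    · exact absurd (hq0.symm.trans hqm) hne
    · exact h
  have hqmid : ∀ k, 0 < k → k < m → q k ∈ B := by
    intro k h1 h2
    rcases hqB k h2.le with h | h | h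
    · have := hq.inj h2.le le_rfl (h.trans hqm.symm)
      omega
    · have := hq.inj h2.le (Nat.zero_le _) (h.trans hq0.symm)
      omega
    · exact h
  have cross : ∀ i ≤ n, ∀ k ≤ m, P i ≠ q k ∧
      (G.Adj (P i) (q k) ↔ (k = 0 ∧ i = n) ∨ (k = m ∧ i = 0)) := by
    intro i hi k hk
    rcases Nat.eq_zero_or_pos k with rfl | h0
    · rw [hq0, G.adj_comm, E.adj₂ i hi]
      exact ⟨(E.ne₂ i hi).symm, by omega⟩
    · rcases Nat.eq_or_lt_of_le hk with rfl | hk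
      · rw [hqm, G.adj_comm, E.adj₁ i hi]
        exact ⟨(E.ne₁ i hi).symm, by omega⟩
      · obtain ⟨c1, c2⟩ := E.apart i hi _ (hqmid k h0 hk)
        exact ⟨c1, ⟨fun e => absurd e c2, by omega⟩⟩
  refine ⟨m, q, hq0, hqm, hqmid, by omega, ?_, ?_⟩
  · rw [if_neg (by omega), if_neg (by omega), if_pos (by omega)]
  · intro i j hij hj
    rcases Nat.lt_or_ge n i with h1 | h1
    · rw [if_neg (by omega), if_pos (by omega), if_neg (by omega), if_pos (by omega)]
      obtain ⟨c1, c2⟩ := hq (i - (n + 1)) (j - (n + 1)) (by omega) (by omega)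
      exact ⟨c1, by rw [c2]; omega⟩
    · rcases Nat.lt_or_ge n j with h2 | h2
      · rw [if_pos h1, if_neg (by omega), if_pos (by omega)]
        obtain ⟨c1, c2⟩ := cross i h1 (j - (n + 1)) (by omega)
        exact ⟨c1, by rw [c2]; omega⟩
      · rw [if_pos h1, if_pos h2]
        obtain ⟨c1, c2⟩ := E.ip i j hij h2
        exact ⟨c1, by rw [c2]; omega⟩

theorem smallSep {t : ℕ} (hG : MemCt t G) (E : IsPathEnds G P n B y₁ y₂) {y : V} {l r : ℕ}
    (hy : ∃ b ∈ B, G.Adj y b) (hyP : ∀ i ≤ n, y ≠ P i) (hl : 1 ≤ l) (hlr : l ≤ r) (hr : r + 1 ≤ n)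
    (hyl : G.Adj y (P l)) (hyr : G.Adj y (P r)) (hull : ∀ i ≤ n, G.Adj y (P i) → l ≤ i ∧ i ≤ r)
    (hy₁ : y ≠ y₁ ∧ ¬ G.Adj y y₁) (hy₂ : y ≠ y₂ ∧ ¬ G.Adj y y₂) :
    SmallSep G (6 * t + 1) {v | ∃ i < l, v = P i} {v | ∃ i, r < i ∧ i ≤ n ∧ v = P i} := by
  classical
  obtain ⟨m, q, hq0, hqm, hqB, H⟩ := E.exists_hole (by omega)
  have hyB : y ∉ B := fun h => (E.apart l (by omega) _ h).2 hyl.symm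
  obtain ⟨b, hb, hyb⟩ := hy
  obtain ⟨b₁, hb₁, hyb₁⟩ := E.touch₁
  have hreach : Reaches G (insert y B) y b₁ :=
    (Reaches.of_adj hyb (by simp) (by simp [hb])).trans
      ((E.conn b hb b₁ hb₁).mono fun x hx => by simp [hx])
  obtain ⟨s, μ, hμ0, ⟨k₀, hk₀, hk₀'⟩, hμB, hμ, hμT⟩ :=
    exists_isIP (T := fun v => ∃ k ≤ m, G.Adj v (q k)) hreach
      ⟨m, le_rfl, by rw [hqm]; exact hyb₁.symm⟩
  have hμpos : ∀ i ≤ s, 0 < i → μ i ∈ B := by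
    intro i hi h0
    rcases hμB i hi with h | h
    · have := hμ.inj hi (Nat.zero_le _) (h.trans hμ0.symm)
      omega
    · exact h
  have hμq : ∀ i ≤ s, ∀ k ≤ m, μ i ≠ q k := by
    intro i hi k hk e
    have hq₁ : ∀ j ≤ s, μ j ≠ y₁ := by
      intro j hj e
      rcases Nat.eq_zero_or_pos j with rfl | h
      · exact hy₁.1 (hμ0.symm.trans e)
      · exact E.not_mem₁ (e ▸ hμpos j hj h)
    have hq₂ : ∀ j ≤ s, μ j ≠ y₂ := by
      intro j hj e
      rcases Nat.eq_zero_or_pos j with rfl | h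
      · exact hy₂.1 (hμ0.symm.trans e)
      · exact E.not_mem₂ (e ▸ hμpos j hj h)
    rcases Nat.eq_zero_or_pos k with rfl | h0
    · exact hq₂ i hi (e.trans hq0)
    rcases Nat.eq_or_lt_of_le hk with rfl | hk'
    · exact hq₁ i hi (e.trans hqm)
    rcases Nat.eq_zero_or_pos i with rfl | hi0
    · rw [hμ0] at e
      exact hyB (e ▸ hqB k h0 hk')
    · refine hμT (i - 1) (by omega) ⟨k, hk, ?_⟩
      rw [← e]
      have := hμ.adj (i := i - 1) (by omega)
      rwa [show i - 1 + 1 = i by omega] at this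
  have hex : ∃ k, k ≤ m ∧ G.Adj (μ s) (q k) := ⟨k₀, hk₀, hk₀'⟩
  obtain ⟨k₁, ⟨hk₁, hk₁'⟩, hmin⟩ : ∃ k, (k ≤ m ∧ G.Adj (μ s) (q k)) ∧
      ∀ j ≤ m, G.Adj (μ s) (q j) → k ≤ j :=
    ⟨_, Nat.find_spec hex, fun j hj hj' => Nat.find_min' hex ⟨hj, hj'⟩⟩
  obtain ⟨k₂, hk₂, hk₂', hmax⟩ : ∃ k, k ≤ m ∧ G.Adj (μ s) (q k) ∧
      ∀ j ≤ m, G.Adj (μ s) (q j) → j ≤ k :=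
    ⟨_, Nat.findGreatest_le m, Nat.findGreatest_spec (P := fun k => G.Adj (μ s) (q k)) hk₀ hk₀',
      fun j hj hj' => Nat.le_findGreatest hj hj'⟩
  have hP : ∀ i ≤ n,
      (if i ≤ n then P i else if i ≤ n + 1 + m then q (i - (n + 1)) else P 0) = P i :=
    fun i hi => if_pos hi
  have hQ : ∀ k ≤ m, (if n + 1 + k ≤ n then P (n + 1 + k) else if n + 1 + k ≤ n + 1 + m then
      q (n + 1 + k - (n + 1)) else P 0) = q k := fun k hk => by
    rw [if_neg (by omega), if_pos (by omega), Nat.add_sub_cancel_left]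
  have L : IsHoleLink G (fun i => if i ≤ n then P i else if i ≤ n + 1 + m then q (i - (n + 1))
      else P 0) (n + m + 2) μ s l r (n + 1 + k₁) (n + 1 + k₂) := by
    refine ⟨H, hμ, ?_, hlr, by omega, ?_, by omega, by omega, ?_, ?_, ?_, ?_, ?_⟩
    · intro i hi j hj
      rcases Nat.lt_or_ge n j with h | h
      · obtain ⟨k, rfl⟩ := Nat.exists_eq_add_of_le (show n + 1 ≤ j from h)
        simp only [hQ k (by omega)]
        exact hμq i hi k (by omega)
      · simp only [hP j h]
        rcases Nat.eq_zero_or_pos i with rfl | hi0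
        · rw [hμ0]
          exact hyP j h
        · exact (E.apart j h _ (hμpos i hi hi0)).1.symm
    · have := hmin k₂ hk₂ hk₂'
      omega
    · intro i hi j hj e
      rcases Nat.lt_or_ge n j with h | h
      · obtain ⟨k, rfl⟩ := Nat.exists_eq_add_of_le (show n + 1 ≤ j from h)
        simp only [hQ k (by omega)] at e
        have his : i = s := by
          by_contra hne
          exact hμT i (by omega) ⟨k, by omega, e⟩
        subst his
        have h1 := hmin k (by omega) e
        have h2 := hmax k (by omega) e
        exact Or.inr ⟨rfl, by omega, by omega⟩
      · simp only [hP j h] at e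
        rcases Nat.eq_zero_or_pos i with rfl | hi0
        · rw [hμ0] at e
          exact Or.inl ⟨rfl, hull j h e⟩
        · exact absurd e.symm (E.apart j h _ (hμpos i hi hi0)).2
    · simp only [hP l (by omega), hμ0]
      exact hyl
    · simp only [hP r (by omega), hμ0]
      exact hyr
    · simp only [hQ k₁ hk₁]
      exact hk₁'
    · simp only [hQ k₂ hk₂]
      exact hk₂'
  refine (L.smallSep hG).mono ?_ ?_
  · rintro _ ⟨i, hi, rfl⟩
    exact ⟨i, by omega, Or.inl hi, (hP i (by omega)).symm⟩
  · rintro _ ⟨i, hi, hi', rfl⟩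
    exact ⟨i, hi, by omega, (hP i hi').symm⟩

end IsPathEnds

theorem adj_of_both_sides {G : SimpleGraph V} (hθ : ¬ ContainsTheta G) {P : ℕ → V} {n : ℕ}
    {B : Set V} (hP : IsIP G P n) (hB : Conn G B)
    (hPB : ∀ i ≤ n, ∀ b ∈ B, P i ≠ b ∧ ¬ G.Adj (P i) b)
    {y y' : V} (hyy : y ≠ y') (hy : ∃ b ∈ B, G.Adj y b) (hy' : ∃ b ∈ B, G.Adj y' b) {a : ℕ}
    (hl : ∃ i < a, G.Adj y (P i)) (hl' : ∃ i < a, G.Adj y' (P i))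
    (hr : ∃ i, a < i ∧ i ≤ n ∧ G.Adj y (P i)) (hr' : ∃ i, a < i ∧ i ≤ n ∧ G.Adj y' (P i)) :
    G.Adj y y' := by
  by_contra hadj
  obtain ⟨b, hb, hyb⟩ := hy
  obtain ⟨b', hb', hyb'⟩ := hy'
  obtain ⟨i, hi, hyi⟩ := hl
  obtain ⟨i', hi', hyi'⟩ := hl'
  obtain ⟨j, hj, hjn, hyj⟩ := hr
  obtain ⟨j', hj', hjn', hyj'⟩ := hr'
  have key : ∀ {A : Set V} {u u'}, Conn G A → u ∈ A → u' ∈ A → G.Adj y u → G.Adj y' u' →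
      Reaches G (insert y (insert y' A)) y y' := fun hA hu hu' e e' =>
    ((Reaches.of_adj e (by simp) (by simp [hu])).trans
      ((hA _ hu _ hu').mono fun x hx => by simp [hx])).trans
      (.of_adj e'.symm (by simp [hu']) (by simp))
  refine hθ (theta_of_sets (a := y) (b := y') (A₁ := P '' Set.Icc 0 (a - 1))
    (A₂ := P '' Set.Icc (a + 1) n) (A₃ := B) hyy hadj (hP.apart (by omega) le_rfl) ?_ ?_
    (key (hP.conn (by omega)) ⟨i, ⟨by omega, by omega⟩, rfl⟩ ⟨i', ⟨by omega, by omega⟩, rfl⟩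
      hyi hyi')
    (key (hP.conn le_rfl) ⟨j, ⟨by omega, by omega⟩, rfl⟩ ⟨j', ⟨by omega, by omega⟩, rfl⟩ hyj hyj')
    (key hB hb hb' hyb hyb'))
  · rintro _ ⟨k, ⟨-, hk⟩, rfl⟩ x hx
    exact hPB k (by omega) x hx
  · rintro _ ⟨k, ⟨-, hk⟩, rfl⟩ x hx
    exact hPB k hk x hx

/-! ### Independence number of sets of vertices -/

/-- The independence number of the subgraph induced on `A` is at most `k`. -/
def AlphaLE (G : SimpleGraph V) (A : Set V) (k : ℕ) : Prop :=
  ∀ S : Finset V, ↑S ⊆ A → StableSet G ↑S → S.card ≤ k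

theorem StableSet.mono {G : SimpleGraph V} {A B : Set V} (h : StableSet G A) (hB : B ⊆ A) :
    StableSet G B := fun x hx y hy => h x (hB hx) y (hB hy)

theorem AlphaLE.mono {G : SimpleGraph V} {A B : Set V} {k m : ℕ} (h : AlphaLE G A k) (hB : B ⊆ A)
    (hk : k ≤ m) : AlphaLE G B m :=
  fun S hS hst => (h S (hS.trans hB) hst).trans hk

theorem AlphaLE.union {G : SimpleGraph V} {A B : Set V} {k m : ℕ} (hA : AlphaLE G A k)
    (hB : AlphaLE G B m) : AlphaLE G (A ∪ B) (k + m) := by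
  classical
  intro S hS hst
  have h1 := hA (S.filter (· ∈ A)) (fun x hx => by simp at hx; exact hx.2)
    (hst.mono fun x hx => by simp at hx; exact hx.1)
  have h2 := hB (S.filter (· ∉ A)) (fun x hx => by
      simp at hx
      exact (hS hx.1).resolve_left hx.2) (hst.mono fun x hx => by simp at hx; exact hx.1)
  have h3 := Finset.card_filter_add_card_filter_not (s := S) (· ∈ A)
  omega

theorem alphaLE_nbhd {G : SimpleGraph V} {t : ℕ} (hK : ¬ ContainsK1t G t) (Z : Finset V) :
    AlphaLE G {v | ∃ z ∈ Z, v = z ∨ G.Adj v z} (Z.card * t) := by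
  classical
  intro S hS hst
  have hsub : S ⊆ Z.biUnion fun z => S.filter fun v => v = z ∨ G.Adj v z := by
    intro v hv
    obtain ⟨z, hz, h⟩ := hS hv
    exact Finset.mem_biUnion.2 ⟨z, hz, Finset.mem_filter.2 ⟨hv, h⟩⟩
  refine (Finset.card_le_card hsub).trans (Finset.card_biUnion_le_card_mul _ _ _ fun z _ => ?_)
  have hst' : StableSet G ((S.filter fun v => v = z ∨ G.Adj v z : Finset V) : Set V) :=
    hst.mono fun x hx => (Finset.mem_filter.1 hx).1
  by_cases hz : z ∈ S
  · have : (S.filter fun v => v = z ∨ G.Adj v z) ⊆ {z} := by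
      intro v hv
      rw [Finset.mem_filter] at hv
      rw [Finset.mem_singleton]
      by_contra hne
      exact hst v hv.1 z hz hne (hv.2.resolve_left hne)
    have h1 := Finset.card_le_card this
    have h2 := pos_of_not_containsK1t hK z
    rw [Finset.card_singleton] at h1
    omega
  · refine (card_lt_of_stable_nbrs hK (v := z) hst' fun x hx => ?_).le
    rw [Finset.mem_filter] at hx
    rcases hx.2 with rfl | h
    exacts [absurd hx.1 hz, h.symm]

/-! ### Balanced separators -/

theorem Reaches.exists_exit {G : SimpleGraph V} {A D : Set V} {u v : V} (h : Reaches G A u v)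
    (hu : u ∈ D) (hv : v ∉ D) : ∃ x ∈ D, ∃ y ∈ A, y ∉ D ∧ G.Adj x y := by
  by_contra! hc
  refine hv (h.induction (C := fun x => x ∈ D) hu fun x y hx hxy hy => ?_)
  by_contra hyD
  exact hc x hx y hy hyD hxy

/-- A family of big sets: it is upward closed and any two members intersect. -/
structure IsBigness (Big : Set V → Prop) : Prop where
  mono : ∀ {D D'}, Big D → D ⊆ D' → Big D'
  inter : ∀ {D D'}, Big D → Big D' → ∃ x ∈ D, x ∈ D'

/-- `P 0, …, P (n - 1)` is an induced path apart from `B` which dominates the neighbours of `B`. -/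
structure IsGuard (G : SimpleGraph V) (B : Set V) (P : ℕ → V) (n : ℕ) : Prop where
  ip : IsIP G P (n - 1)
  apart : ∀ i < n, ∀ b ∈ B, P i ≠ b ∧ ¬ G.Adj (P i) b
  dom : ∀ v, v ∉ B → (∃ b ∈ B, G.Adj v b) → ∃ i < n, G.Adj v (P i)

theorem IsBigness.exists_guard [Finite V] {G : SimpleGraph V} {Big : Set V → Prop}
    (hBig : IsBigness Big) {D₀ : Set V} (hD₀ : Conn G D₀) (hD₀' : Big D₀) :
    ∃ B P n p, Conn G B ∧ Big B ∧ IsGuard G B P n ∧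
      ∀ D ⊆ B, Conn G D → Big D → ∃ x ∈ D, x = p ∨ G.Adj x p := by
  let State : Set V → Prop := fun B => Conn G B ∧ Big B ∧ ∃ n P, IsIP G P n ∧ IsGuard G B P n ∧
    (P n ∈ B ∨ ∃ b ∈ B, G.Adj (P n) b)
  have hex : ∃ B, State B := by
    obtain ⟨B, -, hB⟩ := (Set.toFinite {D | Conn G D ∧ Big D}).exists_le_maximal ⟨hD₀, hD₀'⟩
    obtain ⟨y, hy, -⟩ := hBig.inter hB.prop.2 hB.prop.2
    refine ⟨B, hB.prop.1, hB.prop.2, 0, fun _ => y, fun i j h h' => by omega,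
      ⟨fun i j h h' => by omega, fun i h => by omega, fun v hv hvB => ?_⟩, Or.inl hy⟩
    obtain ⟨b, hb, hvb⟩ := hvB
    exact absurd (hB.le_of_ge ⟨hB.prop.1.insert hb hvb, hBig.mono hB.prop.2 (Set.subset_insert _ _)⟩
      (Set.subset_insert _ _) (Set.mem_insert v B)) hv
  obtain ⟨B, hB⟩ := (Set.toFinite {B | State B}).exists_minimal hex
  obtain ⟨hBc, hBb, n, P, hP, hg, hend⟩ := hB.prop
  refine ⟨B, P, n, P n, hBc, hBb, hg, fun D hDB hDc hDb => ?_⟩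
  by_contra! hD
  obtain ⟨B', hDB', hB'⟩ := (Set.toFinite {D | D ⊆ B ∧ Conn G D ∧ Big D ∧
    ∀ x ∈ D, x ≠ P n ∧ ¬ G.Adj x (P n)}).exists_le_maximal ⟨hDB, hDc, hDb, hD⟩
  obtain ⟨hsub, hc', hb', hap⟩ := hB'.prop
  have step : ∀ v ∈ B, v ∉ B' → (∃ b ∈ B', G.Adj v b) → G.Adj v (P n) := by
    rintro v hv hvB' ⟨b, hb, hvb⟩
    have hvn : v ≠ P n := by
      rintro rfl
      exact (hap b hb).2 hvb.symm
    by_contra hadj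
    refine hvB' (hB'.le_of_ge ⟨Set.insert_subset hv hsub, hc'.insert hb hvb,
      hBig.mono hb' (Set.subset_insert _ _), ?_⟩ (Set.subset_insert _ _) (Set.mem_insert v B'))
    rintro x (rfl | hx)
    exacts [⟨hvn, hadj⟩, hap x hx]
  obtain ⟨b₀, hb₀, -⟩ := hBig.inter hb' hb'
  have hreach : Reaches G (insert (P n) B) b₀ (P n) := by
    rcases hend with h | ⟨b, hb, hbn⟩
    · exact (hBc _ (hsub hb₀) _ h).mono (Set.subset_insert _ _)
    · exact ((hBc _ (hsub hb₀) _ hb).mono (Set.subset_insert _ _)).trans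
        (.of_adj hbn.symm (by simp [hb]) (by simp))
  obtain ⟨x, hx, y, hy, hyB', hxy⟩ := hreach.exists_exit hb₀ fun h => (hap _ h).1 rfl
  have hyB : y ∈ B := by
    rcases hy with rfl | h
    · exact absurd hxy (hap x hx).2
    · exact h
  have hyn := step y hyB hyB' ⟨x, hx, hxy.symm⟩
  have hPe : ∀ i ≤ n, (if i ≤ n then P i else y) = P i := fun i hi => if_pos hi
  have hPn : (if n + 1 ≤ n then P (n + 1) else y) = y := if_neg (by omega)
  have hP' : IsIP G (fun i => if i ≤ n then P i else y) (n + 1) := by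
    intro i j hij hj
    simp only
    rw [hPe i (by omega)]
    rcases Nat.eq_or_lt_of_le hj with rfl | hj
    · rw [hPn]
      rcases Nat.eq_or_lt_of_le (Nat.le_of_lt_succ hij) with rfl | hi
      · exact ⟨hyn.ne.symm, by simp [hyn.symm]⟩
      · obtain ⟨c1, c2⟩ := hg.apart i hi y hyB
        exact ⟨c1, ⟨fun e => absurd e c2, by omega⟩⟩
    · rw [hPe j (by omega)]
      exact hP i j hij (by omega)
  refine hyB' (hB.le_of_le (y := B') ⟨hc', hb', n + 1, _, hP', ⟨hP'.mono (by omega), ?_, ?_⟩,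
    Or.inr ⟨x, hx, ?_⟩⟩ hsub hyB)
  · intro i hi b hb
    rw [hPe i (by omega)]
    rcases Nat.eq_or_lt_of_le (Nat.le_of_lt_succ hi) with rfl | hi
    · exact ⟨(hap b hb).1.symm, fun e => (hap b hb).2 e.symm⟩
    · exact hg.apart i hi b (hsub hb)
  · rintro v hv ⟨b, hb, hvb⟩
    by_cases hvB : v ∈ B
    · exact ⟨n, by omega, by simpa using step v hvB hv ⟨b, hb, hvb⟩⟩
    · obtain ⟨i, hi, hvi⟩ := hg.dom v hvB ⟨b, hsub hb, hvb⟩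
      exact ⟨i, by omega, by simpa [hi.le] using hvi⟩
  · simpa using hxy.symm

theorem IsGuard.exists_ends {G : SimpleGraph V} {B : Set V} {P : ℕ → V} {n : ℕ}
    (h : IsGuard G B P n) (hB : Conn G B) :
    ∃ P n, IsGuard G B P n ∧ (0 < n → ∃ y₁ y₂, IsPathEnds G P (n - 1) B y₁ y₂) := by
  classical
  have hex : ∃ n P, IsGuard G B P n := ⟨n, P, h⟩
  obtain ⟨P, hg⟩ := Nat.find_spec hex
  have hmin := fun m (hm : m < Nat.find hex) => Nat.find_min hex hm
  generalize Nat.find hex = n at *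
  refine ⟨P, n, hg, fun hn => ?_⟩
  have hne : ∀ v, (∃ b ∈ B, G.Adj v b) → ∀ i ≤ n - 1, v ≠ P i := by
    rintro _ ⟨b, hb, hvb⟩ i hi rfl
    exact (hg.apart i (by omega) b hb).2 hvb
  have h1 : ∃ y, (∃ b ∈ B, G.Adj y b) ∧ ∀ i ≤ n - 1, G.Adj y (P i) ↔ i = 0 := by
    by_contra! hc
    refine hmin (n - 1) (by omega) ⟨fun i => P (1 + i), ?_, fun i hi => hg.apart _ (by omega), ?_⟩
    · rcases Nat.eq_or_lt_of_le hn with rfl | hn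
      · intro i j h1 h2
        omega
      · exact hg.ip.shift (by omega)
    · intro v hv hvB
      obtain ⟨i, hi, hiff⟩ := hc v hvB
      obtain ⟨j, hj, hvj⟩ := hg.dom v hv hvB
      rcases Nat.eq_zero_or_pos j with rfl | hj0
      · rcases hiff with h | h
        · exact ⟨i - 1, by omega, by rw [show 1 + (i - 1) = i by omega]; exact h.1⟩
        · exact absurd (h.2 ▸ hvj) h.1
      · exact ⟨j - 1, by omega, by rwa [show 1 + (j - 1) = j by omega]⟩
  have h2 : ∃ y, (∃ b ∈ B, G.Adj y b) ∧ ∀ i ≤ n - 1, G.Adj y (P i) ↔ i = n - 1 := by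
    by_contra! hc
    refine hmin (n - 1) (by omega) ⟨P, hg.ip.mono (by omega), fun i hi => hg.apart _ (by omega), ?_⟩
    intro v hv hvB
    obtain ⟨i, hi, hiff⟩ := hc v hvB
    obtain ⟨j, hj, hvj⟩ := hg.dom v hv hvB
    rcases Nat.lt_or_ge j (n - 1) with hj0 | hj0
    · exact ⟨j, hj0, hvj⟩
    · obtain rfl : j = n - 1 := by omega
      rcases hiff with h | h
      · exact ⟨i, by omega, h.1⟩
      · exact absurd (h.2 ▸ hvj) h.1
  obtain ⟨y₁, hy₁, ha₁⟩ := h1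
  obtain ⟨y₂, hy₂, ha₂⟩ := h2
  exact ⟨y₁, y₂, hg.ip, hB, fun i hi => hg.apart i (by omega), hy₁, hy₂, hne _ hy₁, hne _ hy₂,
    ha₁, ha₂⟩

/-- Some set of at most `k` vertices guards `A` from big connected sets. -/
def Avoids (G : SimpleGraph V) (Big : Set V → Prop) (k : ℕ) (A : Set V) : Prop :=
  ∃ Z : Finset V, Z.card ≤ k ∧ ∀ D, Conn G D → Big D → Apart G D Z → ∀ x ∈ A, x ∉ D

theorem SmallSep.avoids {G : SimpleGraph V} {Big : Set V → Prop} (hBig : IsBigness Big) {k : ℕ}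
    {A B : Set V} (h : SmallSep G k A B) : Avoids G Big k A ∨ Avoids G Big k B := by
  obtain ⟨Z, hZ, hsep⟩ := h
  by_contra! hc
  simp only [Avoids, not_exists, not_and] at hc
  have h1 := hc.1 Z hZ
  have h2 := hc.2 Z hZ
  push Not at h1 h2
  obtain ⟨D, hD, hDb, hDZ, x, hx, hxD⟩ := h1
  obtain ⟨D', hD', hDb', hDZ', y, hy, hyD⟩ := h2
  obtain ⟨z, hz, hz'⟩ := hBig.inter hDb hDb'
  exact hsep (D ∪ D') (hD.union hD' hz hz' (Or.inl rfl)) (hDZ.union_left hDZ') x hx y hy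
    (Or.inl hxD) (Or.inr hyD)

theorem IsGuard.card_straddle {G : SimpleGraph V} {t : ℕ} (hG : MemCt t G) {B : Set V} {P : ℕ → V}
    {n : ℕ} (hg : IsGuard G B P n) (hB : Conn G B) {S : Finset V} (hS : StableSet G (S : Set V))
    (hSB : ∀ y ∈ S, ∃ b ∈ B, G.Adj y b) {a : ℕ} (hl : ∀ y ∈ S, ∃ i ≤ a, G.Adj y (P i))
    (hr : ∀ y ∈ S, ∃ i, a ≤ i ∧ i < n ∧ G.Adj y (P i)) : S.card ≤ t := by
  classical
  have h1 : (S.filter fun y => G.Adj y (P a)).card < t := by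
    refine card_lt_of_stable_nbrs hG.2.2 (v := P a)
      (hS.mono fun x hx => (Finset.mem_filter.1 hx).1) fun x hx => ?_
    exact (Finset.mem_filter.1 hx).2.symm
  have h2 : (S.filter fun y => ¬ G.Adj y (P a)).card ≤ 1 := by
    rw [Finset.card_le_one]
    intro y hy y' hy'
    rw [Finset.mem_filter] at hy hy'
    have side : ∀ y ∈ S, ¬ G.Adj y (P a) → (∃ i < a, G.Adj y (P i)) ∧
        ∃ i, a < i ∧ i ≤ n - 1 ∧ G.Adj y (P i) := by
      intro y hy hya
      obtain ⟨i, hi, hyi⟩ := hl y hy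
      obtain ⟨j, hj, hjn, hyj⟩ := hr y hy
      have hia : i ≠ a := fun e => hya (e ▸ hyi)
      have hja : j ≠ a := fun e => hya (e ▸ hyj)
      exact ⟨⟨i, by omega, hyi⟩, j, by omega, by omega, hyj⟩
    obtain ⟨j, -, hjn, -⟩ := hr y hy.1
    by_contra hne
    exact hS y hy.1 y' hy'.1 hne (adj_of_both_sides hG.1 hg.ip hB
      (fun i hi => hg.apart i (by omega)) hne (hSB y hy.1) (hSB y' hy'.1) (side y hy.1 hy.2).1
      (side y' hy'.1 hy'.2).1 (side y hy.1 hy.2).2 (side y' hy'.1 hy'.2).2)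
  have h3 := Finset.card_filter_add_card_filter_not (s := S) fun y => G.Adj y (P a)
  omega

theorem IsGuard.alphaLE_window {G : SimpleGraph V} {t : ℕ} (hG : MemCt t G) {Big : Set V → Prop}
    (hBig : IsBigness Big) {B : Set V} {P : ℕ → V} {n : ℕ} (hg : IsGuard G B P n) (hB : Conn G B)
    (hends : 0 < n → ∃ y₁ y₂, IsPathEnds G P (n - 1) B y₁ y₂) {a b : ℕ} (hb : b ≤ n)
    (ha : ∀ i ≤ n, a < i → ¬ Avoids G Big (6 * t + 1) {v | ∃ j < i, v = P j})
    (hb' : ∀ i < b, ¬ Avoids G Big (6 * t + 1) {v | ∃ j, i ≤ j ∧ j < n ∧ v = P j}) :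
    AlphaLE G {v | (∃ x ∈ B, G.Adj v x) ∧ ∃ i, a ≤ i ∧ i < b ∧ G.Adj v (P i)} (4 * t) := by
  classical
  intro S hS hst
  rcases Nat.eq_zero_or_pos n with rfl | hn
  · rw [Finset.eq_empty_of_forall_notMem (s := S) fun y hy => ?_]
    · simp
    · obtain ⟨-, i, hi, hi', -⟩ := hS hy
      omega
  obtain ⟨y₁, y₂, E⟩ := hends hn
  let S₁ := S.filter fun y => ∃ i ≤ a, G.Adj y (P i)
  let S₂ := S.filter fun y => ∃ i, b - 1 ≤ i ∧ i < n ∧ G.Adj y (P i)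
  let S₃ := S.filter fun y => y = y₁ ∨ G.Adj y y₁
  let S₄ := S.filter fun y => y = y₂ ∨ G.Adj y y₂
  have hfS : ∀ {p : V → Prop} [DecidablePred p], StableSet G ((S.filter p : Finset V) : Set V) :=
    fun {p} _ => hst.mono fun x hx => (Finset.mem_filter.1 hx).1
  have c1 : S₁.card ≤ t := by
    refine hg.card_straddle hG hB (a := a) hfS (fun y hy => (hS (Finset.mem_filter.1 hy).1).1)
      (fun y hy => (Finset.mem_filter.1 hy).2) fun y hy => ?_
    obtain ⟨-, i, hi, hi', h⟩ := hS (Finset.mem_filter.1 hy).1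
    exact ⟨i, hi, by omega, h⟩
  have c2 : S₂.card ≤ t := by
    refine hg.card_straddle hG hB (a := b - 1) hfS (fun y hy => (hS (Finset.mem_filter.1 hy).1).1)
      (fun y hy => ?_) fun y hy => (Finset.mem_filter.1 hy).2
    obtain ⟨-, i, hi, hi', h⟩ := hS (Finset.mem_filter.1 hy).1
    exact ⟨i, by omega, h⟩
  have c34 : ∀ z, (S.filter fun y => y = z ∨ G.Adj y z).card ≤ t := by
    intro z
    have := alphaLE_nbhd hG.2.2 {z} (S.filter fun y => y = z ∨ G.Adj y z) (fun y hy => by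
      exact ⟨z, by simp, (Finset.mem_filter.1 hy).2⟩) hfS
    simpa using this
  have hcov : S ⊆ S₁ ∪ (S₂ ∪ (S₃ ∪ S₄)) := by
    intro y hy
    by_contra hbad
    simp only [S₁, S₂, S₃, S₄, Finset.mem_union, Finset.mem_filter, hy, true_and, not_or] at hbad
    obtain ⟨n1, n2, n3, n4⟩ := hbad
    obtain ⟨hyB, i, hia, hib, hyi⟩ := hS hy
    have hex : ∃ j, G.Adj y (P j) := ⟨i, hyi⟩
    have hl := Nat.find_spec hex
    have hlmin : ∀ j, G.Adj y (P j) → Nat.find hex ≤ j := fun j hj => Nat.find_min' hex hj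
    obtain ⟨r, hrn, hr, hrmax⟩ : ∃ r ≤ n - 1, G.Adj y (P r) ∧
        ∀ j ≤ n - 1, G.Adj y (P j) → j ≤ r :=
      ⟨_, Nat.findGreatest_le _, Nat.findGreatest_spec (P := fun j => G.Adj y (P j))
        (show i ≤ n - 1 by omega) hyi, fun j hj hj' => Nat.le_findGreatest hj hj'⟩
    generalize Nat.find hex = l at hl hlmin
    have h1 : a < l := by
      by_contra! h
      exact n1 ⟨l, h, hl⟩
    have h2 : r < b - 1 := by
      by_contra! h
      exact n2 ⟨r, h, by omega, hr⟩
    have hli := hlmin i hyi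
    have hir := hrmax i (by omega) hyi
    have hsep := E.smallSep hG hyB (fun j hj => ?_) (l := l) (r := r) (by omega) (by omega)
      (by omega) hl hr (fun j hj h => ⟨hlmin j h, hrmax j hj h⟩) n3 n4
    · rcases hsep.avoids hBig with h | h
      · exact ha l (by omega) h1 h
      · obtain ⟨Z, hZ, h⟩ := h
        refine hb' (r + 1) (by omega) ⟨Z, hZ, fun D hD hDb hDZ x hx => h D hD hDb hDZ x ?_⟩
        obtain ⟨j, hj, hj', e⟩ := hx
        exact ⟨j, by omega, by omega, e⟩
    · rintro rfl
      obtain ⟨x, hx, hyx⟩ := hyB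
      exact (hg.apart j (by omega) x hx).2 hyx
  have e0 := Finset.card_le_card hcov
  have e1 := Finset.card_union_le S₁ (S₂ ∪ (S₃ ∪ S₄))
  have e2 := Finset.card_union_le S₂ (S₃ ∪ S₄)
  have e3 := Finset.card_union_le S₃ S₄
  have e4 : S₃.card ≤ t := c34 y₁
  have e5 : S₄.card ≤ t := c34 y₂
  omega

theorem IsBigness.exists_separator [Finite V] {G : SimpleGraph V} {t : ℕ} (hG : MemCt t G)
    {Big : Set V → Prop} (hBig : IsBigness Big) :
    ∃ X, AlphaLE G X ((2 * (6 * t + 1) * (2 * t + 1) + 1) * t + 4 * t) ∧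
      ∀ D, Conn G D → Big D → ∃ x ∈ D, x ∈ X := by
  classical
  by_cases hD₀ : ∃ D, Conn G D ∧ Big D
  swap
  · push Not at hD₀
    refine ⟨∅, fun S hS _ => ?_, fun D hD hDb => absurd hDb (hD₀ D hD)⟩
    rw [Set.subset_empty_iff, Finset.coe_eq_empty] at hS
    simp [hS]
  obtain ⟨D₀, hD₀, hD₀'⟩ := hD₀
  obtain ⟨B, P₀, n₀, p, hB, hBb, hg₀, hp⟩ := hBig.exists_guard hD₀ hD₀'
  obtain ⟨P, n, hg, hends⟩ := hg₀.exists_ends hB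
  let L : ℕ → Prop := fun i => Avoids G Big (6 * t + 1) {v | ∃ j < i, v = P j}
  let R : ℕ → Prop := fun i => Avoids G Big (6 * t + 1) {v | ∃ j, i ≤ j ∧ j < n ∧ v = P j}
  have hL0 : L 0 := ⟨∅, by simp, by rintro D - - - x ⟨j, hj, -⟩; omega⟩
  have hRn : ∃ i, R i := ⟨n, ∅, by simp, by rintro D - - - x ⟨j, hj, hj', -⟩; omega⟩
  obtain ⟨a, -, ⟨Z₁, hZ₁, hav₁⟩, ha⟩ : ∃ a ≤ n, L a ∧ ∀ i ≤ n, a < i → ¬ L i :=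
    ⟨_, Nat.findGreatest_le _, Nat.findGreatest_spec (P := L) (Nat.zero_le n) hL0,
      fun i hi h hL => absurd (Nat.le_findGreatest hi hL) (by omega)⟩
  obtain ⟨b, hbn, ⟨Z₂, hZ₂, hav₂⟩, hb⟩ : ∃ b ≤ n, R b ∧ ∀ i < b, ¬ R i :=
    ⟨_, Nat.find_min' hRn ⟨∅, by simp, by rintro D - - - x ⟨j, hj, hj', -⟩; omega⟩,
      Nat.find_spec hRn, fun i hi => Nat.find_min hRn hi⟩
  have hY := hg.alphaLE_window hG hBig hB hends hbn ha hb
  set Y := {v | (∃ x ∈ B, G.Adj v x) ∧ ∃ i, a ≤ i ∧ i < b ∧ G.Adj v (P i)}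
  have ht := pos_of_not_containsK1t hG.2.2 p
  let W : Finset V := (Z₁ ∪ Z₂).biUnion fun z =>
    insert z (((Finset.range (n - 1 + 1)).filter fun i => G.Adj z (P i)).image P)
  have hWc : W.card ≤ (2 * (6 * t + 1)) * (2 * t) := by
    refine (Finset.card_biUnion_le_card_mul _ _ (2 * t) fun z _ => ?_).trans
      (Nat.mul_le_mul_right _ ?_)
    · have h1 := Finset.card_insert_le z
        (((Finset.range (n - 1 + 1)).filter fun i => G.Adj z (P i)).image P)
      have h2 := Finset.card_image_le (f := P)
        (s := (Finset.range (n - 1 + 1)).filter fun i => G.Adj z (P i))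
      have h3 := hg.ip.card_nbrs hG.2.2 z
      omega
    · have := Finset.card_union_le Z₁ Z₂
      omega
  have hW : ∀ z ∈ Z₁ ∪ Z₂, ∀ i < n, (P i = z ∨ G.Adj z (P i)) → P i ∈ W := by
    rintro z hz i hi h
    refine Finset.mem_biUnion.2 ⟨z, hz, ?_⟩
    rw [Finset.mem_insert, Finset.mem_image]
    rcases h with h | h
    · exact Or.inl h
    · exact Or.inr ⟨i, Finset.mem_filter.2 ⟨Finset.mem_range.2 (by omega), h⟩, rfl⟩
  let U : Finset V := insert p (Z₁ ∪ Z₂ ∪ W)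
  have hUc : U.card ≤ 2 * (6 * t + 1) * (2 * t + 1) + 1 := by
    have h1 : U.card ≤ (Z₁ ∪ Z₂ ∪ W).card + 1 := Finset.card_insert_le _ _
    have h2 := Finset.card_union_le (Z₁ ∪ Z₂) W
    have h3 := Finset.card_union_le Z₁ Z₂
    rw [Nat.mul_add_one]
    omega
  refine ⟨{v | ∃ z ∈ U, v = z ∨ G.Adj v z} ∪ Y,
    ((alphaLE_nbhd hG.2.2 U).mono subset_rfl (Nat.mul_le_mul_right _ hUc)).union hY,
    fun D hD hDb => ?_⟩
  by_contra! hDX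
  have hDU : ∀ z ∈ U, ∀ x ∈ D, x ≠ z ∧ ¬ G.Adj x z := by
    intro z hz x hx
    constructor
    · rintro rfl
      exact hDX x hx (Or.inl ⟨x, hz, Or.inl rfl⟩)
    · exact fun e => hDX x hx (Or.inl ⟨z, hz, Or.inr e⟩)
  have hZU : ∀ z ∈ Z₁ ∪ Z₂, z ∈ U := fun z hz =>
    Finset.mem_insert_of_mem (Finset.mem_union_left _ hz)
  have hWU : ∀ z ∈ W, z ∈ U := fun z hz => Finset.mem_insert_of_mem (Finset.mem_union_right _ hz)
  have hDP : ∀ x ∈ D, ∀ i < n, G.Adj x (P i) → a ≤ i ∧ i < b := by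
    intro x hx i hi hxi
    have hap : ∀ Z ⊆ Z₁ ∪ Z₂, Apart G (insert (P i) D) Z := by
      rintro Z hZ v (rfl | hv) z hz
      · by_contra hc
        have hPW : P i ∈ W := by
          refine hW z (hZ hz) i hi ?_
          by_contra! h
          exact hc ⟨h.1, fun e => h.2 e.symm⟩
        exact (hDU _ (hWU _ hPW) x hx).2 hxi
      · exact hDU z (hZU z (hZ hz)) v hv
    have hc := hD.insert hx hxi.symm
    have hcb := hBig.mono hDb (Set.subset_insert (P i) D)
    by_contra hab
    rcases Nat.lt_or_ge i a with h | h
    · exact hav₁ _ hc hcb (hap _ Finset.subset_union_left) _ ⟨i, h, rfl⟩ (Set.mem_insert _ _)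
    · exact hav₂ _ hc hcb (hap _ Finset.subset_union_right) _ ⟨i, by omega, hi, rfl⟩
        (Set.mem_insert _ _)
  have hDB : D ⊆ B := by
    by_contra hnot
    obtain ⟨v, hv, hvB⟩ := Set.not_subset.1 hnot
    obtain ⟨x, hxD, hxB⟩ := hBig.inter hDb hBb
    obtain ⟨z, hz, y, hy, hyB, hzy⟩ := (hD x hxD v hv).exists_exit hxB hvB
    obtain ⟨i, hi, hyi⟩ := hg.dom y hyB ⟨z, hz, hzy.symm⟩
    obtain ⟨h1, h2⟩ := hDP y hy i hi hyi
    exact hDX y hy (Or.inr ⟨⟨z, hz, hzy.symm⟩, i, h1, h2, hyi⟩)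
  obtain ⟨x, hx, hxp⟩ := hp D hDB hD hDb
  have := hDU p (Finset.mem_insert_self _ _) x hx
  tauto

/-! ### Halving sets -/

theorem isBigness_half (I : Finset V) [DecidableEq V] :
    IsBigness fun D : Set V => ∃ J ⊆ I, ↑J ⊆ D ∧ I.card < 2 * J.card where
  mono := fun ⟨J, hJI, hJ, h⟩ hD => ⟨J, hJI, hJ.trans hD, h⟩
  inter := by
    rintro D D' ⟨J, hJI, hJ, h⟩ ⟨J', hJI', hJ', h'⟩
    have h1 := Finset.card_union_add_card_inter J J'
    have h2 := Finset.card_le_card (Finset.union_subset hJI hJI')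
    obtain ⟨x, hx⟩ := Finset.card_pos.1 (show 0 < (J ∩ J').card by omega)
    rw [Finset.mem_inter] at hx
    exact ⟨x, hJ hx.1, hJ' hx.2⟩

/-- Sets of independence number at most `K` can halve every finite set of vertices. -/
def HalvingLE (G : SimpleGraph V) (K : ℕ) : Prop :=
  ∀ I : Finset V, ∃ X, AlphaLE G X K ∧
    ∀ D, Conn G D → (∀ x ∈ D, x ∉ X) → ∀ J ⊆ I, ↑J ⊆ D → 2 * J.card ≤ I.card

theorem MemCt.halvingLE [Finite V] {G : SimpleGraph V} {t : ℕ} (hG : MemCt t G) :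
    HalvingLE G ((2 * (6 * t + 1) * (2 * t + 1) + 1) * t + 4 * t) := by
  classical
  intro I
  obtain ⟨X, hX, h⟩ := (isBigness_half I).exists_separator hG
  refine ⟨X, hX, fun D hD hDX J hJI hJ => ?_⟩
  by_contra! hc
  obtain ⟨x, hx, hxX⟩ := h D hD ⟨J, hJI, hJ, hc⟩
  exact hDX x hx hxX

/-! ### Rooted tree decompositions -/

/-- `bag` is a tree decomposition of the subgraph of `G` induced on `U`, with bags of independence
number at most `k`. -/
structure IsDecomp (G : SimpleGraph V) (k : ℕ) (U : Set V) {ι : Type} (T : SimpleGraph ι)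
    (bag : ι → Set V) : Prop where
  isTree : T.IsTree
  alphaLE : ∀ i, AlphaLE G (bag i) k
  subset : ∀ i, bag i ⊆ U
  mem_bag : ∀ v ∈ U, ∃ i, v ∈ bag i
  edge_bag : ∀ u ∈ U, ∀ v ∈ U, G.Adj u v → ∃ i, u ∈ bag i ∧ v ∈ bag i
  bag_connected : ∀ v ∈ U, (T.induce {i | v ∈ bag i}).Connected

/-- The subgraph induced on `U` has a tree decomposition with bags of independence number at most
`k`, one of which contains `R`. -/
def HasDecomp (G : SimpleGraph V) (k : ℕ) (U R : Set V) : Prop :=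
  ∃ (ι : Type) (T : SimpleGraph ι) (bag : ι → Set V) (r : ι), IsDecomp G k U T bag ∧ R ⊆ bag r

theorem AlphaLE.hasDecomp {G : SimpleGraph V} {k : ℕ} {U : Set V} (h : AlphaLE G U k) :
    HasDecomp G k U U := by
  refine ⟨Unit, ⊥, fun _ => U, (), ⟨.of_subsingleton, fun _ => h, fun _ => subset_rfl,
    fun v hv => ⟨(), hv⟩, fun u hu v hv _ => ⟨(), hu, hv⟩, fun v hv => ?_⟩, subset_rfl⟩
  have : Nonempty {i : Unit | v ∈ U} := ⟨⟨(), hv⟩⟩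
  exact ⟨fun a b => by rw [Subsingleton.elim a b]⟩

theorem exists_reachable_of_sum {ι κ : Type} {S : SimpleGraph ι} {T : SimpleGraph κ}
    {E : Set (Sym2 (ι ⊕ κ))} {a : ι} {x : ι ⊕ κ}
    (h : ((S ⊕g T).deleteEdges E).Reachable (Sum.inl a) x) :
    ∃ b, x = Sum.inl b ∧ (S.deleteEdges (Sym2.map Sum.inl ⁻¹' E)).Reachable a b := by
  rw [reachable_iff_reflTransGen] at h
  induction h with
  | refl => exact ⟨a, rfl, .refl a⟩
  | @tail y z _ h ih =>
    obtain ⟨b, rfl, hb⟩ := ih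
    rcases z with c | c
    · refine ⟨c, rfl, hb.trans (Adj.reachable ?_)⟩
      simpa using h
    · simp at h

theorem IsAcyclic.sum {ι κ : Type} {S : SimpleGraph ι} {T : SimpleGraph κ} (hS : S.IsAcyclic)
    (hT : T.IsAcyclic) : (S ⊕g T).IsAcyclic := by
  rw [isAcyclic_iff_forall_adj_isBridge] at *
  have key : ∀ {ι κ : Type} {S : SimpleGraph ι} {T : SimpleGraph κ},
      (∀ ⦃v w⦄, S.Adj v w → S.IsBridge s(v, w)) → ∀ {a b}, S.Adj a b →
      (S ⊕g T).IsBridge s(Sum.inl a, Sum.inl b) := by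
    intro ι κ S T hS a b hab
    rw [isBridge_iff]
    intro h
    obtain ⟨c, hc, h⟩ := exists_reachable_of_sum h
    obtain rfl := Sum.inl_injective hc
    refine isBridge_iff.1 (hS hab) (h.mono fun x y hxy => ?_)
    rw [deleteEdges_adj] at hxy ⊢
    refine ⟨hxy.1, fun h' => hxy.2 ?_⟩
    rw [Set.mem_singleton_iff] at h'
    simp [h']
  rintro (a | a) (b | b) h
  · exact key hS h
  · simp at h
  · simp at h
  · intro hr
    let f : (S ⊕g T).deleteEdges {s(Sum.inr a, Sum.inr b)} →g
        (T ⊕g S).deleteEdges {s(Sum.inl a, Sum.inl b)} := ⟨Sum.swap, by simp +contextual⟩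
    exact key hT h (hr.map f)

theorem isTree_sum_sup_edge {ι κ : Type} {S : SimpleGraph ι} {T : SimpleGraph κ} (hS : S.IsTree)
    (hT : T.IsTree) (a : ι) (b : κ) : ((S ⊕g T) ⊔ edge (Sum.inl a) (Sum.inr b)).IsTree := by
  refine ⟨hS.connected.sum_sup_edge hT.connected, ?_⟩
  refine IsAcyclic.sup_edge_of_not_reachable (not_reachable_sum_inl_inr a b)
    (IsAcyclic.sum hS.isAcyclic hT.isAcyclic)

theorem HasDecomp.glue {G : SimpleGraph V} {k : ℕ} {U₁ U₂ R₁ R₂ : Set V}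
    (h₁ : HasDecomp G k U₁ R₁) (h₂ : HasDecomp G k U₂ R₂) (hU₁ : U₁ ∩ U₂ ⊆ R₁)
    (hU₂ : U₁ ∩ U₂ ⊆ R₂)
    (hadj : ∀ x ∈ U₁, ∀ y ∈ U₂, G.Adj x y → x ∈ U₂ ∨ y ∈ U₁) :
    HasDecomp G k (U₁ ∪ U₂) R₁ := by
  obtain ⟨ι₁, T₁, bag₁, r₁, h₁, hr₁⟩ := h₁
  obtain ⟨ι₂, T₂, bag₂, r₂, h₂, hr₂⟩ := h₂
  refine ⟨ι₁ ⊕ ι₂, (T₁ ⊕g T₂) ⊔ edge (Sum.inl r₁) (Sum.inr r₂), Sum.elim bag₁ bag₂, Sum.inl r₁,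
    ⟨isTree_sum_sup_edge h₁.isTree h₂.isTree r₁ r₂, ?_, ?_, ?_, ?_, ?_⟩, hr₁⟩
  · rintro (i | i)
    exacts [h₁.alphaLE i, h₂.alphaLE i]
  · rintro (i | i)
    exacts [(h₁.subset i).trans Set.subset_union_left, (h₂.subset i).trans Set.subset_union_right]
  · rintro v (hv | hv)
    · obtain ⟨i, hi⟩ := h₁.mem_bag v hv
      exact ⟨.inl i, hi⟩
    · obtain ⟨i, hi⟩ := h₂.mem_bag v hv
      exact ⟨.inr i, hi⟩
  · have e₁ : ∀ u ∈ U₁, ∀ v ∈ U₁, G.Adj u v →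
        ∃ i, u ∈ Sum.elim bag₁ bag₂ i ∧ v ∈ Sum.elim bag₁ bag₂ i := fun u hu v hv h => by
      obtain ⟨i, hi⟩ := h₁.edge_bag u hu v hv h
      exact ⟨.inl i, hi⟩
    have e₂ : ∀ u ∈ U₂, ∀ v ∈ U₂, G.Adj u v →
        ∃ i, u ∈ Sum.elim bag₁ bag₂ i ∧ v ∈ Sum.elim bag₁ bag₂ i := fun u hu v hv h => by
      obtain ⟨i, hi⟩ := h₂.edge_bag u hu v hv h
      exact ⟨.inr i, hi⟩
    rintro u (hu | hu) v (hv | hv) h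
    · exact e₁ u hu v hv h
    · rcases hadj u hu v hv h with h' | h'
      exacts [e₂ u h' v hv h, e₁ u hu v h' h]
    · rcases hadj v hv u hu h.symm with h' | h'
      exacts [e₂ u hu v h' h, e₁ u h' v hv h]
    · exact e₂ u hu v hv h
  · intro v hv
    set T := (T₁ ⊕g T₂) ⊔ edge (Sum.inl r₁) (Sum.inr r₂) with hT
    set A : Set (ι₁ ⊕ ι₂) := {i | v ∈ Sum.elim bag₁ bag₂ i} with hA
    let f₁ : T₁.induce {i | v ∈ bag₁ i} →g T.induce A :=
      ⟨fun i => ⟨.inl i.1, i.2⟩, fun {a b} h => Or.inl h⟩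
    let f₂ : T₂.induce {i | v ∈ bag₂ i} →g T.induce A :=
      ⟨fun i => ⟨.inr i.1, i.2⟩, fun {a b} h => Or.inl h⟩
    have c₁ : ∀ i j (hi : v ∈ bag₁ i) (hj : v ∈ bag₁ j),
        (T.induce A).Reachable ⟨.inl i, hi⟩ ⟨.inl j, hj⟩ := fun i j hi hj =>
      ((h₁.bag_connected v (h₁.subset i hi)).preconnected ⟨i, hi⟩ ⟨j, hj⟩).map f₁
    have c₂ : ∀ i j (hi : v ∈ bag₂ i) (hj : v ∈ bag₂ j),
        (T.induce A).Reachable ⟨.inr i, hi⟩ ⟨.inr j, hj⟩ := fun i j hi hj =>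
      ((h₂.bag_connected v (h₂.subset i hi)).preconnected ⟨i, hi⟩ ⟨j, hj⟩).map f₂
    have c₃ : ∀ i j (hi : v ∈ bag₁ i) (hj : v ∈ bag₂ j),
        (T.induce A).Reachable ⟨.inl i, hi⟩ ⟨.inr j, hj⟩ := fun i j hi hj => by
      have hv' : v ∈ U₁ ∩ U₂ := ⟨h₁.subset i hi, h₂.subset j hj⟩
      have hv₁ : v ∈ bag₁ r₁ := hr₁ (hU₁ hv')
      have hv₂ : v ∈ bag₂ r₂ := hr₂ (hU₂ hv')
      have : (T.induce A).Adj ⟨.inl r₁, hv₁⟩ ⟨.inr r₂, hv₂⟩ := by simp [hT, edge]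
      exact (c₁ i r₁ hi hv₁).trans (this.reachable.trans (c₂ r₂ j hv₂ hj))
    have hne : Nonempty A := by
      rcases hv with hv | hv
      · obtain ⟨i, hi⟩ := h₁.mem_bag v hv
        exact ⟨⟨.inl i, hi⟩⟩
      · obtain ⟨i, hi⟩ := h₂.mem_bag v hv
        exact ⟨⟨.inr i, hi⟩⟩
    refine ⟨?_⟩
    rintro ⟨i | i, hi⟩ ⟨j | j, hj⟩
    exacts [c₁ i j hi hj, c₃ i j hi hj, (c₃ j i hj hi).symm, c₂ i j hi hj]

/-! ### Decompositions from halving sets -/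

theorem exists_component {G : SimpleGraph V} {A : Set V} {x : V} (hx : x ∈ A) :
    ∃ D ⊆ A, x ∈ D ∧ Conn G D ∧ ∀ y ∈ D, ∀ z ∈ A, G.Adj y z → z ∈ D := by
  refine ⟨{y | Reaches G A x y}, fun y hy => hy.right_mem, .refl hx, ?_,
    fun y hy z hz h => hy.trans (.of_adj h hy.right_mem hz)⟩
  have key : ∀ y, Reaches G A x y → Reaches G {y | Reaches G A x y} x y := by
    intro y hy
    refine hy.induction (.refl (.refl hx)) fun a b ha hab hb => ?_
    have ha' : Reaches G A x a := ha.right_mem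
    exact ha.trans (.of_adj hab ha' (ha'.trans (.of_adj hab ha'.right_mem hb)))
  exact fun u hu v hv => (key u hu).symm.trans (key v hv)

theorem exists_alphaLE_card [Finite V] {G : SimpleGraph V} (A : Set V) :
    ∃ I : Finset V, ↑I ⊆ A ∧ StableSet G ↑I ∧ AlphaLE G A I.card := by
  obtain ⟨I, ⟨hI, hI'⟩, hmax⟩ := Set.Finite.exists_maximalFor (fun S : Finset V => S.card)
    {S : Finset V | ↑S ⊆ A ∧ StableSet G ↑S} (Set.toFinite _) ⟨∅, by simp [StableSet]⟩
  refine ⟨I, hI, hI', fun S hS hS' => ?_⟩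
  by_contra! hc
  exact absurd (hmax ⟨hS, hS'⟩ hc.le) (by simpa using hc)

theorem HalvingLE.exists_split [Finite V] {G : SimpleGraph V} {K m : ℕ} (hK : HalvingLE G K)
    {S : Set V} (hS : AlphaLE G S m) :
    ∃ X, AlphaLE G X K ∧ ∀ U, S ⊆ U → ∀ D ⊆ U \ X, Conn G D →
      (∀ y ∈ D, ∀ z ∈ U \ X, G.Adj y z → z ∈ D) → AlphaLE G (S ∩ D) (m / 2 + K) := by
  classical
  obtain ⟨I, hIS, hI, hmax⟩ := exists_alphaLE_card (G := G) S
  obtain ⟨X, hX, hhalf⟩ := hK I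
  refine ⟨X, hX, fun U hU D hDU hD hcl J hJ hJs => ?_⟩
  have hIm := hS I hIS hI
  have h1 := hhalf D hD (fun x hx => (hDU hx).2) (I.filter (· ∈ D)) (Finset.filter_subset _ _)
    (by intro x hx; simp at hx; exact hx.2)
  have h2 := hX (I.filter (· ∈ X)) (by intro x hx; simp at hx; exact hx.2)
    (hI.mono (by intro x hx; simp at hx; exact hx.1))
  set L := I.filter fun x => x ∉ D ∧ x ∉ X with hL
  have hLD : ∀ x ∈ L, x ∈ I ∧ x ∉ D ∧ x ∉ X := fun x hx => Finset.mem_filter.1 hx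
  have hanti : ∀ x ∈ J, ∀ y ∈ L, ¬ G.Adj x y := fun x hx y hy h =>
    (hLD y hy).2.1 (hcl x (hJ hx).2 y ⟨hU (hIS (hLD y hy).1), (hLD y hy).2.2⟩ h)
  have h3 := hmax (J ∪ L) (by
    intro x hx
    rcases Finset.mem_union.1 (Finset.mem_coe.1 hx) with h | h
    exacts [(hJ h).1, hIS (hLD x h).1]) (by
    intro x hx y hy
    rcases Finset.mem_union.1 (Finset.mem_coe.1 hx) with h | h <;>
      rcases Finset.mem_union.1 (Finset.mem_coe.1 hy) with h' | h'
    · exact hJs x h y h'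
    · exact fun _ => hanti x h y h'
    · exact fun _ e => hanti y h' x h e.symm
    · exact hI x (hLD x h).1 y (hLD y h').1)
  have hdisj : Disjoint J L := Finset.disjoint_left.2 fun x hx hx' => (hLD x hx').2.1 (hJ hx).2
  rw [Finset.card_union_of_disjoint hdisj] at h3
  have h4 : I ⊆ I.filter (· ∈ D) ∪ (I.filter (· ∈ X) ∪ L) := by
    intro x hx
    simp only [hL, Finset.mem_union, Finset.mem_filter]
    tauto
  have h5 := Finset.card_le_card h4
  have h6 := Finset.card_union_le (I.filter (· ∈ D)) (I.filter (· ∈ X) ∪ L)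
  have h7 := Finset.card_union_le (I.filter (· ∈ X)) L
  omega

theorem HalvingLE.hasDecomp [Finite V] {G : SimpleGraph V} {K : ℕ} (hK : HalvingLE G K)
    (U S : Set V) (hSU : S ⊆ U) (hS : AlphaLE G S (4 * K + 1)) :
    HasDecomp G (5 * K + 2) U S := by
  induction hn : (U \ S).ncard using Nat.strong_induction_on generalizing U S with
  | _ n ih =>
  by_cases hUS : U ⊆ S
  · obtain rfl := hSU.antisymm hUS
    exact (hS.mono subset_rfl (by omega)).hasDecomp
  obtain ⟨v, hvU, hvS⟩ := Set.not_subset.1 hUS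
  have hS' : AlphaLE G (insert v S) (4 * K + 2) := by
    intro J hJ hJs
    classical
    have h1 := hS (J.erase v) (by
      intro x hx
      rw [Finset.mem_coe, Finset.mem_erase] at hx
      exact (hJ hx.2).resolve_left hx.1) (hJs.mono (by simp))
    have := Finset.pred_card_le_card_erase (s := J) (a := v)
    omega
  have hSU' : insert v S ⊆ U := Set.insert_subset hvU hSU
  obtain ⟨X, hX, hsplit⟩ := hK.exists_split hS'
  have hW : insert v S ∪ X ∩ U ⊆ U := Set.union_subset hSU' Set.inter_subset_right
  have key : ∀ C ⊆ U \ X, (∀ y ∈ C, ∀ z ∈ U \ X, G.Adj y z → z ∈ C) →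
      HasDecomp G (5 * K + 2) (C ∪ (insert v S ∪ X ∩ U)) (insert v S ∪ X ∩ U) := by
    intro C hC hcl
    induction hm : C.ncard using Nat.strong_induction_on generalizing C with
    | _ m ihC =>
    rcases C.eq_empty_or_nonempty with rfl | ⟨x, hx⟩
    · rw [Set.empty_union]
      exact ((hS'.union (hX.mono Set.inter_subset_left le_rfl)).mono subset_rfl
        (by omega)).hasDecomp
    obtain ⟨D, hDU, hxD, hD, hDcl⟩ := exists_component (G := G) (hC hx)
    have hDC : D ⊆ C := fun y hy =>
      ((hD x hxD y hy).mono hDU).induction hx fun a b ha hab hb => hcl a ha b hb hab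
    have d₁ := ihC (C \ D).ncard
      (hm ▸ Set.ncard_lt_ncard ⟨Set.sdiff_subset, fun h => (h hx).2 hxD⟩) (C \ D)
      (Set.sdiff_subset.trans hC)
      (fun y hy z hz h => ⟨hcl y hy.1 z hz h, fun hzD =>
        hy.2 (hDcl z hzD y (hC hy.1) h.symm)⟩) rfl
    have d₂ := ih ((D ∪ X ∩ U) \ (insert v S ∩ D ∪ X ∩ U)).ncard
      (by
        rw [← hn]
        refine Set.ncard_lt_ncard ⟨?_, fun h => ?_⟩
        · rintro y ⟨hy | hy, hy'⟩
          · exact ⟨(hDU hy).1, fun h => hy' (Or.inl ⟨Or.inr h, hy⟩)⟩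
          · exact absurd (Or.inr hy) hy'
        · obtain ⟨h1 | h1, h2⟩ := h ⟨hvU, hvS⟩
          · exact h2 (Or.inl ⟨Set.mem_insert _ _, h1⟩)
          · exact h2 (Or.inr h1))
      (D ∪ X ∩ U) (insert v S ∩ D ∪ X ∩ U)
      (Set.union_subset_union_left _ Set.inter_subset_right)
      (((hsplit U hSU' D hDU hD hDcl).union (hX.mono Set.inter_subset_left le_rfl)).mono
        subset_rfl (by omega)) rfl
    have hsub : ((C \ D) ∪ (insert v S ∪ X ∩ U)) ∩ (D ∪ X ∩ U) ⊆ insert v S ∩ D ∪ X ∩ U := by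
      rintro y ⟨⟨-, hy⟩ | hy | hy, hy' | hy'⟩
      · exact absurd hy' hy
      · exact Or.inr hy'
      · exact Or.inl ⟨hy, hy'⟩
      · exact Or.inr hy'
      · exact Or.inr hy
      · exact Or.inr hy'
    convert d₁.glue d₂ (hsub.trans (Set.union_subset_union_left _ Set.inter_subset_left)) hsub
      (fun y hy z hz h => ?_) using 1
    · ext y
      have := @hDC y
      simp only [Set.mem_union, Set.mem_sdiff]
      tauto
    · by_cases hyX : y ∈ X ∩ U
      · exact Or.inl (Or.inr hyX)
      have hyU : y ∈ U := hy.elim (fun h => (hC h.1).1) fun h => hW h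
      rcases hz with hz | hz
      · exact Or.inl (Or.inl (hDcl z hz y ⟨hyU, fun h => hyX ⟨h, hyU⟩⟩ h.symm))
      · exact Or.inr (Or.inr (Or.inr hz))
  obtain ⟨ι, T, bag, r, h, hr⟩ := key (U \ X) subset_rfl fun y _ z hz _ => hz
  have hU : U \ X ∪ (insert v S ∪ X ∩ U) = U := by
    refine (Set.union_subset Set.sdiff_subset hW).antisymm fun y hy => ?_
    by_cases hyX : y ∈ X
    exacts [Or.inr (Or.inr ⟨hyX, hy⟩), Or.inl ⟨hy, hyX⟩]
  rw [hU] at h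
  exact ⟨ι, T, bag, r, h, fun y hy => hr (Or.inl (Or.inr hy))⟩

theorem HasDecomp.treeAlphaLE {G : SimpleGraph V} {k : ℕ} {R : Set V}
    (h : HasDecomp G k Set.univ R) : TreeAlphaLE G k := by
  obtain ⟨ι, T, bag, r, h, -⟩ := h
  exact ⟨⟨ι, T, h.isTree, bag, fun v => h.mem_bag v trivial,
    fun u v => h.edge_bag u trivial v trivial, fun v => h.bag_connected v trivial⟩, h.alphaLE⟩

/-- For every positive integer `t` there is `τ` such that every
(theta, prism, `K_{1,t}`)-free graph has tree independence number at most `τ`. -/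
theorem statement_0 :
    ∀ t : ℕ, 0 < t → ∃ τ : ℕ, 0 < τ ∧
      ∀ (V : Type) [Fintype V], ∀ (G : SimpleGraph V),
        MemCt t G → TreeAlphaLE G τ := by
  intro t _
  exact ⟨5 * ((2 * (6 * t + 1) * (2 * t + 1) + 1) * t + 4 * t) + 2, by omega, fun V _ G hG =>
    (hG.halvingLE.hasDecomp Set.univ ∅ (Set.empty_subset _) fun S hS _ => by
      rw [Set.subset_empty_iff, Finset.coe_eq_empty] at hS
      simp [hS]).treeAlphaLE⟩
end Paper
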